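/- arXiv:2407.21119 — 12 statements merged into one kernel-verified Lean document; each statement's English description precedes it below -/
import Mathlib

section
/- The regression estimand τ is a vector of causal contrasts under the true design π* (i.e., τ satisfies level irrelevance under π*) if and only if π* is an (improper) implicit design, that is, Σ_{w∈𝒲} π*_i(w) ρ_i(w) = 0 for every unit i. Moreover, when this holds and the implicit design is unique, that unique implicit design (namely π*) is proper and Gram-consistent. -/
open Matrix BigOperators

namespace Stmt0

/-- Gram matrix `G_n(π)` of a design `π` for covariate transform `z`. -/
noncomputable def gram (n T K : ℕ) (W : Type) [Fintype W]
    (z : Fin n → Fin T → W → Fin K → ℝ) (π : Fin n → W → ℝ) :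
    Matrix (Fin K) (Fin K) ℝ :=
  (n : ℝ)⁻¹ • ∑ i : Fin n, ∑ t : Fin T, ∑ w : W, π i w • vecMulVec (z i t w) (z i t w)

/-- Potential weights `ρ_i(w) = Λ G_n⁻¹ 𝐳(x_i,w)' ∈ ℝ^{k×T}`, defined relative to the
true design `πs` (through its Gram matrix). -/
noncomputable def potWeight (n T K k : ℕ) (W : Type) [Fintype W]
    (z : Fin n → Fin T → W → Fin K → ℝ) (Λ : Matrix (Fin k) (Fin K) ℝ)
    (πs : Fin n → W → ℝ) (i : Fin n) (w : W) : Matrix (Fin k) (Fin T) ℝ :=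
  Λ * (gram n T K W z πs)⁻¹ * (Matrix.of fun t j => z i t w j)ᵀ

/-- The regression estimand `τ = Λ G_n⁻¹ (1/n) Σ_{i,t,w} π*_i(w) z_t(x_i,w) y_{it}(w)`,
as a function of the potential outcomes `y`. -/
noncomputable def estimand (n T K k : ℕ) (W : Type) [Fintype W]
    (z : Fin n → Fin T → W → Fin K → ℝ) (Λ : Matrix (Fin k) (Fin K) ℝ)
    (πs : Fin n → W → ℝ) (y : Fin n → W → Fin T → ℝ) : Fin k → ℝ :=
  (Λ * (gram n T K W z πs)⁻¹) *ᵥ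
    ((n : ℝ)⁻¹ • ∑ i : Fin n, ∑ t : Fin T, ∑ w : W, (πs i w * y i w t) • z i t w)

/-- `τ` is a vector of causal contrasts under `πs`: level irrelevance, i.e. the estimand
is unchanged when every potential outcome `y_{it}(w)` is replaced by `y_{it}(w) + c_{it}`. -/
def LevelIrrelevance (n T K k : ℕ) (W : Type) [Fintype W]
    (z : Fin n → Fin T → W → Fin K → ℝ) (Λ : Matrix (Fin k) (Fin K) ℝ)
    (πs : Fin n → W → ℝ) : Prop :=
  ∀ (y : Fin n → W → Fin T → ℝ) (c : Fin n → Fin T → ℝ),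
    estimand n T K k W z Λ πs (fun i w t => y i w t + c i t) = estimand n T K k W z Λ πs y

/-- `q` is an (improper) implicit design: it solves the level-irrelevance equations
`Σ_w q_i(w) ρ_i(w) = 0` and sums to one for every unit. -/
def ImplicitDesign (n T K k : ℕ) (W : Type) [Fintype W]
    (z : Fin n → Fin T → W → Fin K → ℝ) (Λ : Matrix (Fin k) (Fin K) ℝ)
    (πs : Fin n → W → ℝ) (q : Fin n → W → ℝ) : Prop :=
  (∀ i, ∑ w : W, q i w • potWeight n T K k W z Λ πs i w = 0) ∧ (∀ i, ∑ w : W, q i w = 1)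

theorem estimand_apply (n T K k : ℕ) (W : Type) [Fintype W]
    (z : Fin n → Fin T → W → Fin K → ℝ) (Λ : Matrix (Fin k) (Fin K) ℝ)
    (πs : Fin n → W → ℝ) (y : Fin n → W → Fin T → ℝ) (a : Fin k) :
    estimand n T K k W z Λ πs y a =
      (n : ℝ)⁻¹ * ∑ i : Fin n, ∑ t : Fin T, ∑ w : W,
        πs i w * y i w t * potWeight n T K k W z Λ πs i w a t := by
  unfold estimand potWeight
  rw [Matrix.mulVec_smul, Pi.smul_apply, smul_eq_mul]
  congr 1
  simp only [Matrix.mulVec_sum, Finset.sum_apply, Matrix.mulVec_smul, Pi.smul_apply, smul_eq_mul]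
  rfl

theorem estimand_shift (n T K k : ℕ) (W : Type) [Fintype W]
    (z : Fin n → Fin T → W → Fin K → ℝ) (Λ : Matrix (Fin k) (Fin K) ℝ)
    (πs : Fin n → W → ℝ) (y : Fin n → W → Fin T → ℝ) (c : Fin n → Fin T → ℝ) (a : Fin k) :
    estimand n T K k W z Λ πs (fun i w t => y i w t + c i t) a =
      estimand n T K k W z Λ πs y a + (n : ℝ)⁻¹ * ∑ i : Fin n, ∑ t : Fin T,
        c i t * (∑ w : W, πs i w • potWeight n T K k W z Λ πs i w) a t := by
  rw [estimand_apply, estimand_apply, ← mul_add]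
  congr 1
  simp only [← Finset.sum_add_distrib, Matrix.sum_apply, Matrix.smul_apply, smul_eq_mul,
    Finset.mul_sum]
  refine Finset.sum_congr rfl fun i _ => Finset.sum_congr rfl fun t _ => ?_
  refine Finset.sum_congr rfl fun w _ => ?_
  ring

/-- `τ` is a vector of causal contrasts under the true design `πs` iff `πs`
is an (improper) implicit design; moreover, when this holds and the implicit design is
unique, that unique implicit design is proper and Gram-consistent. -/
theorem causal_contrast_iff_implicit_design
    (n T K k : ℕ) (W : Type) [Fintype W]
    (z : Fin n → Fin T → W → Fin K → ℝ) (Λ : Matrix (Fin k) (Fin K) ℝ)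
    (πs : Fin n → W → ℝ)
    (hpos : ∀ i w, 0 ≤ πs i w) (hsum : ∀ i, ∑ w : W, πs i w = 1)
    (hG : IsUnit (gram n T K W z πs).det) :
    (LevelIrrelevance n T K k W z Λ πs ↔ ImplicitDesign n T K k W z Λ πs πs)
    ∧ (LevelIrrelevance n T K k W z Λ πs →
        (∀ q q' : Fin n → W → ℝ, ImplicitDesign n T K k W z Λ πs q →
          ImplicitDesign n T K k W z Λ πs q' → q = q') →
        ∀ q : Fin n → W → ℝ, ImplicitDesign n T K k W z Λ πs q →
          (∀ i w, 0 ≤ q i w) ∧ gram n T K W z q = gram n T K W z πs) := by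
  have key : LevelIrrelevance n T K k W z Λ πs ↔ ImplicitDesign n T K k W z Λ πs πs := by
    constructor
    · intro h
      refine ⟨fun i => ?_, hsum⟩
      ext a t
      have hn : (n : ℝ) ≠ 0 := by
        have := i.pos
        positivity
      have h1 := congrFun (h 0 (fun i' t' => if i' = i then (if t' = t then 1 else 0) else 0)) a
      rw [estimand_shift] at h1
      simpa [hn, ite_mul, Finset.sum_ite_irrel] using h1
    · intro h y c
      funext a
      rw [estimand_shift]
      simp [h.1]
  refine ⟨key, fun h hu q hq => ?_⟩
  obtain rfl := hu q πs hq (key.1 h)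
  exact ⟨hpos, rfl⟩

end Stmt0
end

section
/- Suppose k = T = 1 and 𝒲 = {0,1} (scalar outcome, scalar contrast, binary treatment); write π*_i = π*_i(1) and let ρ_i(1), ρ_i(0) ∈ ℝ be the potential weights. Then τ is a causal contrast under π* if and only if ρ_i(1)ρ_i(0) ≤ 0 for all i and π*_i = −ρ_i(0)/(ρ_i(1) − ρ_i(0)) for every unit i for which at least one of ρ_i(1), ρ_i(0) is nonzero. When this holds, setting ω_i = π*_i ρ_i(1), one has ω_i = −(1 − π*_i) ρ_i(0) and τ = (1/n) Σ_{i=1}^n ω_i (y_i(1) − y_i(0)); moreover ω_i < 0 if and only if ρ_i(1) < 0 < ρ_i(0). -/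
open Matrix BigOperators

namespace Stmt1

/-- Gram matrix of a binary-treatment design `p` (where `p i` is the probability of
treatment `true` for unit `i`). -/
noncomputable def gram (n K : ℕ) (z : Fin n → Bool → Fin K → ℝ) (p : Fin n → ℝ) :
    Matrix (Fin K) (Fin K) ℝ :=
  (n : ℝ)⁻¹ • ∑ i : Fin n,
    (p i • vecMulVec (z i true) (z i true) + (1 - p i) • vecMulVec (z i false) (z i false))

/-- Scalar potential weight `ρ_i(w) = Λ G_n⁻¹ z(x_i,w)` (k = T = 1). -/
noncomputable def rho (n K : ℕ) (z : Fin n → Bool → Fin K → ℝ) (Λ : Fin K → ℝ)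
    (p : Fin n → ℝ) (i : Fin n) (w : Bool) : ℝ :=
  Λ ⬝ᵥ ((gram n K z p)⁻¹ *ᵥ z i w)

/-- Scalar regression estimand `τ = Λ G_n⁻¹ (1/n) Σ_i [π*_i z(x_i,1) y_i(1) + (1-π*_i) z(x_i,0) y_i(0)]`. -/
noncomputable def tau (n K : ℕ) (z : Fin n → Bool → Fin K → ℝ) (Λ : Fin K → ℝ)
    (p : Fin n → ℝ) (y : Fin n → Bool → ℝ) : ℝ :=
  Λ ⬝ᵥ ((gram n K z p)⁻¹ *ᵥ ((n : ℝ)⁻¹ •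
    ∑ i : Fin n, ((p i * y i true) • z i true + ((1 - p i) * y i false) • z i false)))

/-- Level irrelevance: `τ` is unchanged when every potential outcome of unit `i`
is shifted by `c i`. -/
def LevelIrrelevance (n K : ℕ) (z : Fin n → Bool → Fin K → ℝ) (Λ : Fin K → ℝ)
    (p : Fin n → ℝ) : Prop :=
  ∀ (y : Fin n → Bool → ℝ) (c : Fin n → ℝ),
    tau n K z Λ p (fun i w => y i w + c i) = tau n K z Λ p y

theorem tau_eq (n K : ℕ) (z : Fin n → Bool → Fin K → ℝ) (Λ : Fin K → ℝ)
    (p : Fin n → ℝ) (y : Fin n → Bool → ℝ) :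
    tau n K z Λ p y = (n : ℝ)⁻¹ * ∑ i : Fin n,
      (p i * y i true * rho n K z Λ p i true + (1 - p i) * y i false * rho n K z Λ p i false) := by
  unfold tau rho
  rw [Matrix.mulVec_smul, dotProduct_smul, smul_eq_mul, Matrix.mulVec_sum, dotProduct_sum]
  congr 1
  refine Finset.sum_congr rfl fun i _ => ?_
  rw [Matrix.mulVec_add, dotProduct_add, Matrix.mulVec_smul, Matrix.mulVec_smul,
    dotProduct_smul, dotProduct_smul, smul_eq_mul, smul_eq_mul]

theorem level_iff (n K : ℕ) (z : Fin n → Bool → Fin K → ℝ) (Λ : Fin K → ℝ)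
    (p : Fin n → ℝ) : LevelIrrelevance n K z Λ p ↔
    ∀ i, p i * rho n K z Λ p i true + (1 - p i) * rho n K z Λ p i false = 0 := by
  constructor
  · intro h i
    have hn : (n : ℝ) ≠ 0 := by
      have := i.pos
      positivity
    have h1 := h (fun _ _ => 0) (Pi.single i 1)
    rw [tau_eq, tau_eq] at h1
    have h2 := mul_left_cancel₀ (inv_ne_zero hn) h1
    rw [Finset.sum_eq_single i] at h2
    · simpa using h2
    · intro j _ hj
      simp [Pi.single_eq_of_ne hj]
    · simp
  · intro h y c
    rw [tau_eq, tau_eq]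
    congr 1
    refine Finset.sum_congr rfl fun i _ => ?_
    linear_combination c i * h i

/-- k = T = J = 1: `τ` is a causal contrast under the true design `πs` iff
`ρ_i(1)ρ_i(0) ≤ 0` for all `i` and `πs_i = -ρ_i(0)/(ρ_i(1) - ρ_i(0))` whenever one of the
two potential weights is nonzero.  When this holds, `ω_i = πs_i ρ_i(1) = -(1-πs_i) ρ_i(0)`,
`τ = (1/n) Σ_i ω_i (y_i(1) - y_i(0))`, and `ω_i < 0` iff `ρ_i(1) < 0 < ρ_i(0)`. -/
theorem binary_causal_contrast
    (n K : ℕ) (z : Fin n → Bool → Fin K → ℝ) (Λ : Fin K → ℝ)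
    (πs : Fin n → ℝ) (h01 : ∀ i, 0 ≤ πs i ∧ πs i ≤ 1)
    (hG : IsUnit (gram n K z πs).det) :
    (LevelIrrelevance n K z Λ πs ↔
      ((∀ i, rho n K z Λ πs i true * rho n K z Λ πs i false ≤ 0) ∧
        (∀ i, (rho n K z Λ πs i true ≠ 0 ∨ rho n K z Λ πs i false ≠ 0) →
          πs i = -(rho n K z Λ πs i false) /
            (rho n K z Λ πs i true - rho n K z Λ πs i false))))
    ∧ (LevelIrrelevance n K z Λ πs →
        (∀ i, πs i * rho n K z Λ πs i true = -((1 - πs i) * rho n K z Λ πs i false))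
        ∧ (∀ y : Fin n → Bool → ℝ,
            tau n K z Λ πs y
              = (n : ℝ)⁻¹ * ∑ i : Fin n,
                  (πs i * rho n K z Λ πs i true) * (y i true - y i false))
        ∧ (∀ i, πs i * rho n K z Λ πs i true < 0 ↔
            (rho n K z Λ πs i true < 0 ∧ 0 < rho n K z Λ πs i false))) := by
  rw [level_iff]
  refine ⟨⟨fun h => ⟨fun i => ?_, fun i hi => ?_⟩, fun ⟨h1, h2⟩ i => ?_⟩, fun h => ⟨fun i => ?_, fun y => ?_, fun i => ?_⟩⟩
  · have hi := h i
    obtain ⟨h0, h1⟩ := h01 i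
    generalize rho n K z Λ πs i true = a at *
    generalize rho n K z Λ πs i false = b at *
    have e1 : πs i * (a * b) = -((1 - πs i) * b ^ 2) := by linear_combination b * hi
    have e2 : (1 - πs i) * (a * b) = -(πs i * a ^ 2) := by linear_combination a * hi
    have := mul_nonneg h0 (sq_nonneg a)
    have := mul_nonneg (sub_nonneg.2 h1) (sq_nonneg b)
    linarith
  · have hh := h i
    generalize rho n K z Λ πs i true = a at *
    generalize rho n K z Λ πs i false = b at *
    have hab : a - b ≠ 0 := by
      intro e
      have hb : b = 0 := by linear_combination hh - πs i * e
      have ha : a = 0 := by linarith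
      simp [ha, hb] at hi
    rw [eq_div_iff hab]
    linear_combination hh
  · have hh := h1 i
    have hk := h2 i
    generalize rho n K z Λ πs i true = a at *
    generalize rho n K z Λ πs i false = b at *
    by_cases hz : a ≠ 0 ∨ b ≠ 0
    · have hab : a - b ≠ 0 := by
        intro e
        have e' : a = b := by linarith
        subst e'
        have : a = 0 := by nlinarith
        simp [this] at hz
      have := hk hz
      rw [eq_div_iff hab] at this
      linear_combination this
    · push Not at hz
      simp [hz.1, hz.2]
  · linear_combination h i
  · rw [tau_eq]
    congr 1
    refine Finset.sum_congr rfl fun i _ => ?_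
    linear_combination y i false * h i
  · have hi := h i
    obtain ⟨h0, h1⟩ := h01 i
    generalize rho n K z Λ πs i true = a at *
    generalize rho n K z Λ πs i false = b at *
    constructor
    · intro hn
      refine ⟨?_, ?_⟩
      · by_contra hc
        have := mul_nonneg h0 (not_lt.1 hc)
        linarith
      · by_contra hc
        have := mul_nonneg (sub_nonneg.2 h1) (neg_nonneg.2 (not_lt.1 hc))
        linarith
    · rintro ⟨ha, hb⟩
      have hp : 0 < πs i := by
        rcases h0.lt_or_eq with h' | h'
        · exact h'
        · rw [← h'] at hi
          linarith
      exact mul_neg_of_pos_of_neg hp ha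

end Stmt1
end

section
/- Frisch–Waugh–Lovell in population: partition z_t(x_i,w) into blocks z_{t1}(x_i,w) ∈ ℝ^{K₁} and z_{t2}(x_i,w) ∈ ℝ^{K₂} and suppose Λ = [Λ₁, 0] loads only on the first block. Let Γ = ((1/n) Σ_{i,t,w} π*_i(w) z_{t1} z_{t2}') ((1/n) Σ_{i,t,w} π*_i(w) z_{t2} z_{t2}')^{-1} be the population projection matrix of z_{t1} on z_{t2}, set z̃_t(x_i,w) = z_{t1}(x_i,w) − Γ z_{t2}(x_i,w) and G̃_n = (1/n) Σ_{i,t,w} π*_i(w) z̃_t(x_i,w) z̃_t(x_i,w)'. Then: (i) since G_n is invertible, the (2,2) block of G_n is invertible (so Γ is well defined) and G̃_n is positive definite, and both Γ and G̃_n are functions of G_n only; (ii) the potential weights of the residualized specification equal those of the original: Λ₁ G̃_n^{-1} z̃_t(x_i,w) = Λ G_n^{-1} z_t(x_i,w) for every i, t, w. -/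
open Matrix BigOperators

namespace Stmt2

/-- Gram matrix of a design, for a covariate transform indexed by `Fin K1 ⊕ Fin K2`. -/
noncomputable def gram (n T K1 K2 : ℕ) (W : Type) [Fintype W]
    (z : Fin n → Fin T → W → (Fin K1 ⊕ Fin K2) → ℝ) (π : Fin n → W → ℝ) :
    Matrix (Fin K1 ⊕ Fin K2) (Fin K1 ⊕ Fin K2) ℝ :=
  (n : ℝ)⁻¹ • ∑ i : Fin n, ∑ t : Fin T, ∑ w : W, π i w • vecMulVec (z i t w) (z i t w)

/-- Population projection matrix `Γ = G₁₂ G₂₂⁻¹` of the first block on the second,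
a function of the Gram matrix only. -/
noncomputable def Gamma (K1 K2 : ℕ)
    (G : Matrix (Fin K1 ⊕ Fin K2) (Fin K1 ⊕ Fin K2) ℝ) : Matrix (Fin K1) (Fin K2) ℝ :=
  G.toBlocks₁₂ * (G.toBlocks₂₂)⁻¹

/-- Residualized covariate transform `z̃_t(x_i,w) = z_{t1}(x_i,w) - Γ z_{t2}(x_i,w)`. -/
noncomputable def ztilde (n T K1 K2 : ℕ) (W : Type) [Fintype W]
    (z : Fin n → Fin T → W → (Fin K1 ⊕ Fin K2) → ℝ) (π : Fin n → W → ℝ)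
    (i : Fin n) (t : Fin T) (w : W) : Fin K1 → ℝ :=
  fun a => z i t w (Sum.inl a)
    - (Gamma K1 K2 (gram n T K1 K2 W z π) *ᵥ fun j => z i t w (Sum.inr j)) a

/-- Gram matrix `G̃_n` of the residualized specification. -/
noncomputable def gramTilde (n T K1 K2 : ℕ) (W : Type) [Fintype W]
    (z : Fin n → Fin T → W → (Fin K1 ⊕ Fin K2) → ℝ) (π : Fin n → W → ℝ) :
    Matrix (Fin K1) (Fin K1) ℝ :=
  (n : ℝ)⁻¹ • ∑ i : Fin n, ∑ t : Fin T, ∑ w : W,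
    π i w • vecMulVec (ztilde n T K1 K2 W z π i t w) (ztilde n T K1 K2 W z π i t w)

theorem gram_posSemidef (n T K1 K2 : ℕ) (W : Type) [Fintype W]
    (z : Fin n → Fin T → W → (Fin K1 ⊕ Fin K2) → ℝ) (π : Fin n → W → ℝ)
    (hpos : ∀ i w, 0 ≤ π i w) : (gram n T K1 K2 W z π).PosSemidef := by
  unfold gram
  refine Matrix.PosSemidef.smul ?_ (by positivity)
  refine Matrix.posSemidef_sum _ fun i _ => Matrix.posSemidef_sum _ fun t _ =>
    Matrix.posSemidef_sum _ fun w _ => Matrix.PosSemidef.smul ?_ (hpos i w)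
  simpa using Matrix.posSemidef_vecMulVec_self_star (z i t w)

/-- The residual-maker `[1, -Γ]`. -/
noncomputable def resM (K1 K2 : ℕ)
    (G : Matrix (Fin K1 ⊕ Fin K2) (Fin K1 ⊕ Fin K2) ℝ) : Matrix (Fin K1) (Fin K1 ⊕ Fin K2) ℝ :=
  Matrix.fromCols 1 (-Gamma K1 K2 G)

/-- The selection matrix `[1, 0]`. -/
noncomputable def selM (K1 K2 : ℕ) : Matrix (Fin K1) (Fin K1 ⊕ Fin K2) ℝ :=
  Matrix.fromCols 1 0

theorem ztilde_eq (n T K1 K2 : ℕ) (W : Type) [Fintype W]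
    (z : Fin n → Fin T → W → (Fin K1 ⊕ Fin K2) → ℝ) (π : Fin n → W → ℝ)
    (i : Fin n) (t : Fin T) (w : W) :
    ztilde n T K1 K2 W z π i t w = resM K1 K2 (gram n T K1 K2 W z π) *ᵥ z i t w := by
  funext a
  simp [ztilde, resM, Matrix.fromCols_mulVec, Matrix.neg_mulVec, sub_eq_add_neg, Function.comp_def]

theorem gramTilde_eq (n T K1 K2 : ℕ) (W : Type) [Fintype W]
    (z : Fin n → Fin T → W → (Fin K1 ⊕ Fin K2) → ℝ) (π : Fin n → W → ℝ) :
    gramTilde n T K1 K2 W z π = resM K1 K2 (gram n T K1 K2 W z π) * gram n T K1 K2 W z π *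
      (resM K1 K2 (gram n T K1 K2 W z π))ᵀ := by
  unfold gramTilde
  simp only [ztilde_eq]
  generalize resM K1 K2 (gram n T K1 K2 W z π) = M
  unfold gram
  simp only [Matrix.mul_smul, Matrix.smul_mul, Matrix.mul_sum, Matrix.sum_mul,
    Matrix.mul_vecMulVec, Matrix.vecMulVec_mul, Matrix.vecMul_transpose]

theorem resM_mul (K1 K2 : ℕ) (G : Matrix (Fin K1 ⊕ Fin K2) (Fin K1 ⊕ Fin K2) ℝ)
    (h : IsUnit G.toBlocks₂₂.det) :
    resM K1 K2 G * G = (resM K1 K2 G * G * (resM K1 K2 G)ᵀ) * selM K1 K2 := by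
  have key : resM K1 K2 G * G =
      Matrix.fromCols (G.toBlocks₁₁ - Gamma K1 K2 G * G.toBlocks₂₁) 0 := by
    have h0 : Gamma K1 K2 G * G.toBlocks₂₂ = G.toBlocks₁₂ := by
      rw [Gamma, Matrix.mul_assoc, Matrix.nonsing_inv_mul _ h, Matrix.mul_one]
    conv_lhs => rw [← Matrix.fromBlocks_toBlocks G]
    rw [resM, Matrix.fromCols_mul_fromBlocks, Matrix.fromBlocks_toBlocks]
    simp [Matrix.neg_mul, h0, sub_eq_add_neg]
  rw [key, resM, Matrix.transpose_fromCols, Matrix.fromCols_mul_fromRows, selM, Matrix.mul_fromCols]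
  simp

/-- Frisch–Waugh–Lovell in population: if `Λ` loads only on the first block
and the Gram matrix is invertible, then (i) the (2,2) block of the Gram matrix is
invertible and `G̃_n` is positive definite (both being functions of `G_n` alone by
construction), and (ii) the potential weights of the residualized specification coincide
with those of the original specification. -/
theorem frisch_waugh_lovell
    (n T K1 K2 k : ℕ) (W : Type) [Fintype W]
    (z : Fin n → Fin T → W → (Fin K1 ⊕ Fin K2) → ℝ)
    (Λ : Matrix (Fin k) (Fin K1 ⊕ Fin K2) ℝ)
    (hΛ : ∀ a j, Λ a (Sum.inr j) = 0)
    (πs : Fin n → W → ℝ)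
    (hpos : ∀ i w, 0 ≤ πs i w) (hsum : ∀ i, ∑ w : W, πs i w = 1)
    (hG : IsUnit (gram n T K1 K2 W z πs).det) :
    IsUnit ((gram n T K1 K2 W z πs).toBlocks₂₂).det
    ∧ (gramTilde n T K1 K2 W z πs).PosDef
    ∧ ∀ (i : Fin n) (t : Fin T) (w : W),
        ((Matrix.of fun a b => Λ a (Sum.inl b)) * (gramTilde n T K1 K2 W z πs)⁻¹) *ᵥ
            ztilde n T K1 K2 W z πs i t w
          = (Λ * (gram n T K1 K2 W z πs)⁻¹) *ᵥ (z i t w) := by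
  have hPD : (gram n T K1 K2 W z πs).PosDef :=
    (gram_posSemidef n T K1 K2 W z πs hpos).posDef_iff_isUnit.mpr
      ((Matrix.isUnit_iff_isUnit_det _).mpr hG)
  have h22 : IsUnit ((gram n T K1 K2 W z πs).toBlocks₂₂).det :=
    (Matrix.isUnit_iff_isUnit_det _).mp (hPD.submatrix Sum.inr_injective).isUnit
  have hT : (gramTilde n T K1 K2 W z πs).PosDef := by
    rw [gramTilde_eq]
    have := hPD.mul_mul_conjTranspose_same (B := resM K1 K2 (gram n T K1 K2 W z πs)) ?_
    · simpa using this
    · intro u v huv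
      funext a
      have := congrFun huv (Sum.inl a)
      simpa [resM, Matrix.vecMul_fromCols] using this
  refine ⟨h22, hT, fun i t w => ?_⟩
  have hTu := (Matrix.isUnit_iff_isUnit_det _).mp hT.isUnit
  have hm := resM_mul K1 K2 _ h22
  rw [← gramTilde_eq] at hm
  have hL : Λ = (Matrix.of fun a b => Λ a (Sum.inl b) : Matrix (Fin k) (Fin K1) ℝ) * selM K1 K2 := by
    rw [selM, Matrix.mul_fromCols]
    ext a (b | b) <;> simp [hΛ]
  rw [ztilde_eq, Matrix.mulVec_mulVec]
  conv_rhs => rw [hL]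
  congr 1
  rw [Matrix.mul_assoc, Matrix.mul_assoc]
  congr 1
  calc _ = (gramTilde n T K1 K2 W z πs)⁻¹ * (resM K1 K2 (gram n T K1 K2 W z πs) *
        gram n T K1 K2 W z πs) * (gram n T K1 K2 W z πs)⁻¹ := by
        rw [Matrix.mul_assoc, Matrix.mul_assoc, Matrix.mul_nonsing_inv _ hG, Matrix.mul_one]
    _ = _ := by
        rw [hm, ← Matrix.mul_assoc, Matrix.nonsing_inv_mul _ hTu, Matrix.one_mul]

end Stmt2
end

section
/- For the specification Y_i = τ W_i + x_i'γ + ε_i with binary treatment, scalar outcome, covariates x_i ∈ ℝ^d whose first coordinate is the constant 1, Σ_i x_i x_i' invertible, and τ the coefficient of interest, let δ = ((1/n) Σ_i x_i x_i')^{-1} (1/n) Σ_i π*_i x_i. Then: (a) the unique implicit design is π_i = x_i'δ, and this design is Gram-consistent regardless of whether it equals π*; (b) π* equals the implicit design if and only if π*_i = x_i'δ for all i; (c) the implicit-estimand weights are ω_i = π_i(1−π_i) / ((1/n) Σ_{j=1}^n π_j(1−π_j)), and when π* equals the implicit design these weights are nonnegative. -/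
open Matrix BigOperators

namespace Stmt4

/-- Covariate transform `z(x_i, w) = (w, x_i')` for the specification
`Y_i = τ W_i + x_i'γ + ε_i`. -/
def zv (n d : ℕ) (x : Fin n → Fin d → ℝ) (i : Fin n) (w : Bool) : (Unit ⊕ Fin d) → ℝ :=
  Sum.elim (fun _ => if w then (1 : ℝ) else 0) (x i)

/-- The contrast vector picking out the coefficient on `W`. -/
def lam (d : ℕ) : (Unit ⊕ Fin d) → ℝ := Sum.elim (fun _ => (1 : ℝ)) (fun _ => 0)

/-- Gram matrix of a binary-treatment design `p`. -/
noncomputable def gram (n d : ℕ) (x : Fin n → Fin d → ℝ) (p : Fin n → ℝ) :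
    Matrix (Unit ⊕ Fin d) (Unit ⊕ Fin d) ℝ :=
  (n : ℝ)⁻¹ • ∑ i : Fin n,
    (p i • vecMulVec (zv n d x i true) (zv n d x i true)
      + (1 - p i) • vecMulVec (zv n d x i false) (zv n d x i false))

/-- Potential weights `ρ_i(w) = Λ G_n⁻¹ z(x_i,w)` relative to the true design `πs`. -/
noncomputable def rho (n d : ℕ) (x : Fin n → Fin d → ℝ) (πs : Fin n → ℝ)
    (i : Fin n) (w : Bool) : ℝ :=
  lam d ⬝ᵥ ((gram n d x πs)⁻¹ *ᵥ zv n d x i w)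

/-- `(1/n) Σ_i x_i x_i'`. -/
noncomputable def A (n d : ℕ) (x : Fin n → Fin d → ℝ) : Matrix (Fin d) (Fin d) ℝ :=
  (n : ℝ)⁻¹ • ∑ i : Fin n, vecMulVec (x i) (x i)

/-- `δ = ((1/n) Σ_i x_i x_i')⁻¹ (1/n) Σ_i π*_i x_i`. -/
noncomputable def delta (n d : ℕ) (x : Fin n → Fin d → ℝ) (πs : Fin n → ℝ) : Fin d → ℝ :=
  (A n d x)⁻¹ *ᵥ ((n : ℝ)⁻¹ • ∑ i : Fin n, πs i • x i)

/-- `q` is an (improper) implicit design: `q_i ρ_i(1) + (1-q_i) ρ_i(0) = 0` for all `i`. -/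
def ImplicitDesign (n d : ℕ) (x : Fin n → Fin d → ℝ) (πs : Fin n → ℝ)
    (q : Fin n → ℝ) : Prop :=
  ∀ i, q i * rho n d x πs i true + (1 - q i) * rho n d x πs i false = 0

/-- mean treated covariates -/
noncomputable def bv (n d : ℕ) (x : Fin n → Fin d → ℝ) (p : Fin n → ℝ) : Fin d → ℝ :=
  (n : ℝ)⁻¹ • ∑ i : Fin n, p i • x i

lemma gram_blocks (n d : ℕ) (x : Fin n → Fin d → ℝ) (p : Fin n → ℝ) :
    gram n d x p = fromBlocks (Matrix.of fun _ _ => (n : ℝ)⁻¹ * ∑ i, p i)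
      (Matrix.of fun _ j => bv n d x p j) (Matrix.of fun j _ => bv n d x p j) (A n d x) := by
  ext i j
  rcases i with i | i <;> rcases j with j | j <;>
    simp [gram, bv, A, zv, Matrix.sum_apply, vecMulVec_apply, Finset.sum_apply]
  left
  refine Finset.sum_congr rfl fun k _ => ?_
  ring

lemma gram_symm (n d : ℕ) (x : Fin n → Fin d → ℝ) (p : Fin n → ℝ) :
    (gram n d x p)ᵀ = gram n d x p := by
  simp [gram, transpose_sum, transpose_vecMulVec]

lemma A_mulVec (n d : ℕ) (x : Fin n → Fin d → ℝ) (v : Fin d → ℝ) :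
    A n d x *ᵥ v = bv n d x (fun i => x i ⬝ᵥ v) := by
  simp only [A, bv, smul_mulVec, sum_mulVec]
  congr 1
  refine Finset.sum_congr rfl fun k _ => ?_
  ext j
  simp [vecMulVec_mulVec, mul_comm]

lemma bv_dot (n d : ℕ) (x : Fin n → Fin d → ℝ) (p : Fin n → ℝ) (v : Fin d → ℝ) :
    bv n d x p ⬝ᵥ v = (n : ℝ)⁻¹ * ∑ i, p i * (x i ⬝ᵥ v) := by
  simp [bv, smul_dotProduct, sum_dotProduct]

lemma bv_zero (n d : ℕ) (hd : 0 < d) (x : Fin n → Fin d → ℝ)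
    (hx1 : ∀ i, x i ⟨0, hd⟩ = 1) (p : Fin n → ℝ) :
    bv n d x p ⟨0, hd⟩ = (n : ℝ)⁻¹ * ∑ i, p i := by
  simp [bv, Finset.sum_apply, hx1]

lemma bv_delta (n d : ℕ) (x : Fin n → Fin d → ℝ) (πs : Fin n → ℝ)
    (hA : IsUnit (A n d x).det) :
    bv n d x (fun i => x i ⬝ᵥ delta n d x πs) = bv n d x πs := by
  rw [← A_mulVec, delta, mulVec_mulVec, mul_nonsing_inv _ hA, one_mulVec, bv]

lemma gram_delta (n d : ℕ) (hd : 0 < d) (x : Fin n → Fin d → ℝ)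
    (hx1 : ∀ i, x i ⟨0, hd⟩ = 1) (πs : Fin n → ℝ) (hA : IsUnit (A n d x).det) :
    gram n d x (fun i => x i ⬝ᵥ delta n d x πs) = gram n d x πs := by
  simp only [gram_blocks, ← bv_zero n d hd x hx1, bv_delta n d x πs hA]

lemma gram_mulVec (n d : ℕ) (x : Fin n → Fin d → ℝ) (v : Fin d → ℝ) :
    gram n d x (fun i => x i ⬝ᵥ v) *ᵥ (Sum.elim (fun _ => 1) (-v)) =
      ((n : ℝ)⁻¹ * ∑ j, (x j ⬝ᵥ v) * (1 - x j ⬝ᵥ v)) • lam d := by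
  have hb := bv_dot n d x (fun i => x i ⬝ᵥ v) v
  have hA := A_mulVec n d x v
  rw [gram_blocks, fromBlocks_mulVec, Sum.elim_comp_inl, Sum.elim_comp_inr, mulVec_neg,
    mulVec_neg, hA]
  clear hA
  simp only [mul_sub, Finset.sum_sub_distrib, mul_one]
  rw [← hb]
  generalize bv n d x (fun i => x i ⬝ᵥ v) = b
  ext j
  rcases j with j | j
  · simp [lam, mulVec, dotProduct, sub_eq_add_neg]
  · simp [lam, mulVec, dotProduct]

lemma rho_eq (n d : ℕ) (hd : 0 < d) (x : Fin n → Fin d → ℝ)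
    (hx1 : ∀ i, x i ⟨0, hd⟩ = 1) (πs : Fin n → ℝ) (hA : IsUnit (A n d x).det)
    (hG : IsUnit (gram n d x πs).det) (s : ℝ)
    (hs : s = (n : ℝ)⁻¹ * ∑ j : Fin n, (x j ⬝ᵥ delta n d x πs) * (1 - x j ⬝ᵥ delta n d x πs)) :
    s ≠ 0 ∧ ∀ i w, s * rho n d x πs i w = (if w then 1 else 0) - x i ⬝ᵥ delta n d x πs := by
  have h := gram_mulVec n d x (delta n d x πs)
  rw [gram_delta n d hd x hx1 πs hA, ← hs] at h
  constructor
  · rintro rfl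
    rw [zero_smul] at h
    have h2 := congrArg (fun u => (gram n d x πs)⁻¹ *ᵥ u) h
    simp only [mulVec_mulVec, nonsing_inv_mul _ hG, one_mulVec, mulVec_zero] at h2
    have := congrFun h2 (Sum.inl ())
    simp at this
  · intro i w
    rw [rho, ← smul_eq_mul, ← smul_dotProduct, ← h, ← vecMul_transpose, gram_symm,
      ← dotProduct_mulVec, mulVec_mulVec, mul_nonsing_inv _ hG, one_mulVec, zv]
    simp [dotProduct_comm, sub_eq_add_neg]

/-- Angrist 1998 / Blandhol et al.: for `Y_i = τ W_i + x_i'γ + ε_i` with the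
first covariate the constant 1, (a) the unique implicit design is `π_i = x_i'δ`, and it is
Gram-consistent regardless of whether it equals `π*`; (b) `π*` equals the implicit design
iff `π*_i = x_i'δ` for all `i`; (c) the implicit-estimand weights are
`ω_i = π_i(1-π_i) / ((1/n) Σ_j π_j(1-π_j))`, nonnegative when `π*` equals the implicit
design. -/
theorem angrist98
    (n d : ℕ) (hd : 0 < d) (x : Fin n → Fin d → ℝ)
    (hx1 : ∀ i, x i ⟨0, hd⟩ = 1)
    (πs : Fin n → ℝ) (h01 : ∀ i, 0 ≤ πs i ∧ πs i ≤ 1)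
    (hA : IsUnit (A n d x).det)
    (hG : IsUnit (gram n d x πs).det) :
    (ImplicitDesign n d x πs (fun i => x i ⬝ᵥ delta n d x πs)
      ∧ (∀ q : Fin n → ℝ, ImplicitDesign n d x πs q → q = fun i => x i ⬝ᵥ delta n d x πs)
      ∧ gram n d x (fun i => x i ⬝ᵥ delta n d x πs) = gram n d x πs)
    ∧ (πs = (fun i => x i ⬝ᵥ delta n d x πs) ↔ ∀ i, πs i = x i ⬝ᵥ delta n d x πs)
    ∧ ((∀ i, (x i ⬝ᵥ delta n d x πs) * rho n d x πs i true
          = (x i ⬝ᵥ delta n d x πs) * (1 - x i ⬝ᵥ delta n d x πs)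
            / ((n : ℝ)⁻¹ * ∑ j : Fin n, (x j ⬝ᵥ delta n d x πs) * (1 - x j ⬝ᵥ delta n d x πs)))
      ∧ (πs = (fun i => x i ⬝ᵥ delta n d x πs) →
          ∀ i, 0 ≤ (x i ⬝ᵥ delta n d x πs) * rho n d x πs i true)) := by
  obtain ⟨hs0, hr⟩ := rho_eq n d hd x hx1 πs hA hG _ rfl
  have hr1 := fun i => hr i true
  have hr0 := fun i => hr i false
  have hgd := gram_delta n d hd x hx1 πs hA
  clear hr
  simp only [if_true, Bool.false_eq_true, if_false] at hr1 hr0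
  have hw : ∀ i, (x i ⬝ᵥ delta n d x πs) * rho n d x πs i true
          = (x i ⬝ᵥ delta n d x πs) * (1 - x i ⬝ᵥ delta n d x πs)
            / ((n : ℝ)⁻¹ * ∑ j : Fin n,
              (x j ⬝ᵥ delta n d x πs) * (1 - x j ⬝ᵥ delta n d x πs)) := by
    intro i
    rw [eq_div_iff hs0, ← hr1 i]
    ring
  refine ⟨⟨?_, ?_, hgd⟩, funext_iff, hw, ?_⟩
  · intro i
    refine (mul_eq_zero.1 ?_).resolve_left hs0
    beta_reduce
    linear_combination (x i ⬝ᵥ delta n d x πs) * hr1 i + (1 - x i ⬝ᵥ delta n d x πs) * hr0 i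
  · intro q hq
    funext i
    linear_combination -(q i) * hr1 i - (1 - q i) * hr0 i + ((n : ℝ)⁻¹ * ∑ j : Fin n,
              (x j ⬝ᵥ delta n d x πs) * (1 - x j ⬝ᵥ delta n d x πs)) * hq i
  · intro h i
    rw [hw i]
    have hp : ∀ j, 0 ≤ (x j ⬝ᵥ delta n d x πs) * (1 - x j ⬝ᵥ delta n d x πs) := by
      intro j
      have h1 := h01 j
      rw [congrFun h j] at h1
      exact mul_nonneg h1.1 (sub_nonneg.2 h1.2)
    exact div_nonneg (hp i) (mul_nonneg (by positivity) (Finset.sum_nonneg fun j _ => hp j))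

end Stmt4
end

section
/- For the multivalued-treatment specification Y_i = Σ_{j=1}^J τ_j 1(W_i=j) + x_i'γ + ε_i with 𝒲 = {0,1,…,J}, J > 1, covariates x_i ∈ ℝ^d whose first coordinate is the constant 1, Σ_i x_i x_i' invertible, and the coefficients of interest τ = (τ_1,…,τ_J)', let δ_j = ((1/n) Σ_i x_i x_i')^{-1} (1/n) Σ_i π*_i(j) x_i for j = 1,…,J. Then: (a) the unique implicit design is π_i(j) = x_i'δ_j for j = 1,…,J (with π_i(0) = 1 − Σ_j π_i(j)), and it is Gram-consistent regardless of whether it equals π*; (b) π* equals the implicit design if and only if π*_i(j) = x_i'δ_j for all i and all j ∈ {1,…,J}; (c) there exist configurations of covariates and designs with π* equal to the implicit design for which the implicit estimand is contaminated, i.e., for some coordinate j ∈ {1,…,J}, the weight that τ_j places on a potential outcome y_i(ℓ) with ℓ ∉ {0,j} is nonzero. -/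
open Matrix BigOperators

namespace Stmt5

/-- Covariate transform `z(x_i, w) = (1(w=1),…,1(w=J), x_i')`. -/
def zv (n d J : ℕ) (x : Fin n → Fin d → ℝ) (i : Fin n) (w : Fin (J + 1)) :
    (Fin J ⊕ Fin d) → ℝ :=
  Sum.elim (fun j => if w = Fin.succ j then (1 : ℝ) else 0) (x i)

/-- Contrast matrix picking out the coefficients `(τ_1,…,τ_J)` on the treatment dummies. -/
def lam (d J : ℕ) : Matrix (Fin J) (Fin J ⊕ Fin d) ℝ :=
  Matrix.of fun a => Sum.elim (fun j => if j = a then (1 : ℝ) else 0) (fun _ => 0)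

/-- Gram matrix of a design `p` on `{0,1,…,J}`. -/
noncomputable def gram (n d J : ℕ) (x : Fin n → Fin d → ℝ) (p : Fin n → Fin (J + 1) → ℝ) :
    Matrix (Fin J ⊕ Fin d) (Fin J ⊕ Fin d) ℝ :=
  (n : ℝ)⁻¹ • ∑ i : Fin n, ∑ w : Fin (J + 1), p i w • vecMulVec (zv n d J x i w) (zv n d J x i w)

/-- Potential weights `ρ_i(w) = Λ G_n⁻¹ z(x_i,w) ∈ ℝ^J`, relative to the true design `πs`. -/
noncomputable def rho (n d J : ℕ) (x : Fin n → Fin d → ℝ) (πs : Fin n → Fin (J + 1) → ℝ)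
    (i : Fin n) (w : Fin (J + 1)) : Fin J → ℝ :=
  (lam d J * (gram n d J x πs)⁻¹) *ᵥ zv n d J x i w

/-- `(1/n) Σ_i x_i x_i'`. -/
noncomputable def A (n d : ℕ) (x : Fin n → Fin d → ℝ) : Matrix (Fin d) (Fin d) ℝ :=
  (n : ℝ)⁻¹ • ∑ i : Fin n, vecMulVec (x i) (x i)

/-- `δ_j = ((1/n) Σ_i x_i x_i')⁻¹ (1/n) Σ_i π*_i(j) x_i`. -/
noncomputable def delta (n d J : ℕ) (x : Fin n → Fin d → ℝ) (πs : Fin n → Fin (J + 1) → ℝ)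
    (j : Fin J) : Fin d → ℝ :=
  (A n d x)⁻¹ *ᵥ ((n : ℝ)⁻¹ • ∑ i : Fin n, πs i (Fin.succ j) • x i)

/-- The candidate implicit design `π_i(j) = x_i'δ_j` for `j = 1,…,J`, with
`π_i(0) = 1 - Σ_j x_i'δ_j`. -/
noncomputable def piImp (n d J : ℕ) (x : Fin n → Fin d → ℝ) (πs : Fin n → Fin (J + 1) → ℝ)
    (i : Fin n) (w : Fin (J + 1)) : ℝ :=
  Fin.cases (1 - ∑ j : Fin J, x i ⬝ᵥ delta n d J x πs j) (fun j => x i ⬝ᵥ delta n d J x πs j) w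

/-- `q` is an (improper) implicit design. -/
def ImplicitDesign (n d J : ℕ) (x : Fin n → Fin d → ℝ) (πs : Fin n → Fin (J + 1) → ℝ)
    (q : Fin n → Fin (J + 1) → ℝ) : Prop :=
  (∀ i, ∑ w : Fin (J + 1), q i w • rho n d J x πs i w = 0)
  ∧ (∀ i, ∑ w : Fin (J + 1), q i w = 1)

noncomputable def Bm (n d J : ℕ) (x : Fin n → Fin d → ℝ) (p : Fin n → Fin (J + 1) → ℝ) :
    Matrix (Fin J) (Fin d) ℝ :=
  Matrix.of fun j k => (n : ℝ)⁻¹ * ∑ i : Fin n, p i (Fin.succ j) * x i k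

lemma A_symm (n d : ℕ) (x : Fin n → Fin d → ℝ) (k l : Fin d) : A n d x k l = A n d x l k := by
  simp [A, Matrix.sum_apply, vecMulVec_apply, mul_comm]

lemma A_transpose (n d : ℕ) (x : Fin n → Fin d → ℝ) : (A n d x)ᵀ = A n d x := by
  ext k l
  exact A_symm n d x l k

lemma gram_blocks (n d J : ℕ) (hd : 0 < d) (x : Fin n → Fin d → ℝ)
    (hx1 : ∀ i, x i ⟨0, hd⟩ = 1) (p : Fin n → Fin (J + 1) → ℝ)
    (hsum : ∀ i, ∑ w : Fin (J + 1), p i w = 1) :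
    gram n d J x p = fromBlocks (diagonal fun j => Bm n d J x p j ⟨0, hd⟩) (Bm n d J x p)
      (Bm n d J x p)ᵀ (A n d x) := by
  ext a b
  rcases a with j | k <;> rcases b with l | l
  · simp only [gram, Matrix.smul_apply, Matrix.sum_apply, vecMulVec_apply, zv, Sum.elim_inl,
      fromBlocks_apply₁₁, diagonal_apply, Bm, Matrix.of_apply, hx1, smul_eq_mul, mul_one]
    by_cases h : j = l
    · subst h
      simp
    · simp only [h, if_false]
      have : ∀ w : Fin (J+1), ((if w = j.succ then (1:ℝ) else 0) * (if w = l.succ then 1 else 0)) = 0 := by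
        intro w
        by_cases h1 : w = j.succ
        · have : w ≠ l.succ := by
            rintro h2
            exact h (Fin.succ_injective _ (h1.symm.trans h2))
          simp [this]
        · simp [h1]
      simp [this]
  · simp [gram, Matrix.sum_apply, vecMulVec_apply, zv, Bm]
  · simp [gram, Matrix.sum_apply, vecMulVec_apply, zv, Bm, mul_comm]
  · simp only [gram, Matrix.smul_apply, Matrix.sum_apply, vecMulVec_apply, zv, Sum.elim_inr,
      fromBlocks_apply₂₂, A, smul_eq_mul, ← Finset.sum_mul, hsum, one_mul]

lemma delta_mul (n d J : ℕ) (x : Fin n → Fin d → ℝ) (πs : Fin n → Fin (J + 1) → ℝ)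
    (hA : IsUnit (A n d x).det) :
    (Matrix.of (delta n d J x πs)) * A n d x = Bm n d J x πs := by
  ext j k
  have h : A n d x *ᵥ delta n d J x πs j = ((n : ℝ)⁻¹ • ∑ i : Fin n, πs i (Fin.succ j) • x i) := by
    rw [delta, mulVec_mulVec, mul_nonsing_inv _ hA, one_mulVec]
  have h2 := congrFun h k
  simp only [Bm, Matrix.of_apply, Matrix.mul_apply]
  simp only [mulVec, dotProduct, Pi.smul_apply, Finset.sum_apply, smul_eq_mul] at h2
  rw [← h2]
  exact Finset.sum_congr rfl fun l _ => by rw [A_symm n d x l k, mul_comm]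

lemma delta_eq (n d J : ℕ) (x : Fin n → Fin d → ℝ) (πs : Fin n → Fin (J + 1) → ℝ)
    (hA : IsUnit (A n d x).det) (j : Fin J) (v : Fin d → ℝ)
    (h : ∀ i, πs i (Fin.succ j) = x i ⬝ᵥ v) : delta n d J x πs j = v := by
  have : ((n : ℝ)⁻¹ • ∑ i : Fin n, πs i (Fin.succ j) • x i) = A n d x *ᵥ v := by
    rw [A, smul_mulVec, Matrix.sum_mulVec]
    congr 1
    refine Finset.sum_congr rfl fun i _ => ?_
    rw [h i, vecMulVec_mulVec]
    ext k
    simp [mul_comm]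
  rw [delta, this, mulVec_mulVec, nonsing_inv_mul _ hA, one_mulVec]

lemma Bm_piImp (n d J : ℕ) (x : Fin n → Fin d → ℝ) (πs : Fin n → Fin (J + 1) → ℝ)
    (hA : IsUnit (A n d x).det) :
    Bm n d J x (piImp n d J x πs) = Bm n d J x πs := by
  rw [← delta_mul n d J x πs hA]
  have : delta n d J x πs = delta n d J x (piImp n d J x πs) := by
    ext1 j
    exact (delta_eq n d J x (piImp n d J x πs) hA j _ fun i => by simp [piImp]).symm
  rw [this, delta_mul n d J x _ hA]

lemma rho_form (n d J : ℕ) (hd : 0 < d) (x : Fin n → Fin d → ℝ)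
    (hx1 : ∀ i, x i ⟨0, hd⟩ = 1) (πs : Fin n → Fin (J + 1) → ℝ)
    (hsum : ∀ i, ∑ w : Fin (J + 1), πs i w = 1)
    (hA : IsUnit (A n d x).det)
    (hG : IsUnit (gram n d J x πs).det) :
    ∃ P S : Matrix (Fin J) (Fin J) ℝ, S * P = 1 ∧ ∀ i w, rho n d J x πs i w =
      P *ᵥ (fun j => (if w = Fin.succ j then 1 else 0) - x i ⬝ᵥ delta n d J x πs j) := by
  set M := lam d J * (gram n d J x πs)⁻¹ with hM
  set P := M.toCols₁ with hP
  set Q := M.toCols₂ with hQ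
  set B := Bm n d J x πs with hB
  set Δ : Matrix (Fin J) (Fin d) ℝ := Matrix.of (delta n d J x πs) with hΔ
  have hPQ : M = fromCols P Q := (fromCols_toCols M).symm
  have hl : lam d J = fromCols 1 0 := by
    ext a b
    rcases b with b | b
    · simp [lam, Matrix.one_apply, eq_comm]
    · simp [lam]
  have hMG : M * gram n d J x πs = lam d J := by
    rw [hM, Matrix.mul_assoc, nonsing_inv_mul _ hG, Matrix.mul_one]
  rw [hPQ, gram_blocks n d J hd x hx1 πs hsum, hl, fromCols_mul_fromBlocks] at hMG
  obtain ⟨h1, h2⟩ := fromCols_inj hMG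
  have hΔA : Δ * A n d x = B := delta_mul n d J x πs hA
  have hQe : Q = - (P * Δ) := by
    have : (Q + P * Δ) * A n d x = 0 := by
      rw [Matrix.add_mul, Matrix.mul_assoc, hΔA, add_comm, h2]
    have h3 : (Q + P * Δ) * A n d x * (A n d x)⁻¹ = 0 := by rw [this, Matrix.zero_mul]
    rw [Matrix.mul_assoc, mul_nonsing_inv _ hA, Matrix.mul_one] at h3
    exact eq_neg_of_add_eq_zero_left h3
  refine ⟨P, (diagonal fun j => B j ⟨0, hd⟩) - Δ * Bᵀ, ?_, ?_⟩
  · apply mul_eq_one_comm.1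
    rw [Matrix.mul_sub, ← h1, hQe, Matrix.neg_mul, Matrix.mul_assoc, sub_eq_add_neg]
  · intro i w
    have : rho n d J x πs i w = M *ᵥ zv n d J x i w := rfl
    rw [this, hPQ, zv, fromCols_mulVec, hQe, neg_mulVec, ← mulVec_mulVec, ← sub_eq_add_neg,
      ← mulVec_sub]
    congr 1
    ext j
    simp [hΔ, mulVec, dotProduct_comm]

lemma implicit_iff (n d J : ℕ) (hd : 0 < d) (x : Fin n → Fin d → ℝ)
    (hx1 : ∀ i, x i ⟨0, hd⟩ = 1) (πs : Fin n → Fin (J + 1) → ℝ)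
    (hsum : ∀ i, ∑ w : Fin (J + 1), πs i w = 1)
    (hA : IsUnit (A n d x).det)
    (hG : IsUnit (gram n d J x πs).det) (q : Fin n → Fin (J + 1) → ℝ)
    (hq : ∀ i, ∑ w : Fin (J + 1), q i w = 1) :
    (∀ i, ∑ w : Fin (J + 1), q i w • rho n d J x πs i w = 0) ↔
      ∀ i j, q i (Fin.succ j) = x i ⬝ᵥ delta n d J x πs j := by
  obtain ⟨P, S, hSP, hr⟩ := rho_form n d J hd x hx1 πs hsum hA hG
  refine forall_congr' fun i => ?_
  have e : ∑ w : Fin (J + 1), q i w • rho n d J x πs i w =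
      P *ᵥ fun j => q i (Fin.succ j) - x i ⬝ᵥ delta n d J x πs j := by
    simp_rw [hr, ← mulVec_smul]
    rw [← mulVec_sum]
    congr 1
    ext j
    simp [mul_sub, ← Finset.sum_mul, hq]
  rw [e]
  constructor
  · intro h j
    have h2 := congrArg (fun v => S *ᵥ v) h
    simp only [mulVec_mulVec, hSP, one_mulVec, mulVec_zero] at h2
    exact sub_eq_zero.1 (congrFun h2 j)
  · intro h
    simp_rw [h, sub_self]
    exact mulVec_zero P

lemma piImp_sum (n d J : ℕ) (x : Fin n → Fin d → ℝ) (πs : Fin n → Fin (J + 1) → ℝ) (i : Fin n) :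
    ∑ w, piImp n d J x πs i w = 1 := by
  rw [Fin.sum_univ_succ]
  simp [piImp]

lemma eq_piImp (n d J : ℕ) (x : Fin n → Fin d → ℝ) (πs q : Fin n → Fin (J + 1) → ℝ)
    (hq : ∀ i, ∑ w : Fin (J + 1), q i w = 1) :
    q = piImp n d J x πs ↔ ∀ i j, q i (Fin.succ j) = x i ⬝ᵥ delta n d J x πs j := by
  constructor
  · intro h i j
    rw [h]
    simp [piImp]
  · intro h
    ext i w
    refine Fin.cases ?_ (fun j => ?_) w
    · have := hq i
      rw [Fin.sum_univ_succ] at this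
      simp only [h] at this
      simp only [piImp, Fin.cases_zero]
      linarith
    · simp [piImp, h]

lemma gram_unit (n d J : ℕ) (hn : 0 < n) (x : Fin n → Fin d → ℝ) (p : Fin n → Fin (J + 1) → ℝ)
    (hp : ∀ i w, 0 < p i w) (hx : ∀ v, (∀ i, x i ⬝ᵥ v = 0) → v = 0) :
    IsUnit (gram n d J x p).det := by
  rw [isUnit_iff_ne_zero]
  intro h0
  obtain ⟨v, hv, hGv⟩ := exists_mulVec_eq_zero_iff.2 h0
  apply hv
  have e : v ⬝ᵥ (gram n d J x p *ᵥ v) =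
      (n : ℝ)⁻¹ * ∑ i, ∑ w, p i w * (zv n d J x i w ⬝ᵥ v) ^ 2 := by
    rw [gram, smul_mulVec, dotProduct_smul, smul_eq_mul]
    simp only [Matrix.sum_mulVec, dotProduct_sum]
    congr 1
    refine Finset.sum_congr rfl fun i _ => Finset.sum_congr rfl fun w _ => ?_
    rw [smul_mulVec, dotProduct_smul, vecMulVec_mulVec, dotProduct_smul, dotProduct_comm v]
    simp only [smul_eq_mul, MulOpposite.smul_eq_mul_unop, MulOpposite.unop_op]
    ring
  rw [hGv, dotProduct_zero] at e
  have hn' : (n : ℝ)⁻¹ ≠ 0 := by positivity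
  have e2 := (mul_eq_zero.1 e.symm).resolve_left hn'
  have nn : ∀ i w, 0 ≤ p i w * (zv n d J x i w ⬝ᵥ v) ^ 2 := fun i w =>
    mul_nonneg (hp i w).le (sq_nonneg _)
  have hz : ∀ i w, zv n d J x i w ⬝ᵥ v = 0 := by
    intro i w
    have h1 := (Finset.sum_eq_zero_iff_of_nonneg
      (fun i _ => Finset.sum_nonneg fun w _ => nn i w)).1 e2 i (Finset.mem_univ _)
    have h2 := (Finset.sum_eq_zero_iff_of_nonneg (fun w _ => nn i w)).1 h1 w (Finset.mem_univ _)
    exact pow_eq_zero_iff (two_ne_zero) |>.1 ((mul_eq_zero.1 h2).resolve_left (hp i w).ne')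
  have hγ : (fun k => v (Sum.inr k)) = 0 := by
    apply hx
    intro i
    have := hz i 0
    simpa [zv, dotProduct, Fintype.sum_sum_type, (Fin.succ_ne_zero _).symm] using this
  ext a
  rcases a with j | k
  · have := hz ⟨0, hn⟩ (Fin.succ j)
    have hk : ∀ k, v (Sum.inr k) = 0 := fun k => congrFun hγ k
    simpa [zv, dotProduct, Fintype.sum_sum_type, hk] using this
  · exact congrFun hγ k

lemma partC (J : ℕ) (hJ : 1 < J) :
    ∃ (n' d' : ℕ) (hd' : 0 < d') (x' : Fin n' → Fin d' → ℝ)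
        (πs' : Fin n' → Fin (J + 1) → ℝ),
        (∀ i, x' i ⟨0, hd'⟩ = 1)
        ∧ (∀ i w, 0 ≤ πs' i w) ∧ (∀ i, ∑ w : Fin (J + 1), πs' i w = 1)
        ∧ IsUnit (A n' d' x').det
        ∧ IsUnit (gram n' d' J x' πs').det
        ∧ πs' = piImp n' d' J x' πs'
        ∧ ∃ (i : Fin n') (j : Fin J) (ℓ : Fin (J + 1)),
            ℓ ≠ 0 ∧ ℓ ≠ Fin.succ j ∧ πs' i ℓ * rho n' d' J x' πs' i ℓ j ≠ 0 := by
  obtain ⟨l, m, hlm⟩ : ∃ l m : Fin J, l ≠ m :=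
    ⟨⟨0, by omega⟩, ⟨1, hJ⟩, by simp [Fin.ext_iff]⟩
  let x : Fin 2 → Fin 2 → ℝ := ![![1, 0], ![1, 1]]
  let t : Fin 2 → ℝ := ![0, 1 / 2]
  let p : Fin 2 → Fin (J + 1) → ℝ := fun i w =>
    ((J : ℝ) + 1)⁻¹ * (1 + (if w = m.succ then t i else 0) - (if w = 0 then t i else 0))
  have hJ0 : (0 : ℝ) < ((J : ℝ) + 1)⁻¹ := by positivity
  have ht : ∀ i, 0 ≤ t i ∧ t i ≤ 1 / 2 := by
    intro i
    fin_cases i <;> norm_num [t]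
  have hpos : ∀ i w, 0 < p i w := by
    intro i w
    apply mul_pos hJ0
    have := ht i
    split_ifs <;> linarith
  have hsum : ∀ i, ∑ w, p i w = 1 := by
    intro i
    simp only [p]
    rw [← Finset.mul_sum, Finset.sum_sub_distrib, Finset.sum_add_distrib]
    simp
    field_simp
  have hx1 : ∀ i, x i ⟨0, two_pos⟩ = 1 := by
    intro i
    fin_cases i <;> simp [x]
  have hA : IsUnit (A 2 2 x).det := by
    rw [isUnit_iff_ne_zero, det_fin_two]
    simp [A, x, vecMulVec_apply, Fin.sum_univ_two]
    norm_num
  have hG : IsUnit (gram 2 2 J x p).det := by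
    refine gram_unit 2 2 J two_pos x p hpos fun v hv => ?_
    have h0 := hv 0
    have h1 := hv 1
    simp [x, dotProduct, Fin.sum_univ_two] at h0 h1
    ext k
    fin_cases k
    · simpa using h0
    · simp
      linarith
  have hδ : ∀ i j, p i (Fin.succ j) = x i ⬝ᵥ delta 2 2 J x p j := by
    intro i j
    have hv : ∀ i, p i (Fin.succ j) = x i ⬝ᵥ ![p 0 j.succ, p 1 j.succ - p 0 j.succ] := by
      intro i
      fin_cases i <;> simp [x, dotProduct, Fin.sum_univ_two]
    rw [delta_eq 2 2 J x p hA j _ hv]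
    exact hv i
  refine ⟨2, 2, two_pos, x, p, hx1, fun i w => (hpos i w).le, hsum, hA, hG,
    (eq_piImp 2 2 J x p p hsum).2 hδ, ?_⟩
  by_contra hcon
  push Not at hcon
  obtain ⟨P, S, hSP, hr⟩ := rho_form 2 2 J two_pos x hx1 p hsum hA hG
  have key : ∀ i j, (if l = j then 1 else 0) - p i j.succ = S j l * rho 2 2 J x p i l.succ l := by
    intro i j
    have h1 := congrFun (congrArg (fun v => S *ᵥ v) (hr i l.succ)) j
    simp only [mulVec_mulVec, hSP, one_mulVec, ← hδ, Fin.succ_inj] at h1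
    rw [← h1, mulVec, dotProduct, Finset.sum_eq_single l]
    · intro b _ hb
      have := hcon i b l.succ (Fin.succ_ne_zero _) (fun h => hb (Fin.succ_injective _ h).symm)
      rw [(mul_eq_zero.1 this).resolve_left (hpos i _).ne', mul_zero]
    · simp
  have a0 := key 0 l
  have a1 := key 1 l
  have b0 := key 0 m
  have b1 := key 1 m
  have hJ1 : ((J : ℝ) + 1)⁻¹ < 1 := by
    apply inv_lt_one_of_one_lt₀
    have : (1 : ℝ) < J := by exact_mod_cast hJ
    linarith
  generalize rho 2 2 J x p 0 l.succ l = c0 at a0 b0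
  generalize rho 2 2 J x p 1 l.succ l = c1 at a1 b1
  simp [p, t, hlm] at a0 a1 b0 b1
  have hS : S l l ≠ 0 := by
    intro h
    rw [h] at a0
    linarith
  have hc : c0 = c1 := mul_left_cancel₀ hS (a0.symm.trans a1)
  subst hc
  linarith

/-- Goldsmith-Pinkham et al.: for the multivalued-treatment specification,
(a) the unique implicit design is `π_i(j) = x_i'δ_j`, Gram-consistent regardless of whether
it equals `π*`; (b) `π*` equals the implicit design iff `π*_i(j) = x_i'δ_j` for all `i,j`;
(c) there exist configurations with `π*` equal to the implicit design whose implicit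
estimand is contaminated. -/
theorem contamination
    (J : ℕ) (hJ : 1 < J)
    (n d : ℕ) (hd : 0 < d) (x : Fin n → Fin d → ℝ)
    (hx1 : ∀ i, x i ⟨0, hd⟩ = 1)
    (πs : Fin n → Fin (J + 1) → ℝ)
    (hpos : ∀ i w, 0 ≤ πs i w) (hsum : ∀ i, ∑ w : Fin (J + 1), πs i w = 1)
    (hA : IsUnit (A n d x).det)
    (hG : IsUnit (gram n d J x πs).det) :
    (ImplicitDesign n d J x πs (piImp n d J x πs)
      ∧ (∀ q, ImplicitDesign n d J x πs q → q = piImp n d J x πs)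
      ∧ gram n d J x (piImp n d J x πs) = gram n d J x πs)
    ∧ (πs = piImp n d J x πs ↔
        ∀ (i : Fin n) (j : Fin J), πs i (Fin.succ j) = x i ⬝ᵥ delta n d J x πs j)
    ∧ (∃ (n' d' : ℕ) (hd' : 0 < d') (x' : Fin n' → Fin d' → ℝ)
        (πs' : Fin n' → Fin (J + 1) → ℝ),
        (∀ i, x' i ⟨0, hd'⟩ = 1)
        ∧ (∀ i w, 0 ≤ πs' i w) ∧ (∀ i, ∑ w : Fin (J + 1), πs' i w = 1)
        ∧ IsUnit (A n' d' x').det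
        ∧ IsUnit (gram n' d' J x' πs').det
        ∧ πs' = piImp n' d' J x' πs'
        ∧ ∃ (i : Fin n') (j : Fin J) (ℓ : Fin (J + 1)),
            ℓ ≠ 0 ∧ ℓ ≠ Fin.succ j ∧ πs' i ℓ * rho n' d' J x' πs' i ℓ j ≠ 0) := by
  have hI := implicit_iff n d J hd x hx1 πs hsum hA hG
  refine ⟨⟨⟨?_, piImp_sum n d J x πs⟩, ?_, ?_⟩, eq_piImp n d J x πs πs hsum, partC J hJ⟩
  · exact (hI _ (piImp_sum n d J x πs)).2 fun i j => by simp [piImp]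
  · rintro q ⟨h1, h2⟩
    exact (eq_piImp n d J x πs q h2).2 ((hI q h2).1 h1)
  · rw [gram_blocks n d J hd x hx1 _ (piImp_sum n d J x πs), gram_blocks n d J hd x hx1 πs hsum,
      Bm_piImp n d J x πs hA]

end Stmt5
end

section
/- Suppose x_i represents saturated discrete covariates taking values in {0,…,L}, encoded as indicators x_{iℓ} = 1(x_i = ℓ) for ℓ = 1,…,L, and let x̄ = (1/n) Σ_i x_i. For the specification Y_i = α_0 + γ_1'x_i + τ W_i + W_i (x_i − x̄)'γ_2 + ε_i with binary treatment and τ the coefficient of interest, let π(ℓ) denote the mean of π*_j over units j with x_j = ℓ. Then: (a) the unique implicit design assigns to every unit i with x_i = ℓ the value π_i = π(ℓ), and it is Gram-consistent regardless of whether it equals π*; (b) π* equals the implicit design if and only if π*_i is the same for all units sharing the same x-value; (c) the implicit-estimand weights are ω_i = 1 for every i, i.e., the implicit estimand is the average treatment effect (1/n) Σ_i (y_i(1) − y_i(0)). -/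
open Matrix BigOperators

namespace Stmt6

/-- Indicator encoding of the saturated discrete covariate: `x_{iℓ} = 1(c_i = ℓ)`
for `ℓ = 1,…,L`. -/
def xv (n L : ℕ) (c : Fin n → Fin (L + 1)) (i : Fin n) : Fin L → ℝ :=
  fun ℓ => if c i = Fin.succ ℓ then 1 else 0

/-- `x̄ = (1/n) Σ_i x_i`. -/
noncomputable def xbar (n L : ℕ) (c : Fin n → Fin (L + 1)) : Fin L → ℝ :=
  (n : ℝ)⁻¹ • ∑ i : Fin n, xv n L c i

/-- Covariate transform for `Y_i = α_0 + γ_1'x_i + τ W_i + W_i (x_i - x̄)'γ_2 + ε_i`. -/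
noncomputable def zv (n L : ℕ) (c : Fin n → Fin (L + 1)) (i : Fin n) (w : Bool) :
    (Unit ⊕ Fin L ⊕ Unit ⊕ Fin L) → ℝ :=
  Sum.elim (fun _ => 1)
    (Sum.elim (xv n L c i)
      (Sum.elim (fun _ => if w then 1 else 0)
        (fun ℓ => (if w then (1 : ℝ) else 0) * (xv n L c i ℓ - xbar n L c ℓ))))

/-- The contrast vector picking out the coefficient on `W`. -/
def lam (L : ℕ) : (Unit ⊕ Fin L ⊕ Unit ⊕ Fin L) → ℝ :=
  Sum.elim (fun _ => 0) (Sum.elim (fun _ => 0) (Sum.elim (fun _ => 1) (fun _ => 0)))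

/-- Gram matrix of a binary-treatment design `p`. -/
noncomputable def gram (n L : ℕ) (c : Fin n → Fin (L + 1)) (p : Fin n → ℝ) :
    Matrix (Unit ⊕ Fin L ⊕ Unit ⊕ Fin L) (Unit ⊕ Fin L ⊕ Unit ⊕ Fin L) ℝ :=
  (n : ℝ)⁻¹ • ∑ i : Fin n,
    (p i • vecMulVec (zv n L c i true) (zv n L c i true)
      + (1 - p i) • vecMulVec (zv n L c i false) (zv n L c i false))

/-- Potential weights `ρ_i(w) = Λ G_n⁻¹ z(x_i,w)` relative to the true design `πs`. -/
noncomputable def rho (n L : ℕ) (c : Fin n → Fin (L + 1)) (πs : Fin n → ℝ)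
    (i : Fin n) (w : Bool) : ℝ :=
  lam L ⬝ᵥ ((gram n L c πs)⁻¹ *ᵥ zv n L c i w)

/-- Scalar regression estimand. -/
noncomputable def tau (n L : ℕ) (c : Fin n → Fin (L + 1)) (πs : Fin n → ℝ)
    (y : Fin n → Bool → ℝ) : ℝ :=
  lam L ⬝ᵥ ((gram n L c πs)⁻¹ *ᵥ ((n : ℝ)⁻¹ •
    ∑ i : Fin n, ((πs i * y i true) • zv n L c i true
      + ((1 - πs i) * y i false) • zv n L c i false)))

/-- Mean of `π*_j` over the units `j` whose covariate value is `ℓ`. -/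
noncomputable def pibar (n L : ℕ) (c : Fin n → Fin (L + 1)) (πs : Fin n → ℝ)
    (ℓ : Fin (L + 1)) : ℝ :=
  (∑ j ∈ Finset.univ.filter (fun j => c j = ℓ), πs j)
    / ((Finset.univ.filter (fun j : Fin n => c j = ℓ)).card : ℝ)

/-- `q` is an (improper) implicit design. -/
def ImplicitDesign (n L : ℕ) (c : Fin n → Fin (L + 1)) (πs : Fin n → ℝ)
    (q : Fin n → ℝ) : Prop :=
  ∀ i, q i * rho n L c πs i true + (1 - q i) * rho n L c πs i false = 0

/-- cell-level regressor -/
noncomputable def zc (n L : ℕ) (c : Fin n → Fin (L + 1)) (l : Fin (L + 1)) (w : Bool) :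
    (Unit ⊕ Fin L ⊕ Unit ⊕ Fin L) → ℝ :=
  Sum.elim (fun _ => 1)
    (Sum.elim (fun k => if l = Fin.succ k then 1 else 0)
      (Sum.elim (fun _ => if w then 1 else 0)
        (fun k => (if w then (1 : ℝ) else 0) *
          ((if l = Fin.succ k then 1 else 0) - xbar n L c k))))

theorem zv_eq (n L : ℕ) (c : Fin n → Fin (L + 1)) (i : Fin n) (w : Bool) :
    zv n L c i w = zc n L c (c i) w := rfl

theorem expand (L : ℕ) (f : Fin (L + 1) → ℝ) (l : Fin (L + 1)) :
    f 0 + ∑ k : Fin L, (f k.succ - f 0) * (if l = Fin.succ k then 1 else 0) = f l := by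
  refine Fin.cases ?_ (fun m => ?_) l
  · simp [(Fin.succ_ne_zero _).symm]
  · simp [Fin.succ_inj]

theorem pibar_mul (n L : ℕ) (c : Fin n → Fin (L + 1)) (πs : Fin n → ℝ) (i : Fin n) :
    pibar n L c πs (c i) * ((Finset.univ.filter (fun j : Fin n => c j = c i)).card : ℝ)
      = ∑ j ∈ Finset.univ.filter (fun j => c j = c i), πs j := by
  unfold pibar
  rw [div_mul_cancel₀]
  have : 0 < (Finset.univ.filter (fun j : Fin n => c j = c i)).card :=
    Finset.card_pos.mpr ⟨i, by simp⟩
  positivity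

theorem sum_pibar (n L : ℕ) (c : Fin n → Fin (L + 1)) (πs : Fin n → ℝ)
    (F : Fin (L + 1) → ℝ) :
    ∑ i, pibar n L c πs (c i) * F (c i) = ∑ i, πs i * F (c i) := by
  rw [← Finset.sum_fiberwise Finset.univ c, ← Finset.sum_fiberwise Finset.univ c]
  refine Finset.sum_congr rfl fun l _ => ?_
  have h1 : ∑ i ∈ Finset.univ.filter (fun j => c j = l), pibar n L c πs (c i) * F (c i)
      = ∑ i ∈ Finset.univ.filter (fun j => c j = l), pibar n L c πs l * F l :=
    Finset.sum_congr rfl fun i hi => by rw [(Finset.mem_filter.mp hi).2]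
  have h2 : ∑ i ∈ Finset.univ.filter (fun j => c j = l), πs i * F (c i)
      = ∑ i ∈ Finset.univ.filter (fun j => c j = l), πs i * F l :=
    Finset.sum_congr rfl fun i hi => by rw [(Finset.mem_filter.mp hi).2]
  rw [h1, h2, Finset.sum_const, nsmul_eq_mul, ← Finset.sum_mul]
  by_cases h : ∃ i, c i = l
  · obtain ⟨i, rfl⟩ := h
    rw [← pibar_mul]; ring
  · have : Finset.univ.filter (fun j => c j = l) = ∅ := by
      ext j; simp; exact fun hj => h ⟨j, hj⟩
    rw [this]; simp

theorem gram_eq (n L : ℕ) (c : Fin n → Fin (L + 1)) (πs : Fin n → ℝ) :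
    gram n L c (fun i => pibar n L c πs (c i)) = gram n L c πs := by
  unfold gram
  congr 1
  ext a b
  simp only [Matrix.sum_apply, Matrix.add_apply, Matrix.smul_apply, vecMulVec_apply, zv_eq,
    smul_eq_mul]
  have h := sum_pibar n L c πs (fun l => zc n L c l true a * zc n L c l true b
    - zc n L c l false a * zc n L c l false b)
  have e : ∀ p : Fin n → ℝ, ∑ i, (p i * (zc n L c (c i) true a * zc n L c (c i) true b)
      + (1 - p i) * (zc n L c (c i) false a * zc n L c (c i) false b))
      = ∑ i, p i * (zc n L c (c i) true a * zc n L c (c i) true b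
        - zc n L c (c i) false a * zc n L c (c i) false b)
       + ∑ i, (zc n L c (c i) false a * zc n L c (c i) false b) := by
    intro p
    rw [← Finset.sum_add_distrib]
    exact Finset.sum_congr rfl fun i _ => by ring
  rw [e, e, h]

/-- normal equations tested against `v` -/
theorem normal_eq (n L : ℕ) (c : Fin n → Fin (L + 1)) (πs : Fin n → ℝ)
    (hG : IsUnit (gram n L c πs).det) (v : (Unit ⊕ Fin L ⊕ Unit ⊕ Fin L) → ℝ) :
    (n : ℝ)⁻¹ * ∑ i, (πs i * rho n L c πs i true * (zv n L c i true ⬝ᵥ v)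
      + (1 - πs i) * rho n L c πs i false * (zv n L c i false ⬝ᵥ v)) = lam L ⬝ᵥ v := by
  have h : lam L ⬝ᵥ ((gram n L c πs)⁻¹ *ᵥ (gram n L c πs *ᵥ v)) = lam L ⬝ᵥ v := by
    rw [mulVec_mulVec, nonsing_inv_mul _ hG, one_mulVec]
  rw [← h]
  have h2 : gram n L c πs *ᵥ v = (n : ℝ)⁻¹ • ∑ i,
      ((πs i * (zv n L c i true ⬝ᵥ v)) • zv n L c i true
      + ((1 - πs i) * (zv n L c i false ⬝ᵥ v)) • zv n L c i false) := by
    conv_lhs => unfold gram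
    rw [smul_mulVec, sum_mulVec]
    congr 1
    refine Finset.sum_congr rfl fun i _ => ?_
    rw [add_mulVec, smul_mulVec, smul_mulVec, vecMulVec_mulVec, vecMulVec_mulVec]
    ext a
    simp [mul_assoc, mul_comm]
  rw [h2]
  simp only [mulVec_smul, mulVec_sum, mulVec_add, dotProduct_smul, dotProduct_sum,
    dotProduct_add, smul_eq_mul]
  congr 1
  refine Finset.sum_congr rfl fun i _ => ?_
  simp only [rho]
  ring

theorem tau_eq (n L : ℕ) (c : Fin n → Fin (L + 1)) (πs : Fin n → ℝ)
    (y : Fin n → Bool → ℝ) : tau n L c πs y = (n : ℝ)⁻¹ * ∑ i,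
      (πs i * y i true * rho n L c πs i true
        + (1 - πs i) * y i false * rho n L c πs i false) := by
  unfold tau
  simp only [mulVec_smul, mulVec_sum, mulVec_add, dotProduct_smul, dotProduct_sum,
    dotProduct_add, smul_eq_mul, rho]

theorem xbar_expand (n L : ℕ) (hn : (n : ℝ) ≠ 0) (c : Fin n → Fin (L + 1))
    (f : Fin (L + 1) → ℝ) :
    f 0 + ∑ k : Fin L, (f k.succ - f 0) * xbar n L c k = (n : ℝ)⁻¹ * ∑ i, f (c i) := by
  have : ∑ i, f (c i) = ∑ i, (f 0 + ∑ k : Fin L, (f k.succ - f 0) * xv n L c i k) :=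
    Finset.sum_congr rfl fun i _ => (expand L f (c i)).symm
  rw [this, Finset.sum_add_distrib, Finset.sum_comm, mul_add]
  congr 1
  · simp [hn]
  · rw [Finset.mul_sum]
    refine Finset.sum_congr rfl fun k _ => ?_
    rw [← Finset.mul_sum]
    simp only [xbar, Pi.smul_apply, Finset.sum_apply, smul_eq_mul]
    ring

theorem treated_eq (n L : ℕ) (hn : (n : ℝ) ≠ 0) (c : Fin n → Fin (L + 1)) (πs : Fin n → ℝ)
    (hG : IsUnit (gram n L c πs).det) (f : Fin (L + 1) → ℝ) :
    ∑ i, πs i * rho n L c πs i true * f (c i) = ∑ i, f (c i) := by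
  have h := normal_eq n L c πs hG (Sum.elim (fun _ => 0) (Sum.elim (fun _ => 0)
    (Sum.elim (fun _ => f 0 + ∑ k : Fin L, (f k.succ - f 0) * xbar n L c k)
      (fun k => f k.succ - f 0))))
  have ht : ∀ i, zv n L c i true ⬝ᵥ (Sum.elim (fun _ => 0) (Sum.elim (fun _ => 0)
    (Sum.elim (fun _ => f 0 + ∑ k : Fin L, (f k.succ - f 0) * xbar n L c k)
      (fun k => f k.succ - f 0)))) = f (c i) := by
    intro i
    rw [← expand L f (c i)]
    simp only [zv, dotProduct, Fintype.sum_sum_type, Sum.elim_inl, Sum.elim_inr, xv]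
    simp only [Finset.univ_unique, Finset.sum_singleton, mul_zero, Finset.sum_const_zero,
      zero_add, if_true, one_mul]
    rw [add_assoc, ← Finset.sum_add_distrib]
    congr 1
    exact Finset.sum_congr rfl fun k _ => by ring
  have hf : ∀ i, zv n L c i false ⬝ᵥ (Sum.elim (fun _ => 0) (Sum.elim (fun _ => 0)
    (Sum.elim (fun _ => f 0 + ∑ k : Fin L, (f k.succ - f 0) * xbar n L c k)
      (fun k => f k.succ - f 0)))) = 0 := by
    intro i
    simp [zv, dotProduct, Fintype.sum_sum_type]
  have hl : lam L ⬝ᵥ (Sum.elim (fun _ => 0) (Sum.elim (fun _ => 0)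
    (Sum.elim (fun _ => f 0 + ∑ k : Fin L, (f k.succ - f 0) * xbar n L c k)
      (fun k => f k.succ - f 0)))) = (n : ℝ)⁻¹ * ∑ i, f (c i) := by
    rw [← xbar_expand n L hn c f]
    simp [lam, dotProduct, Fintype.sum_sum_type]
  simp only [ht, hf, hl, mul_zero, add_zero] at h
  exact mul_left_cancel₀ (inv_ne_zero hn) h

theorem control_eq (n L : ℕ) (hn : (n : ℝ) ≠ 0) (c : Fin n → Fin (L + 1)) (πs : Fin n → ℝ)
    (hG : IsUnit (gram n L c πs).det) (f : Fin (L + 1) → ℝ) :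
    ∑ i, (1 - πs i) * rho n L c πs i false * f (c i) = - ∑ i, f (c i) := by
  have h := normal_eq n L c πs hG (Sum.elim (fun _ => f 0) (Sum.elim (fun k => f k.succ - f 0)
    (Sum.elim (fun _ => 0) (fun _ => 0))))
  have ht : ∀ i w, zv n L c i w ⬝ᵥ (Sum.elim (fun _ => f 0) (Sum.elim (fun k => f k.succ - f 0)
    (Sum.elim (fun _ => 0) (fun _ => 0)))) = f (c i) := by
    intro i w
    rw [← expand L f (c i)]
    simp [zv, dotProduct, Fintype.sum_sum_type, xv]
  have hl : lam L ⬝ᵥ (Sum.elim (fun _ => f 0) (Sum.elim (fun k => f k.succ - f 0)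
    (Sum.elim (fun _ => 0) (fun _ => 0)))) = 0 := by
    simp [lam, dotProduct, Fintype.sum_sum_type]
  simp only [ht, hl, Finset.sum_add_distrib, treated_eq n L hn c πs hG f] at h
  have := (mul_eq_zero.mp h).resolve_left (inv_ne_zero hn)
  linarith

theorem weight_cell (n L : ℕ) (c : Fin n → Fin (L + 1)) (p : Fin n → ℝ) (i : Fin n)
    (r : Fin n → ℝ) (hr : ∀ j, c j = c i → r j = r i) (s : ℝ)
    (h : ∑ j, p j * r j * (if c j = c i then 1 else 0)
      = s * ∑ j, (if c j = c i then (1 : ℝ) else 0)) :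
    pibar n L c p (c i) * r i = s := by
  have hc : (0 : ℝ) < ((Finset.univ.filter (fun j : Fin n => c j = c i)).card : ℝ) := by
    exact_mod_cast Finset.card_pos.mpr ⟨i, by simp⟩
  have h1 : ∑ j, p j * r j * (if c j = c i then 1 else 0)
      = (∑ j ∈ Finset.univ.filter (fun j => c j = c i), p j) * r i := by
    rw [Finset.sum_mul, Finset.sum_filter]
    refine Finset.sum_congr rfl fun j _ => ?_
    split_ifs with hj
    · rw [hr j hj, mul_one]
    · simp
  rw [h1, ← pibar_mul, Finset.sum_boole] at h
  apply mul_right_cancel₀ hc.ne'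
  linarith

theorem rho_cell (n L : ℕ) (c : Fin n → Fin (L + 1)) (πs : Fin n → ℝ) (i j : Fin n) (w : Bool)
    (h : c j = c i) : rho n L c πs j w = rho n L c πs i w := by
  simp only [rho, zv_eq, h]

theorem pibar_compl (n L : ℕ) (c : Fin n → Fin (L + 1)) (πs : Fin n → ℝ) (i : Fin n) :
    pibar n L c (fun j => 1 - πs j) (c i) = 1 - pibar n L c πs (c i) := by
  have hc : (0 : ℝ) < ((Finset.univ.filter (fun j : Fin n => c j = c i)).card : ℝ) := by
    exact_mod_cast Finset.card_pos.mpr ⟨i, by simp⟩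
  apply mul_right_cancel₀ hc.ne'
  rw [pibar_mul, sub_mul, pibar_mul]
  simp

/-- saturated interacted regression: (a) the unique implicit design assigns
to each unit the group mean `π(ℓ)` of the true design over its covariate cell, and it is
Gram-consistent regardless of whether it equals `π*`; (b) `π*` equals the implicit design
iff `π*` is constant on covariate cells; (c) all implicit-estimand weights are 1, i.e. the
implicit estimand is the average treatment effect. -/
theorem saturated_interacted
    (n L : ℕ) (c : Fin n → Fin (L + 1))
    (πs : Fin n → ℝ) (h01 : ∀ i, 0 ≤ πs i ∧ πs i ≤ 1)
    (hG : IsUnit (gram n L c πs).det) :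
    (ImplicitDesign n L c πs (fun i => pibar n L c πs (c i))
      ∧ (∀ q, ImplicitDesign n L c πs q → q = fun i => pibar n L c πs (c i))
      ∧ gram n L c (fun i => pibar n L c πs (c i)) = gram n L c πs)
    ∧ (πs = (fun i => pibar n L c πs (c i)) ↔ ∀ i j, c i = c j → πs i = πs j)
    ∧ ((∀ i, pibar n L c πs (c i) * rho n L c πs i true = 1)
      ∧ (πs = (fun i => pibar n L c πs (c i)) →
          ∀ y : Fin n → Bool → ℝ,
            tau n L c πs y = (n : ℝ)⁻¹ * ∑ i : Fin n, (y i true - y i false))) := by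
  have hn : ∀ i : Fin n, (n : ℝ) ≠ 0 := fun i => by
    have := i.pos
    positivity
  have h1 : ∀ i, pibar n L c πs (c i) * rho n L c πs i true = 1 := fun i =>
    weight_cell n L c πs i (fun j => rho n L c πs j true)
      (fun j hj => rho_cell n L c πs i j true hj) 1
      (by rw [one_mul]; exact treated_eq n L (hn i) c πs hG (fun l => if l = c i then 1 else 0))
  have h0 : ∀ i, (1 - pibar n L c πs (c i)) * rho n L c πs i false = -1 := fun i => by
    rw [← pibar_compl]
    exact weight_cell n L c (fun j => 1 - πs j) i (fun j => rho n L c πs j false)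
      (fun j hj => rho_cell n L c πs i j false hj) (-1)
      (by rw [neg_one_mul]
          exact control_eq n L (hn i) c πs hG (fun l => if l = c i then 1 else 0))
  refine ⟨⟨fun i => ?_, fun q hq => ?_, gram_eq n L c πs⟩, ⟨fun h i j hij => ?_, fun h => ?_⟩,
    h1, fun h y => ?_⟩
  · show pibar n L c πs (c i) * _ + (1 - pibar n L c πs (c i)) * _ = 0
    rw [h1, h0]; norm_num
  · funext i
    have a := h1 i
    have b := h0 i
    have d := hq i
    have e : (q i - pibar n L c πs (c i)) * (rho n L c πs i true - rho n L c πs i false) = 0 := by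
      linear_combination d - a - b
    rcases mul_eq_zero.mp e with e | e
    · linarith
    · exfalso
      have e' : rho n L c πs i true = rho n L c πs i false := by linarith
      rw [e'] at a
      have z : rho n L c πs i false = 0 := by linarith
      rw [z] at a
      simp at a
  · rw [h]; simp only [hij]
  · funext i
    have hc : (0 : ℝ) < ((Finset.univ.filter (fun j : Fin n => c j = c i)).card : ℝ) := by
      exact_mod_cast Finset.card_pos.mpr ⟨i, by simp⟩
    apply mul_right_cancel₀ hc.ne'
    rw [pibar_mul, Finset.sum_congr rfl (fun j hj => h j i (Finset.mem_filter.mp hj).2)]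
    simp [mul_comm]
  · rw [tau_eq]
    congr 1
    refine Finset.sum_congr rfl fun i _ => ?_
    have a := h1 i
    have b := h0 i
    have hi : πs i = pibar n L c πs (c i) := congrFun h i
    rw [← hi] at a b
    linear_combination y i true * a + y i false * b

end Stmt6
end

section
/- Let 𝒲 ⊂ {0,1}^T be a set of binary treatment paths whose nonzero elements are linearly independent vectors whose linear span excludes the all-ones vector 1_T. For the two-way fixed effects specification Y_{it} = α_i + μ_t + τ W_{it} + ε_{it} with τ the coefficient of interest: (a) the unique implicit design is constant across units and equals π_i(w) = (1/n) Σ_{j=1}^n π*_j(w) for every i and w ∈ 𝒲, and it is Gram-consistent regardless of whether it equals π*; (b) π* equals the implicit design if and only if π*_i is the same for all units i; (c) when π equals this implicit design, the implicit estimand places weight ω_t(π,w) = π(w) g_t(w) / (Σ_{s=1}^T Σ_{w'∈𝒲} π(w') g_s(w')²) on y_{it}(w), where w_π = Σ_{w'∈𝒲} π(w') w' and g_t(w) = w_t − w_{π,t} − (1_T'w − 1_T'w_π)/T. -/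
open Matrix BigOperators

namespace Stmt8

/-- Covariate transform for the TWFE specification `Y_{it} = α_i + μ_t + τ W_{it} + ε_{it}`,
with unit fixed effects parametrized by the within-transformation and time dummies for
periods `1,…,T-1` (within-transformed): index `Unit` is the (demeaned) treatment and
`Fin T'` are the demeaned time dummies. -/
noncomputable def zv (T' : ℕ) (t : Fin (T' + 1)) (w : Fin (T' + 1) → ℝ) :
    (Unit ⊕ Fin T') → ℝ :=
  Sum.elim (fun _ => w t - (∑ s, w s) / (T' + 1))
    (fun s => (if t = Fin.succ s then (1 : ℝ) else 0) - (T' + 1 : ℝ)⁻¹)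

/-- The contrast vector picking out the coefficient on `W_{it}`. -/
def lam (T' : ℕ) : (Unit ⊕ Fin T') → ℝ := Sum.elim (fun _ => 1) (fun _ => 0)

/-- Gram matrix of a design `p` on the set `WS` of treatment paths. -/
noncomputable def gram (n T' : ℕ) (WS : Finset (Fin (T' + 1) → ℝ))
    (p : Fin n → (Fin (T' + 1) → ℝ) → ℝ) : Matrix (Unit ⊕ Fin T') (Unit ⊕ Fin T') ℝ :=
  (n : ℝ)⁻¹ • ∑ i : Fin n, ∑ t : Fin (T' + 1), ∑ w ∈ WS,
    p i w • vecMulVec (zv T' t w) (zv T' t w)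

/-- Potential weights `ρ_{it}(w) = Λ G_n⁻¹ z_t(w)` (they do not depend on `i`). -/
noncomputable def rho (n T' : ℕ) (WS : Finset (Fin (T' + 1) → ℝ))
    (πs : Fin n → (Fin (T' + 1) → ℝ) → ℝ) (t : Fin (T' + 1)) (w : Fin (T' + 1) → ℝ) : ℝ :=
  lam T' ⬝ᵥ ((gram n T' WS πs)⁻¹ *ᵥ zv T' t w)

/-- Average assignment probabilities `π̄(w) = (1/n) Σ_j π*_j(w)`. -/
noncomputable def pibar (n T' : ℕ) (πs : Fin n → (Fin (T' + 1) → ℝ) → ℝ)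
    (w : Fin (T' + 1) → ℝ) : ℝ :=
  (n : ℝ)⁻¹ * ∑ j : Fin n, πs j w

/-- `w_π = Σ_{w'∈𝒲} π̄(w') w'`. -/
noncomputable def wpi (n T' : ℕ) (WS : Finset (Fin (T' + 1) → ℝ))
    (πs : Fin n → (Fin (T' + 1) → ℝ) → ℝ) (t : Fin (T' + 1)) : ℝ :=
  ∑ w' ∈ WS, pibar n T' πs w' * w' t

/-- `g_t(w) = w_t - w_{π,t} - (1'w - 1'w_π)/T`. -/
noncomputable def g (n T' : ℕ) (WS : Finset (Fin (T' + 1) → ℝ))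
    (πs : Fin n → (Fin (T' + 1) → ℝ) → ℝ) (t : Fin (T' + 1)) (w : Fin (T' + 1) → ℝ) : ℝ :=
  w t - wpi n T' WS πs t - ((∑ s, w s) - ∑ s, wpi n T' WS πs s) / (T' + 1)

/-- `q` is an (improper) implicit design. -/
def ImplicitDesign (n T' : ℕ) (WS : Finset (Fin (T' + 1) → ℝ))
    (πs q : Fin n → (Fin (T' + 1) → ℝ) → ℝ) : Prop :=
  (∀ (i : Fin n) (t : Fin (T' + 1)), ∑ w ∈ WS, q i w * rho n T' WS πs t w = 0)
  ∧ (∀ i, ∑ w ∈ WS, q i w = 1)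

theorem gram_eq (n T' : ℕ) (WS : Finset (Fin (T' + 1) → ℝ))
    (πs : Fin n → (Fin (T' + 1) → ℝ) → ℝ) (j k : Unit ⊕ Fin T') :
    gram n T' WS πs j k = ∑ t : Fin (T' + 1), ∑ w ∈ WS,
      pibar n T' πs w * (zv T' t w j * zv T' t w k) := by
  unfold gram pibar
  simp only [Matrix.smul_apply, Matrix.sum_apply, vecMulVec_apply, smul_eq_mul]
  rw [Finset.sum_comm, Finset.mul_sum]
  refine Finset.sum_congr rfl fun t _ => ?_
  rw [Finset.sum_comm, Finset.mul_sum]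
  refine Finset.sum_congr rfl fun w _ => ?_
  rw [mul_assoc, Finset.sum_mul]

theorem pibar_const (n T' : ℕ) (hn : n ≠ 0) (f : (Fin (T' + 1) → ℝ) → ℝ) (w) :
    pibar n T' (fun _ => f) w = f w := by
  have : (n : ℝ) ≠ 0 := by exact_mod_cast hn
  unfold pibar
  simp
  field_simp

theorem zv_sum (T' : ℕ) (w : Fin (T' + 1) → ℝ) (k) : ∑ t, zv T' t w k = 0 := by
  have : (T' + 1 : ℝ) ≠ 0 := by positivity
  rcases k with u | s
  · simp only [zv, Sum.elim_inl, Finset.sum_sub_distrib, Finset.sum_const, Finset.card_univ,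
      Fintype.card_fin, nsmul_eq_mul]
    push_cast
    field_simp
    ring
  · simp [zv, Finset.sum_sub_distrib, this]

theorem key (n T' : ℕ) (WS : Finset (Fin (T' + 1) → ℝ))
    (πs : Fin n → (Fin (T' + 1) → ℝ) → ℝ) (hG : IsUnit (gram n T' WS πs).det)
    (k : Unit ⊕ Fin T') :
    ∑ t : Fin (T' + 1), ∑ w ∈ WS, pibar n T' πs w * rho n T' WS πs t w * zv T' t w k
      = lam T' k := by
  have h : (lam T' ᵥ* (gram n T' WS πs)⁻¹) ᵥ* (gram n T' WS πs) = lam T' := by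
    rw [vecMul_vecMul, Matrix.nonsing_inv_mul _ hG, vecMul_one]
  have h2 := congrFun h k
  rw [← h2]
  simp only [rho, dotProduct_mulVec]
  generalize lam T' ᵥ* (gram n T' WS πs)⁻¹ = r
  simp only [vecMul, dotProduct, gram_eq, Finset.mul_sum, Finset.sum_mul]
  rw [Finset.sum_comm (s := (Finset.univ : Finset (Unit ⊕ Fin T')))]
  refine Finset.sum_congr rfl fun t _ => ?_
  rw [Finset.sum_comm (s := (Finset.univ : Finset (Unit ⊕ Fin T')))]
  refine Finset.sum_congr rfl fun w _ => Finset.sum_congr rfl fun j _ => ?_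
  ring

theorem rho_form (n T' : ℕ) (WS : Finset (Fin (T' + 1) → ℝ))
    (πs : Fin n → (Fin (T' + 1) → ℝ) → ℝ) :
    (∀ w, ∑ t, rho n T' WS πs t w = 0) ∧
    ∃ (a : ℝ) (c : Fin (T' + 1) → ℝ), ∀ t w,
      rho n T' WS πs t w = a * (w t - (∑ s, w s) / (T' + 1)) + c t := by
  simp only [rho, dotProduct_mulVec]
  generalize lam T' ᵥ* (gram n T' WS πs)⁻¹ = r
  constructor
  · intro w
    simp only [dotProduct]
    rw [Finset.sum_comm]
    simp only [← Finset.mul_sum, zv_sum, mul_zero, Finset.sum_const_zero]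
  · refine ⟨r (Sum.inl ()), fun t => ∑ s : Fin T', r (Sum.inr s) *
      ((if t = Fin.succ s then (1 : ℝ) else 0) - (T' + 1 : ℝ)⁻¹), fun t w => ?_⟩
    simp [dotProduct, zv, Fintype.sum_sum_type]

theorem mean_zero (n T' : ℕ) (WS : Finset (Fin (T' + 1) → ℝ))
    (πs : Fin n → (Fin (T' + 1) → ℝ) → ℝ) (hG : IsUnit (gram n T' WS πs).det)
    (t : Fin (T' + 1)) :
    ∑ w ∈ WS, pibar n T' πs w * rho n T' WS πs t w = 0 := by
  set m : Fin (T' + 1) → ℝ := fun t => ∑ w ∈ WS, pibar n T' πs w * rho n T' WS πs t w with hm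
  have hs : ∑ t, m t = 0 := by
    simp only [hm]
    rw [Finset.sum_comm]
    simp only [← Finset.mul_sum, (rho_form n T' WS πs).1, mul_zero, Finset.sum_const_zero]
  have hsucc : ∀ s : Fin T', m s.succ = 0 := by
    intro s
    have h := key n T' WS πs hG (Sum.inr s)
    simp only [zv, lam, Sum.elim_inr, ← Finset.sum_mul] at h
    change ∑ t, m t * _ = 0 at h
    simp only [mul_sub, Finset.sum_sub_distrib, ← Finset.sum_mul, hs] at h
    simpa using h
  change m t = 0
  refine Fin.cases ?_ hsucc t
  rw [Fin.sum_univ_succ] at hs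
  simpa [hsucc] using hs

theorem rho_g (n T' : ℕ) (WS : Finset (Fin (T' + 1) → ℝ))
    (πs : Fin n → (Fin (T' + 1) → ℝ) → ℝ) (hG : IsUnit (gram n T' WS πs).det)
    (hp : ∑ w ∈ WS, pibar n T' πs w = 1) :
    ∃ a : ℝ, (∀ t w, rho n T' WS πs t w = a * g n T' WS πs t w) ∧
      a * (∑ s : Fin (T' + 1), ∑ w' ∈ WS, pibar n T' πs w' * (g n T' WS πs s w') ^ 2) = 1 := by
  obtain ⟨-, a, c, hr⟩ := rho_form n T' WS πs
  have hms : ∑ s, wpi n T' WS πs s = ∑ w ∈ WS, pibar n T' πs w * ∑ s, w s := by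
    simp only [wpi, Finset.mul_sum]
    rw [Finset.sum_comm]
  have hc : ∀ t, c t = - (a * (wpi n T' WS πs t - (∑ s, wpi n T' WS πs s) / (T' + 1))) := by
    intro t
    have h := mean_zero n T' WS πs hG t
    have e : ∑ w ∈ WS, pibar n T' πs w * rho n T' WS πs t w
        = a * (wpi n T' WS πs t - (∑ s, wpi n T' WS πs s) / (T' + 1))
          + (∑ w ∈ WS, pibar n T' πs w) * c t := by
      rw [hms]
      simp only [wpi, Finset.sum_div, ← Finset.sum_sub_distrib, Finset.mul_sum, Finset.sum_mul,
        ← Finset.sum_add_distrib]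
      refine Finset.sum_congr rfl fun w _ => ?_
      rw [hr, ← Finset.sum_div, ← Finset.mul_sum]
      ring
    rw [e, hp] at h
    linarith
  have hrg : ∀ t w, rho n T' WS πs t w = a * g n T' WS πs t w := by
    intro t w
    rw [hr, hc, g]
    ring
  refine ⟨a, hrg, ?_⟩
  have h := key n T' WS πs hG (Sum.inl ())
  simp only [zv, lam, Sum.elim_inl] at h
  rw [← h, Finset.mul_sum]
  refine Finset.sum_congr rfl fun t _ => ?_
  have h0 := mean_zero n T' WS πs hG t
  have e : ∀ w, w t - (∑ s, w s) / (T' + 1) = g n T' WS πs t w +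
      (wpi n T' WS πs t - (∑ s, wpi n T' WS πs s) / (T' + 1)) := by
    intro w
    rw [g]
    ring
  generalize wpi n T' WS πs t - (∑ s, wpi n T' WS πs s) / (T' + 1) = D at e
  simp only [e, mul_add, Finset.sum_add_distrib]
  rw [← Finset.sum_mul, h0, zero_mul, add_zero, Finset.mul_sum]
  refine Finset.sum_congr rfl fun w _ => ?_
  rw [hrg]
  ring

theorem uniq (T' : ℕ) (WS : Finset (Fin (T' + 1) → ℝ))
    (hli : LinearIndependent ℝ
      (fun v : ((WS : Set (Fin (T' + 1) → ℝ)) \ {0} : Set (Fin (T' + 1) → ℝ)) =>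
        (v : Fin (T' + 1) → ℝ)))
    (hspan : (fun _ => (1 : ℝ)) ∉
      Submodule.span ℝ ((WS : Set (Fin (T' + 1) → ℝ)) \ {0}))
    (d : (Fin (T' + 1) → ℝ) → ℝ) (hd : ∑ w ∈ WS, d w = 0) (K : ℝ)
    (hK : ∀ t, ∑ w ∈ WS, d w * w t = K) : ∀ w ∈ WS, d w = 0 := by
  classical
  have hv : ∑ w ∈ WS, d w • w = fun _ => K := by
    funext t
    simpa using hK t
  have hK0 : K = 0 := by
    by_contra hne
    apply hspan
    have : (fun _ => (1 : ℝ)) = K⁻¹ • ∑ w ∈ WS, d w • w := by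
      rw [hv]
      funext t
      simp [hne]
    rw [this]
    refine Submodule.smul_mem _ _ (Submodule.sum_mem _ fun w hw => ?_)
    by_cases h0 : w = 0
    · simp [h0]
    · exact Submodule.smul_mem _ _ (Submodule.subset_span ⟨hw, h0⟩)
  have hv' : ∑ w ∈ WS.erase 0, d w • w = 0 := by
    have : ∑ w ∈ WS.erase 0, d w • w = ∑ w ∈ WS, d w • w :=
      Finset.sum_erase _ (by simp)
    rw [this, hv, hK0]
    rfl
  have hnz : ∀ w ∈ WS, w ≠ 0 → d w = 0 := by
    have hl : LinearIndepOn ℝ id ((WS.erase 0 : Finset _) : Set (Fin (T' + 1) → ℝ)) := by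
      rw [Finset.coe_erase]
      exact hli
    rw [linearIndepOn_finset_iff] at hl
    intro w hw h0
    exact hl d hv' w (Finset.mem_erase.2 ⟨h0, hw⟩)
  intro w hw
  by_cases h0 : w = 0
  · subst h0
    rwa [Finset.sum_eq_single_of_mem _ hw fun b hb hb0 => hnz b hb hb0] at hd
  · exact hnz w hw h0

/-- Athey–Imbens, TWFE: when the nonzero treatment paths are linearly
independent and their span excludes `1_T`, (a) the unique implicit design is the constant
design `π̄(w) = (1/n) Σ_j π*_j(w)`, Gram-consistent regardless of whether it equals `π*`;
(b) `π*` equals the implicit design iff `π*` is constant across units; (c) the implicit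
estimand places weight `π̄(w) g_t(w) / (Σ_s Σ_{w'} π̄(w') g_s(w')²)` on `y_{it}(w)`. -/
theorem twfe_athey_imbens
    (n T' : ℕ) (WS : Finset (Fin (T' + 1) → ℝ))
    (hbin : ∀ w ∈ WS, ∀ t, w t = 0 ∨ w t = 1)
    (hli : LinearIndependent ℝ
      (fun v : ((WS : Set (Fin (T' + 1) → ℝ)) \ {0} : Set (Fin (T' + 1) → ℝ)) =>
        (v : Fin (T' + 1) → ℝ)))
    (hspan : (fun _ => (1 : ℝ)) ∉
      Submodule.span ℝ ((WS : Set (Fin (T' + 1) → ℝ)) \ {0}))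
    (πs : Fin n → (Fin (T' + 1) → ℝ) → ℝ)
    (hpos : ∀ i, ∀ w ∈ WS, 0 ≤ πs i w) (hsum : ∀ i, ∑ w ∈ WS, πs i w = 1)
    (hG : IsUnit (gram n T' WS πs).det) :
    (ImplicitDesign n T' WS πs (fun _ w => pibar n T' πs w)
      ∧ (∀ q, ImplicitDesign n T' WS πs q → ∀ i, ∀ w ∈ WS, q i w = pibar n T' πs w)
      ∧ gram n T' WS (fun _ w => pibar n T' πs w) = gram n T' WS πs)
    ∧ ((∀ i, ∀ w ∈ WS, πs i w = pibar n T' πs w) ↔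
        (∀ i j, ∀ w ∈ WS, πs i w = πs j w))
    ∧ (∀ (t : Fin (T' + 1)), ∀ w ∈ WS,
        pibar n T' πs w * rho n T' WS πs t w
          = pibar n T' πs w * g n T' WS πs t w
            / (∑ s : Fin (T' + 1), ∑ w' ∈ WS, pibar n T' πs w' * (g n T' WS πs s w') ^ 2)) := by
  have hn : n ≠ 0 := by
    rintro rfl
    have : gram 0 T' WS πs = 0 := by simp [gram]
    rw [this, Matrix.det_zero] at hG
    simp at hG
  have hn' : (n : ℝ) ≠ 0 := by exact_mod_cast hn
  have hp : ∑ w ∈ WS, pibar n T' πs w = 1 := by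
    simp only [pibar, ← Finset.mul_sum]
    rw [Finset.sum_comm]
    simp [hsum, hn']
  obtain ⟨a, hrg, ha⟩ := rho_g n T' WS πs hG hp
  have ha0 : a ≠ 0 := left_ne_zero_of_mul_eq_one ha
  refine ⟨⟨⟨fun _ t => mean_zero n T' WS πs hG t, fun _ => hp⟩, ?_, ?_⟩, ?_, ?_⟩
  · rintro q ⟨hq, hq1⟩ i w hw
    have hz : ∀ t, ∑ w ∈ WS, (q i w - pibar n T' πs w) * g n T' WS πs t w = 0 := by
      intro t
      have h1 := hq i t
      have h2 := mean_zero n T' WS πs hG t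
      have h3 : a * ∑ w ∈ WS, (q i w - pibar n T' πs w) * g n T' WS πs t w = 0 := by
        rw [← sub_zero (0 : ℝ)]
        nth_rewrite 1 [← h1]
        rw [← h2, ← Finset.sum_sub_distrib, Finset.mul_sum]
        refine Finset.sum_congr rfl fun w _ => ?_
        rw [hrg]
        ring
      exact (mul_eq_zero.1 h3).resolve_left ha0
    have hd : ∑ w ∈ WS, (q i w - pibar n T' πs w) = 0 := by
      rw [Finset.sum_sub_distrib, hq1, hp, sub_self]
    refine sub_eq_zero.1 (uniq T' WS hli hspan (fun w => q i w - pibar n T' πs w) hd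
      (∑ w ∈ WS, (q i w - pibar n T' πs w) * ((∑ s, w s) / (T' + 1))) (fun t => ?_) w hw)
    have e : ∑ w ∈ WS, (q i w - pibar n T' πs w) * g n T' WS πs t w
        = ∑ w ∈ WS, (q i w - pibar n T' πs w) * w t
          - ∑ w ∈ WS, (q i w - pibar n T' πs w) * ((∑ s, w s) / (T' + 1))
          - (∑ w ∈ WS, (q i w - pibar n T' πs w)) *
            (wpi n T' WS πs t - (∑ s, wpi n T' WS πs s) / (T' + 1)) := by
      rw [Finset.sum_mul, ← Finset.sum_sub_distrib, ← Finset.sum_sub_distrib]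
      refine Finset.sum_congr rfl fun w _ => ?_
      rw [g]
      ring
    rw [hz, hd] at e
    linarith
  · ext j k
    rw [gram_eq, gram_eq]
    simp only [pibar_const n T' hn]
  · constructor
    · intro h i j w hw
      rw [h i w hw, h j w hw]
    · intro h i w hw
      rw [pibar, Finset.sum_congr rfl fun j _ => h j i w hw]
      simp
      field_simp
  · intro t w hw
    have hS := right_ne_zero_of_mul_eq_one ha
    rw [hrg, eq_div_iff hS]
    linear_combination (pibar n T' πs w * g n T' WS πs t w) * ha
end Stmt8
end

section
/- Consider the interacted specification Y_i = γ_0 + τ_0 W_i + τ_1'(W_i x_{1i}) + γ_1'x_{2i} + ε_i with binary treatment, where x_{1i}, x_{2i} are subvectors of x_i, and let τ = (τ_0, τ_1')' be the coefficients of interest. Let (δ_0, δ_1) be the population projection coefficients of π*_i on (1, x_{2i}) and (Γ_0, Γ_1) the population projection coefficients of π*_i x_{1i} on (1, x_{2i}). Then an implicit design exists if and only if (δ_0 + δ_1'x_{2i}) x_{1i} = Γ_0 + Γ_1 x_{2i} for all i; when it exists, the implicit design is uniquely π_i = δ_0 + δ_1'x_{2i}. Consequently, if τ is a vector of causal contrasts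 under π*, then π*_i = δ_0 + δ_1'x_{2i} and π*_i x_{1i} = Γ_0 + Γ_1 x_{2i} for all i. -/
open Matrix BigOperators

namespace Stmt9

/-- Covariate transform for `Y_i = γ_0 + τ_0 W_i + τ_1'(W_i x_{1i}) + γ_1'x_{2i} + ε_i`:
`(1, w, w·x_{1i}, x_{2i})`. -/
def zv (n d1 d2 : ℕ) (x1 : Fin n → Fin d1 → ℝ) (x2 : Fin n → Fin d2 → ℝ)
    (i : Fin n) (w : Bool) : (Unit ⊕ Unit ⊕ Fin d1 ⊕ Fin d2) → ℝ :=
  Sum.elim (fun _ => 1)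
    (Sum.elim (fun _ => if w then 1 else 0)
      (Sum.elim (fun m => (if w then (1 : ℝ) else 0) * x1 i m) (x2 i)))

/-- Contrast matrix picking out the coefficients `(τ_0, τ_1')`. -/
def lam (d1 d2 : ℕ) : Matrix (Unit ⊕ Fin d1) (Unit ⊕ Unit ⊕ Fin d1 ⊕ Fin d2) ℝ :=
  Matrix.of
    (Sum.elim
      (fun _ => Sum.elim (fun _ => (0 : ℝ))
        (Sum.elim (fun _ => 1) (Sum.elim (fun _ => 0) (fun _ => 0))))
      (fun m => Sum.elim (fun _ => (0 : ℝ))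
        (Sum.elim (fun _ => 0)
          (Sum.elim (fun m' => if m' = m then 1 else 0) (fun _ => 0)))))

/-- Gram matrix of a binary-treatment design `p`. -/
noncomputable def gram (n d1 d2 : ℕ) (x1 : Fin n → Fin d1 → ℝ) (x2 : Fin n → Fin d2 → ℝ)
    (p : Fin n → ℝ) :
    Matrix (Unit ⊕ Unit ⊕ Fin d1 ⊕ Fin d2) (Unit ⊕ Unit ⊕ Fin d1 ⊕ Fin d2) ℝ :=
  (n : ℝ)⁻¹ • ∑ i : Fin n,
    (p i • vecMulVec (zv n d1 d2 x1 x2 i true) (zv n d1 d2 x1 x2 i true)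
      + (1 - p i) • vecMulVec (zv n d1 d2 x1 x2 i false) (zv n d1 d2 x1 x2 i false))

/-- Potential weights `ρ_i(w) = Λ G_n⁻¹ z(x_i,w) ∈ ℝ^{1+d1}`, relative to the true
design `πs`. -/
noncomputable def rho (n d1 d2 : ℕ) (x1 : Fin n → Fin d1 → ℝ) (x2 : Fin n → Fin d2 → ℝ)
    (πs : Fin n → ℝ) (i : Fin n) (w : Bool) : (Unit ⊕ Fin d1) → ℝ :=
  (lam d1 d2 * (gram n d1 d2 x1 x2 πs)⁻¹) *ᵥ zv n d1 d2 x1 x2 i w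

/-- Vector regression estimand `τ = (τ_0, τ_1')`. -/
noncomputable def tau (n d1 d2 : ℕ) (x1 : Fin n → Fin d1 → ℝ) (x2 : Fin n → Fin d2 → ℝ)
    (πs : Fin n → ℝ) (y : Fin n → Bool → ℝ) : (Unit ⊕ Fin d1) → ℝ :=
  (lam d1 d2 * (gram n d1 d2 x1 x2 πs)⁻¹) *ᵥ ((n : ℝ)⁻¹ •
    ∑ i : Fin n, ((πs i * y i true) • zv n d1 d2 x1 x2 i true
      + ((1 - πs i) * y i false) • zv n d1 d2 x1 x2 i false))

/-- Level irrelevance of the vector of contrasts `τ` under `πs`. -/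
def LevelIrrelevance (n d1 d2 : ℕ) (x1 : Fin n → Fin d1 → ℝ) (x2 : Fin n → Fin d2 → ℝ)
    (πs : Fin n → ℝ) : Prop :=
  ∀ (y : Fin n → Bool → ℝ) (c : Fin n → ℝ),
    tau n d1 d2 x1 x2 πs (fun i w => y i w + c i) = tau n d1 d2 x1 x2 πs y

/-- `q` is an (improper) implicit design. -/
def ImplicitDesign (n d1 d2 : ℕ) (x1 : Fin n → Fin d1 → ℝ) (x2 : Fin n → Fin d2 → ℝ)
    (πs : Fin n → ℝ) (q : Fin n → ℝ) : Prop :=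
  ∀ i, q i • rho n d1 d2 x1 x2 πs i true + (1 - q i) • rho n d1 d2 x1 x2 πs i false = 0

/-- Mixed regressor. -/
def zq (n d1 d2 : ℕ) (x1 : Fin n → Fin d1 → ℝ) (x2 : Fin n → Fin d2 → ℝ)
    (i : Fin n) (q : ℝ) : (Unit ⊕ Unit ⊕ Fin d1 ⊕ Fin d2) → ℝ :=
  Sum.elim (fun _ => 1)
    (Sum.elim (fun _ => q)
      (Sum.elim (fun m => q * x1 i m) (x2 i)))

/-- Vector with vanishing contrast coefficients. -/
def mkv (d1 d2 : ℕ) (a : ℝ) (b : Fin d2 → ℝ) : (Unit ⊕ Unit ⊕ Fin d1 ⊕ Fin d2) → ℝ :=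
  Sum.elim (fun _ => a) (Sum.elim (fun _ => 0) (Sum.elim (fun _ => 0) b))

lemma zq_eq (n d1 d2 : ℕ) (x1 : Fin n → Fin d1 → ℝ) (x2 : Fin n → Fin d2 → ℝ)
    (i : Fin n) (q : ℝ) :
    q • zv n d1 d2 x1 x2 i true + (1 - q) • zv n d1 d2 x1 x2 i false = zq n d1 d2 x1 x2 i q := by
  ext k
  rcases k with k | k | k | k <;> (simp [zv, zq]; try ring)

lemma lam_zero (d1 d2 : ℕ) (v : (Unit ⊕ Unit ⊕ Fin d1 ⊕ Fin d2) → ℝ) :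
    lam d1 d2 *ᵥ v = 0 ↔ ∃ a b, v = mkv d1 d2 a b := by
  constructor
  · intro h
    refine ⟨v (Sum.inl ()), fun j => v (Sum.inr (Sum.inr (Sum.inr j))), ?_⟩
    ext k
    rcases k with k | k | k | k
    · simp [mkv]
    · have := congrFun h (Sum.inl ())
      simpa [lam, mulVec, dotProduct, mkv] using this
    · have := congrFun h (Sum.inr k)
      simpa [lam, mulVec, dotProduct, mkv] using this
    · simp [mkv]
  · rintro ⟨a, b, rfl⟩
    ext k
    rcases k with k | k <;> simp [lam, mulVec, dotProduct, mkv]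

lemma zv_dot (n d1 d2 : ℕ) (x1 : Fin n → Fin d1 → ℝ) (x2 : Fin n → Fin d2 → ℝ)
    (i : Fin n) (w : Bool) (a : ℝ) (b : Fin d2 → ℝ) :
    zv n d1 d2 x1 x2 i w ⬝ᵥ mkv d1 d2 a b = a + b ⬝ᵥ x2 i := by
  simp [zv, mkv, dotProduct, mul_comm]

lemma gram_mkv (n d1 d2 : ℕ) (x1 : Fin n → Fin d1 → ℝ) (x2 : Fin n → Fin d2 → ℝ)
    (p : Fin n → ℝ) (a : ℝ) (b : Fin d2 → ℝ) :
    gram n d1 d2 x1 x2 p *ᵥ mkv d1 d2 a b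
      = (n : ℝ)⁻¹ • ∑ j, (a + b ⬝ᵥ x2 j) • zq n d1 d2 x1 x2 j (p j) := by
  unfold gram
  rw [smul_mulVec, sum_mulVec]
  congr 1
  refine Finset.sum_congr rfl fun j _ => ?_
  rw [add_mulVec, smul_mulVec, smul_mulVec, vecMulVec_mulVec, vecMulVec_mulVec, zv_dot, zv_dot,
    ← zq_eq]
  ext k
  simp
  ring

lemma impl_iff (n d1 d2 : ℕ) (x1 : Fin n → Fin d1 → ℝ) (x2 : Fin n → Fin d2 → ℝ)
    (πs : Fin n → ℝ) (hG : IsUnit (gram n d1 d2 x1 x2 πs).det) (i : Fin n) (q : ℝ) :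
    q • rho n d1 d2 x1 x2 πs i true + (1 - q) • rho n d1 d2 x1 x2 πs i false = 0 ↔
    ∃ a b, (n : ℝ)⁻¹ • ∑ j, (a + b ⬝ᵥ x2 j) • zq n d1 d2 x1 x2 j (πs j)
      = zq n d1 d2 x1 x2 i q := by
  unfold rho
  rw [← mulVec_smul, ← mulVec_smul, ← mulVec_add, zq_eq, ← mulVec_mulVec, lam_zero]
  refine exists_congr fun a => exists_congr fun b => ?_
  rw [← gram_mkv]
  constructor
  · intro h
    rw [← h, mulVec_mulVec, mul_nonsing_inv _ hG, one_mulVec]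
  · intro h
    rw [← h, mulVec_mulVec, nonsing_inv_mul _ hG, one_mulVec]

lemma normal_eq (n d2 : ℕ) (x2 : Fin n → Fin d2 → ℝ) (v : Fin n → ℝ) (δ0 : ℝ) (δ1 : Fin d2 → ℝ)
    (hδ : ∀ (a : ℝ) (b : Fin d2 → ℝ),
      (∑ i : Fin n, (v i - δ0 - δ1 ⬝ᵥ x2 i) ^ 2)
        ≤ ∑ i : Fin n, (v i - a - b ⬝ᵥ x2 i) ^ 2) (a : ℝ) (b : Fin d2 → ℝ) :
    ∑ i, (a + b ⬝ᵥ x2 i) * v i = ∑ i, (a + b ⬝ᵥ x2 i) * (δ0 + δ1 ⬝ᵥ x2 i) := by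
  set E := ∑ i, (a + b ⬝ᵥ x2 i) * (v i - δ0 - δ1 ⬝ᵥ x2 i) with hE
  set F := ∑ i, (a + b ⬝ᵥ x2 i) ^ 2 with hF
  have key : ∀ t : ℝ, 0 ≤ t ^ 2 * F - 2 * t * E := by
    intro t
    have h := hδ (δ0 + t * a) (δ1 + t • b)
    have h2 : ∑ i : Fin n, (v i - (δ0 + t * a) - (δ1 + t • b) ⬝ᵥ x2 i) ^ 2
        = ∑ i : Fin n, (v i - δ0 - δ1 ⬝ᵥ x2 i) ^ 2 + (t ^ 2 * F - 2 * t * E) := by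
      rw [hE, hF, Finset.mul_sum, Finset.mul_sum, ← Finset.sum_sub_distrib,
        ← Finset.sum_add_distrib]
      refine Finset.sum_congr rfl fun i _ => ?_
      rw [add_dotProduct, smul_dotProduct, smul_eq_mul]
      ring
    linarith
  have hF0 : 0 ≤ F := Finset.sum_nonneg fun i _ => sq_nonneg _
  have hE0 : E = 0 := by
    have h := key (E / (F + 1))
    have e : (E / (F + 1)) ^ 2 * F - 2 * (E / (F + 1)) * E
        = - (E ^ 2 * (F + 2) / (F + 1) ^ 2) := by
      field_simp
      ring
    rw [e] at h
    by_contra hne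
    have : 0 < E ^ 2 * (F + 2) / (F + 1) ^ 2 := by positivity
    linarith
  have : ∑ i, (a + b ⬝ᵥ x2 i) * v i - ∑ i, (a + b ⬝ᵥ x2 i) * (δ0 + δ1 ⬝ᵥ x2 i) = E := by
    rw [hE, ← Finset.sum_sub_distrib]
    exact Finset.sum_congr rfl fun i _ => by ring
  linarith

lemma min_row (n d1 d2 : ℕ) (x2 : Fin n → Fin d2 → ℝ) (v : Fin n → Fin d1 → ℝ)
    (Γ0 : Fin d1 → ℝ) (Γ1 : Matrix (Fin d1) (Fin d2) ℝ)
    (hΓ : ∀ (a : Fin d1 → ℝ) (B : Matrix (Fin d1) (Fin d2) ℝ),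
      (∑ i : Fin n, ∑ m : Fin d1, (v i m - Γ0 m - (Γ1 *ᵥ x2 i) m) ^ 2)
        ≤ ∑ i : Fin n, ∑ m : Fin d1, (v i m - a m - (B *ᵥ x2 i) m) ^ 2)
    (m : Fin d1) (a : ℝ) (b : Fin d2 → ℝ) :
    (∑ i : Fin n, (v i m - Γ0 m - Γ1 m ⬝ᵥ x2 i) ^ 2)
        ≤ ∑ i : Fin n, (v i m - a - b ⬝ᵥ x2 i) ^ 2 := by
  have h := hΓ (Function.update Γ0 m a) (Γ1.updateRow m b)
  rw [Finset.sum_comm (s := (Finset.univ : Finset (Fin n))) (t := (Finset.univ : Finset (Fin d1)))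
      (f := fun i m => (v i m - Γ0 m - (Γ1 *ᵥ x2 i) m) ^ 2),
    Finset.sum_comm (s := (Finset.univ : Finset (Fin n))) (t := (Finset.univ : Finset (Fin d1)))
      (f := fun i m' => (v i m' - Function.update Γ0 m a m' - (Γ1.updateRow m b *ᵥ x2 i) m') ^ 2),
    ← Finset.add_sum_erase _ _ (Finset.mem_univ m),
    ← Finset.add_sum_erase _ _ (Finset.mem_univ m)] at h
  have e : ∑ m' ∈ Finset.univ.erase m, ∑ i : Fin n,
      (v i m' - Function.update Γ0 m a m'
        - (Γ1.updateRow m b *ᵥ x2 i) m') ^ 2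
      = ∑ m' ∈ Finset.univ.erase m, ∑ i : Fin n, (v i m' - Γ0 m' - (Γ1 *ᵥ x2 i) m') ^ 2 := by
    refine Finset.sum_congr rfl fun m' hm => Finset.sum_congr rfl fun i _ => ?_
    have hm' := Finset.ne_of_mem_erase hm
    simp [mulVec, Function.update_of_ne hm', updateRow_ne hm']
  rw [e] at h
  have h' := le_of_add_le_add_right h
  simpa [mulVec] using h'

lemma lin_sum (n d2 : ℕ) (x2 : Fin n → Fin d2 → ℝ) (f : Fin n → ℝ) (a : ℝ) (b : Fin d2 → ℝ) :
    ∑ j, f j * (a + b ⬝ᵥ x2 j) = a * ∑ j, f j + ∑ k, b k * ∑ j, f j * x2 j k := by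
  simp only [mul_add, Finset.sum_add_distrib, dotProduct, Finset.mul_sum]
  rw [Finset.sum_comm]
  congr 1
  · exact Finset.sum_congr rfl fun j _ => by ring
  · exact Finset.sum_congr rfl fun j _ => Finset.sum_congr rfl fun k _ => by ring

lemma lin_sol (n d2 : ℕ) (x2 : Fin n → Fin d2 → ℝ) (i : Fin n) (f v : Fin n → ℝ) (c : ℝ)
    (h1 : c * ∑ j, f j = 1) (h2 : ∀ k, c * ∑ j, f j * x2 j k = x2 i k)
    (a : ℝ) (b : Fin d2 → ℝ) (hv : ∑ j, f j * v j = ∑ j, f j * (a + b ⬝ᵥ x2 j)) :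
    c * ∑ j, f j * v j = a + b ⬝ᵥ x2 i := by
  rw [hv, lin_sum, mul_add, mul_left_comm, h1, mul_one, Finset.mul_sum, dotProduct]
  congr 1
  refine Finset.sum_congr rfl fun k _ => ?_
  rw [mul_left_comm, h2]

lemma exists_sol (n d1 d2 : ℕ) (x1 : Fin n → Fin d1 → ℝ) (x2 : Fin n → Fin d2 → ℝ)
    (πs : Fin n → ℝ) (hG : IsUnit (gram n d1 d2 x1 x2 πs).det) (i : Fin n) :
    ∃ (a : ℝ) (b : Fin d2 → ℝ), (n : ℝ)⁻¹ * ∑ j, (a + b ⬝ᵥ x2 j) = 1 ∧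
      ∀ k, (n : ℝ)⁻¹ * ∑ j, (a + b ⬝ᵥ x2 j) * x2 j k = x2 i k := by
  have hn : (n : ℝ)⁻¹ ≠ 0 := by
    have : n ≠ 0 := by
      rintro rfl
      exact i.elim0
    positivity
  let L : (ℝ × (Fin d2 → ℝ)) →ₗ[ℝ] (ℝ × (Fin d2 → ℝ)) :=
    { toFun := fun u => ((n : ℝ)⁻¹ * ∑ j, (u.1 + u.2 ⬝ᵥ x2 j),
        fun k => (n : ℝ)⁻¹ * ∑ j, (u.1 + u.2 ⬝ᵥ x2 j) * x2 j k)
      map_add' := by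
        intro u w
        ext
        · simp only [Prod.fst_add, Prod.snd_add, add_dotProduct]
          rw [← mul_add, ← Finset.sum_add_distrib]
          congr 1
          exact Finset.sum_congr rfl fun j _ => by ring
        · simp only [Prod.fst_add, Prod.snd_add, add_dotProduct, Pi.add_apply]
          rw [← mul_add, ← Finset.sum_add_distrib]
          congr 1
          exact Finset.sum_congr rfl fun j _ => by ring
      map_smul' := by
        intro t u
        ext
        · simp only [Prod.smul_fst, Prod.smul_snd, smul_dotProduct, smul_eq_mul, RingHom.id_apply]
          simp only [Finset.mul_sum]
          exact Finset.sum_congr rfl fun j _ => by ring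
        · simp only [Prod.smul_fst, Prod.smul_snd, smul_dotProduct, smul_eq_mul, RingHom.id_apply,
            Pi.smul_apply]
          simp only [Finset.mul_sum]
          exact Finset.sum_congr rfl fun j _ => by ring }
  have hinj : Function.Injective L := by
    rw [injective_iff_map_eq_zero]
    rintro ⟨a, b⟩ h
    have h1 : ∑ j, (a + b ⬝ᵥ x2 j) = 0 := by
      have : (n : ℝ)⁻¹ * ∑ j, (a + b ⬝ᵥ x2 j) = 0 := congrArg Prod.fst h
      exact (mul_eq_zero.mp this).resolve_left hn
    have h2 : ∀ k, ∑ j, (a + b ⬝ᵥ x2 j) * x2 j k = 0 := by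
      intro k
      have : (n : ℝ)⁻¹ * ∑ j, (a + b ⬝ᵥ x2 j) * x2 j k = 0 := congrFun (congrArg Prod.snd h) k
      exact (mul_eq_zero.mp this).resolve_left hn
    have h3 : ∑ j, (a + b ⬝ᵥ x2 j) * (a + b ⬝ᵥ x2 j) = 0 := by
      rw [lin_sum n d2 x2 _ a b, h1]
      simp [h2]
    have h4 : ∀ j, a + b ⬝ᵥ x2 j = 0 := by
      intro j
      have := (Finset.sum_eq_zero_iff_of_nonneg (fun j _ => mul_self_nonneg _)).mp h3 j
        (Finset.mem_univ j)
      exact mul_self_eq_zero.mp this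
    have h5 : gram n d1 d2 x1 x2 πs *ᵥ mkv d1 d2 a b = 0 := by
      rw [gram_mkv]
      simp [h4]
    have h6 : mkv d1 d2 a b = 0 := by
      rw [← one_mulVec (mkv d1 d2 a b), ← nonsing_inv_mul _ hG, ← mulVec_mulVec, h5, mulVec_zero]
    ext k
    · exact congrFun h6 (Sum.inl ())
    · exact congrFun h6 (Sum.inr (Sum.inr (Sum.inr k)))
  obtain ⟨⟨a, b⟩, h⟩ := (LinearMap.injective_iff_surjective.mp hinj) (1, x2 i)
  exact ⟨a, b, congrArg Prod.fst h, fun k => congrFun (congrArg Prod.snd h) k⟩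

/-- forbidden interactions: with `(δ_0, δ_1)` the population projection
coefficients of `π*_i` on `(1, x_{2i})` and `(Γ_0, Γ_1)` those of `π*_i x_{1i}` on
`(1, x_{2i})`, an implicit design exists iff `(δ_0 + δ_1'x_{2i}) x_{1i} = Γ_0 + Γ_1 x_{2i}`
for all `i`; when it exists it is uniquely `π_i = δ_0 + δ_1'x_{2i}`; consequently if `τ`
is a vector of causal contrasts under `π*`, then `π*_i = δ_0 + δ_1'x_{2i}` and
`π*_i x_{1i} = Γ_0 + Γ_1 x_{2i}` for all `i`. -/
theorem forbidden_interactions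
    (n d1 d2 : ℕ) (x1 : Fin n → Fin d1 → ℝ) (x2 : Fin n → Fin d2 → ℝ)
    (πs : Fin n → ℝ) (h01 : ∀ i, 0 ≤ πs i ∧ πs i ≤ 1)
    (hG : IsUnit (gram n d1 d2 x1 x2 πs).det)
    (δ0 : ℝ) (δ1 : Fin d2 → ℝ)
    (hδ : ∀ (a : ℝ) (b : Fin d2 → ℝ),
      (∑ i : Fin n, (πs i - δ0 - δ1 ⬝ᵥ x2 i) ^ 2)
        ≤ ∑ i : Fin n, (πs i - a - b ⬝ᵥ x2 i) ^ 2)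
    (Γ0 : Fin d1 → ℝ) (Γ1 : Matrix (Fin d1) (Fin d2) ℝ)
    (hΓ : ∀ (a : Fin d1 → ℝ) (B : Matrix (Fin d1) (Fin d2) ℝ),
      (∑ i : Fin n, ∑ m : Fin d1, (πs i * x1 i m - Γ0 m - (Γ1 *ᵥ x2 i) m) ^ 2)
        ≤ ∑ i : Fin n, ∑ m : Fin d1, (πs i * x1 i m - a m - (B *ᵥ x2 i) m) ^ 2) :
    ((∃ q : Fin n → ℝ, ImplicitDesign n d1 d2 x1 x2 πs q) ↔
      ∀ (i : Fin n) (m : Fin d1),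
        (δ0 + δ1 ⬝ᵥ x2 i) * x1 i m = Γ0 m + (Γ1 *ᵥ x2 i) m)
    ∧ (∀ q : Fin n → ℝ, ImplicitDesign n d1 d2 x1 x2 πs q →
        ∀ i, q i = δ0 + δ1 ⬝ᵥ x2 i)
    ∧ (LevelIrrelevance n d1 d2 x1 x2 πs →
        (∀ i, πs i = δ0 + δ1 ⬝ᵥ x2 i)
        ∧ (∀ (i : Fin n) (m : Fin d1), πs i * x1 i m = Γ0 m + (Γ1 *ᵥ x2 i) m)) := by
  have nδ := normal_eq n d2 x2 πs δ0 δ1 hδ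
  have nΓ := fun m => normal_eq n d2 x2 (fun i => πs i * x1 i m) (Γ0 m) (Γ1 m)
    (min_row n d1 d2 x2 (fun i m => πs i * x1 i m) Γ0 Γ1 hΓ m)
  have fwd : ∀ q : Fin n → ℝ, ImplicitDesign n d1 d2 x1 x2 πs q →
      ∀ i, q i = δ0 + δ1 ⬝ᵥ x2 i ∧ ∀ m, q i * x1 i m = Γ0 m + (Γ1 *ᵥ x2 i) m := by
    intro q hq i
    obtain ⟨a, b, h⟩ := (impl_iff n d1 d2 x1 x2 πs hG i (q i)).mp (hq i)
    have e1 : (n : ℝ)⁻¹ * ∑ j, (a + b ⬝ᵥ x2 j) = 1 := by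
      have := congrFun h (Sum.inl ())
      simpa [zq, Finset.sum_apply] using this
    have e2 : ∀ k, (n : ℝ)⁻¹ * ∑ j, (a + b ⬝ᵥ x2 j) * x2 j k = x2 i k := by
      intro k
      have := congrFun h (Sum.inr (Sum.inr (Sum.inr k)))
      simpa [zq, Finset.sum_apply] using this
    have e3 : (n : ℝ)⁻¹ * ∑ j, (a + b ⬝ᵥ x2 j) * πs j = q i := by
      have := congrFun h (Sum.inr (Sum.inl ()))
      simpa [zq, Finset.sum_apply] using this
    have e4 : ∀ m, (n : ℝ)⁻¹ * ∑ j, (a + b ⬝ᵥ x2 j) * (πs j * x1 j m) = q i * x1 i m := by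
      intro m
      have := congrFun h (Sum.inr (Sum.inr (Sum.inl m)))
      simpa [zq, Finset.sum_apply] using this
    refine ⟨?_, fun m => ?_⟩
    · rw [← e3]
      exact lin_sol n d2 x2 i _ _ _ e1 e2 _ _ (nδ a b)
    · rw [← e4]
      exact lin_sol n d2 x2 i _ _ _ e1 e2 _ _ (nΓ m a b)
  refine ⟨⟨?_, ?_⟩, fun q hq i => (fwd q hq i).1, ?_⟩
  · rintro ⟨q, hq⟩ i m
    rw [← (fwd q hq i).1]
    exact (fwd q hq i).2 m
  · intro h
    refine ⟨fun i => δ0 + δ1 ⬝ᵥ x2 i, fun i => ?_⟩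
    rw [impl_iff n d1 d2 x1 x2 πs hG]
    obtain ⟨a, b, e1, e2⟩ := exists_sol n d1 d2 x1 x2 πs hG i
    refine ⟨a, b, ?_⟩
    have e3 := lin_sol n d2 x2 i _ _ _ e1 e2 _ _ (nδ a b)
    have e4 := fun m => lin_sol n d2 x2 i _ _ _ e1 e2 _ _ (nΓ m a b)
    ext k
    rcases k with k | k | k | k
    · simpa [zq, Finset.sum_apply] using e1
    · simpa [zq, Finset.sum_apply] using e3
    · have := h i k
      simp only [zq, Finset.sum_apply, Pi.smul_apply, Sum.elim_inl, Sum.elim_inr, smul_eq_mul]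
      rw [this]
      exact e4 k
    · simpa [zq, Finset.sum_apply] using e2 k
  · intro hL
    have hI : ImplicitDesign n d1 d2 x1 x2 πs πs := by
      intro i
      have hn : (n : ℝ)⁻¹ ≠ 0 := by
        have : n ≠ 0 := by
          rintro rfl
          exact i.elim0
        positivity
      have h := hL (fun _ _ => 0) (fun j => if j = i then 1 else 0)
      unfold tau at h
      simp only [zero_add, mul_zero, zero_smul, add_zero, Finset.sum_const_zero, smul_zero,
        mulVec_zero, mul_ite, mul_one, ite_smul] at h
      rw [Finset.sum_add_distrib, Finset.sum_ite_eq' , Finset.sum_ite_eq'] at h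
      simp only [Finset.mem_univ, if_true] at h
      rw [mulVec_smul] at h
      have h' := (smul_eq_zero.mp h).resolve_left hn
      rw [mulVec_add, mulVec_smul, mulVec_smul] at h'
      exact h'
    refine ⟨fun i => (fwd πs hI i).1, fun i => (fwd πs hI i).2⟩

end Stmt9
end

section
/- Consider the two-way fixed effects regression with time-varying covariates Y_{it} = α_i + γ_t + τ W_{it} + δ'x_{it} + ε_{it}, with 𝒲 ⊂ {0,1}^T and τ the coefficient of interest; let β_{w→x} be the population projection coefficient of W_{it} on x_{it} under π*, including unit and time fixed effects. Then a necessary condition for the set of implicit designs to be nonempty is that (x_i − (1/n) Σ_{j=1}^n x_j) β_{w→x} lies in the linear span of 𝒲 ∪ {1_T} for every unit i, where x_i is the T×dim(x) matrix of unit i's covariates. Moreover, when β_{w→x} = 0 and 𝒲 contains linearly independent vectors whose span excludes 1_T, the implicit design is uniquely equal to π_i(w) = (1/n) Σ_{j=1}^n π*_j(w) for all i. -/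
open Matrix BigOperators

namespace Stmt10

/-- Covariate transform for `Y_{it} = α_i + γ_t + τ W_{it} + δ'x_{it} + ε_{it}`: the
within-transformed treatment, within-transformed time dummies (for periods `1,…,T-1`),
and within-transformed time-varying covariates. -/
noncomputable def zv (n T' p : ℕ) (xc : Fin n → Fin (T' + 1) → Fin p → ℝ)
    (i : Fin n) (t : Fin (T' + 1)) (w : Fin (T' + 1) → ℝ) :
    (Unit ⊕ Fin T' ⊕ Fin p) → ℝ :=
  Sum.elim (fun _ => w t - (∑ s, w s) / (T' + 1))
    (Sum.elim (fun s => (if t = Fin.succ s then (1 : ℝ) else 0) - (T' + 1 : ℝ)⁻¹)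
      (fun m => xc i t m - (∑ s, xc i s m) / (T' + 1)))

/-- The contrast vector picking out the coefficient on `W_{it}`. -/
def lam (T' p : ℕ) : (Unit ⊕ Fin T' ⊕ Fin p) → ℝ :=
  Sum.elim (fun _ => 1) (Sum.elim (fun _ => 0) (fun _ => 0))

/-- Gram matrix of a design `q` on the set `WS` of treatment paths. -/
noncomputable def gram (n T' p : ℕ) (WS : Finset (Fin (T' + 1) → ℝ))
    (xc : Fin n → Fin (T' + 1) → Fin p → ℝ) (q : Fin n → (Fin (T' + 1) → ℝ) → ℝ) :
    Matrix (Unit ⊕ Fin T' ⊕ Fin p) (Unit ⊕ Fin T' ⊕ Fin p) ℝ :=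
  (n : ℝ)⁻¹ • ∑ i : Fin n, ∑ t : Fin (T' + 1), ∑ w ∈ WS,
    q i w • vecMulVec (zv n T' p xc i t w) (zv n T' p xc i t w)

/-- Potential weights `ρ_{it}(w) = Λ G_n⁻¹ z_{it}(w)`, relative to the true design `πs`. -/
noncomputable def rho (n T' p : ℕ) (WS : Finset (Fin (T' + 1) → ℝ))
    (xc : Fin n → Fin (T' + 1) → Fin p → ℝ) (πs : Fin n → (Fin (T' + 1) → ℝ) → ℝ)
    (i : Fin n) (t : Fin (T' + 1)) (w : Fin (T' + 1) → ℝ) : ℝ :=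
  lam T' p ⬝ᵥ ((gram n T' p WS xc πs)⁻¹ *ᵥ zv n T' p xc i t w)

/-- `q` is an (improper) implicit design. -/
def ImplicitDesign (n T' p : ℕ) (WS : Finset (Fin (T' + 1) → ℝ))
    (xc : Fin n → Fin (T' + 1) → Fin p → ℝ) (πs q : Fin n → (Fin (T' + 1) → ℝ) → ℝ) : Prop :=
  (∀ (i : Fin n) (t : Fin (T' + 1)), ∑ w ∈ WS, q i w * rho n T' p WS xc πs i t w = 0)
  ∧ (∀ i, ∑ w ∈ WS, q i w = 1)

/-- The population two-way fixed effects least-squares objective for regressing `W_{it}`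
on `x_{it}`, unit fixed effects `α`, and time fixed effects `γ`, under `πs`. -/
noncomputable def wxObj (n T' p : ℕ) (WS : Finset (Fin (T' + 1) → ℝ))
    (xc : Fin n → Fin (T' + 1) → Fin p → ℝ) (πs : Fin n → (Fin (T' + 1) → ℝ) → ℝ)
    (b : Fin p → ℝ) (α : Fin n → ℝ) (γ : Fin (T' + 1) → ℝ) : ℝ :=
  ∑ i : Fin n, ∑ t : Fin (T' + 1), ∑ w ∈ WS,
    πs i w * (w t - α i - γ t - b ⬝ᵥ (fun m => xc i t m)) ^ 2


/-- Residual. -/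
noncomputable def res (n T' p : ℕ) (xc : Fin n → Fin (T' + 1) → Fin p → ℝ)
    (b : Fin p → ℝ) (α : Fin n → ℝ) (γ : Fin (T' + 1) → ℝ)
    (i : Fin n) (t : Fin (T' + 1)) (w : Fin (T' + 1) → ℝ) : ℝ :=
  w t - α i - γ t - b ⬝ᵥ (fun m => xc i t m)

lemma lin_zero {A B : ℝ} (h : ∀ ε : ℝ, 0 ≤ -2 * ε * A + ε ^ 2 * B) : A = 0 := by
  by_contra hA
  have hB : 0 < |B| + 1 := by positivity
  have h1 := h (A / (|B| + 1))
  have h2 : -2 * (A / (|B| + 1)) * A + (A / (|B| + 1)) ^ 2 * B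
      = (A / (|B| + 1)) ^ 2 * (B - 2 * (|B| + 1)) := by
    field_simp
    ring
  rw [h2] at h1
  have h3 : 0 < (A / (|B| + 1)) ^ 2 := by positivity
  have h4 : B - 2 * (|B| + 1) < 0 := by
    have := le_abs_self B
    have := abs_nonneg B
    linarith
  nlinarith

lemma normal_eq (n T' p : ℕ) (WS : Finset (Fin (T' + 1) → ℝ))
    (xc : Fin n → Fin (T' + 1) → Fin p → ℝ)
    (πs : Fin n → (Fin (T' + 1) → ℝ) → ℝ)
    (β : Fin p → ℝ) (α : Fin n → ℝ) (γ : Fin (T' + 1) → ℝ)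
    (h : ∀ (b' : Fin p → ℝ) (α' : Fin n → ℝ) (γ' : Fin (T' + 1) → ℝ),
        wxObj n T' p WS xc πs β α γ ≤ wxObj n T' p WS xc πs b' α' γ')
    (b : Fin p → ℝ) (a : Fin n → ℝ) (g : Fin (T' + 1) → ℝ) :
    ∑ i, ∑ t, ∑ w ∈ WS, πs i w *
      (res n T' p xc β α γ i t w * (a i + g t + b ⬝ᵥ (fun m => xc i t m))) = 0 := by
  apply lin_zero (B := ∑ i, ∑ t, ∑ w ∈ WS, πs i w * (a i + g t + b ⬝ᵥ (fun m => xc i t m)) ^ 2)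
  intro ε
  have h1 := h (β + ε • b) (α + ε • a) (γ + ε • g)
  have h2 : wxObj n T' p WS xc πs (β + ε • b) (α + ε • a) (γ + ε • g)
      = wxObj n T' p WS xc πs β α γ + (-2 * ε * (∑ i, ∑ t, ∑ w ∈ WS, πs i w *
      (res n T' p xc β α γ i t w * (a i + g t + b ⬝ᵥ (fun m => xc i t m))))
      + ε ^ 2 * ∑ i, ∑ t, ∑ w ∈ WS, πs i w * (a i + g t + b ⬝ᵥ (fun m => xc i t m)) ^ 2) := by
    unfold wxObj res
    simp only [Finset.mul_sum, ← Finset.sum_add_distrib]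
    refine Finset.sum_congr rfl fun i _ => Finset.sum_congr rfl fun t _ =>
      Finset.sum_congr rfl fun w _ => ?_
    simp only [add_dotProduct, smul_dotProduct, Pi.add_apply, Pi.smul_apply, smul_eq_mul]
    ring
  linarith

/-- Coefficient vector. -/
def vv (T' p : ℕ) (β : Fin p → ℝ) (γ : Fin (T' + 1) → ℝ) : (Unit ⊕ Fin T' ⊕ Fin p) → ℝ :=
  Sum.elim (fun _ => 1) (Sum.elim (fun s => γ 0 - γ s.succ) (fun m => - β m))

lemma zv_dot (n T' p : ℕ) (xc : Fin n → Fin (T' + 1) → Fin p → ℝ)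
    (β : Fin p → ℝ) (α : Fin n → ℝ) (γ : Fin (T' + 1) → ℝ)
    (i : Fin n) (t : Fin (T' + 1)) (w : Fin (T' + 1) → ℝ) :
    zv n T' p xc i t w ⬝ᵥ vv T' p β γ =
      res n T' p xc β α γ i t w - (∑ s, res n T' p xc β α γ i s w) / (T' + 1) := by
  have hT : (T' + 1 : ℝ) ≠ 0 := by positivity
  have hg : ∑ s : Fin T', ((if t = Fin.succ s then (1 : ℝ) else 0) - (T' + 1 : ℝ)⁻¹) *
      (γ 0 - γ s.succ) = - γ t + (∑ s, γ s) / (T' + 1) := by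
    have h0 : ∑ s : Fin (T' + 1), ((if t = s then (1 : ℝ) else 0) - (T' + 1 : ℝ)⁻¹) *
      (γ 0 - γ s) = - γ t + (∑ s, γ s) / (T' + 1) := by
      simp only [sub_mul, Finset.sum_sub_distrib, ite_mul, one_mul, zero_mul,
        Finset.sum_ite_eq, Finset.mem_univ, if_true, ← Finset.mul_sum, Finset.sum_const,
        Finset.card_univ, Fintype.card_fin, nsmul_eq_mul]
      push_cast
      field_simp
      ring
    rw [Fin.sum_univ_succ] at h0
    simpa using h0
  have hx : ∑ m, (xc i t m - (∑ s, xc i s m) / (T' + 1)) * (- β m)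
      = - (β ⬝ᵥ fun m => xc i t m) + (∑ s, β ⬝ᵥ fun m => xc i s m) / (T' + 1) := by
    simp only [dotProduct]
    rw [Finset.sum_comm, Finset.sum_div, ← Finset.sum_neg_distrib, ← Finset.sum_add_distrib]
    refine Finset.sum_congr rfl fun m _ => ?_
    rw [← Finset.mul_sum]
    ring
  simp only [dotProduct, Fintype.sum_sum_type, zv, vv, Sum.elim_inl, Sum.elim_inr] at hx ⊢
  rw [hg, hx]
  simp only [res, Finset.sum_sub_distrib, Finset.sum_const, dotProduct,
        Finset.card_univ, Fintype.card_fin, nsmul_eq_mul]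
  push_cast
  simp
  field_simp
  ring

lemma gram_mulVec (n T' p : ℕ) (WS : Finset (Fin (T' + 1) → ℝ))
    (xc : Fin n → Fin (T' + 1) → Fin p → ℝ) (q : Fin n → (Fin (T' + 1) → ℝ) → ℝ)
    (v : (Unit ⊕ Fin T' ⊕ Fin p) → ℝ) (k) :
    (gram n T' p WS xc q *ᵥ v) k = (n : ℝ)⁻¹ * ∑ i, ∑ t, ∑ w ∈ WS,
      q i w * (zv n T' p xc i t w k * (zv n T' p xc i t w ⬝ᵥ v)) := by
  unfold gram
  simp only [smul_mulVec, sum_mulVec, Pi.smul_apply, Finset.sum_apply, smul_eq_mul,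
    vecMulVec_mulVec]
  congr 1

lemma gram_symm (n T' p : ℕ) (WS : Finset (Fin (T' + 1) → ℝ))
    (xc : Fin n → Fin (T' + 1) → Fin p → ℝ) (q : Fin n → (Fin (T' + 1) → ℝ) → ℝ) :
    (gram n T' p WS xc q)ᵀ = gram n T' p WS xc q := by
  unfold gram
  simp only [transpose_smul, transpose_sum, transpose_vecMulVec]

lemma key0 (n T' p : ℕ) (WS : Finset (Fin (T' + 1) → ℝ))
    (xc : Fin n → Fin (T' + 1) → Fin p → ℝ)
    (πs : Fin n → (Fin (T' + 1) → ℝ) → ℝ)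
    (β : Fin p → ℝ) (α : Fin n → ℝ) (γ : Fin (T' + 1) → ℝ)
    (h : ∀ (b' : Fin p → ℝ) (α' : Fin n → ℝ) (γ' : Fin (T' + 1) → ℝ),
        wxObj n T' p WS xc πs β α γ ≤ wxObj n T' p WS xc πs b' α' γ')
    (b : Fin p → ℝ) (a : Fin n → ℝ) (g : Fin (T' + 1) → ℝ) (k : Unit ⊕ Fin T' ⊕ Fin p)
    (hk : ∀ i t w, zv n T' p xc i t w k = a i + g t + b ⬝ᵥ (fun m => xc i t m))
    (hs : ∀ i, ∑ t, (a i + g t + b ⬝ᵥ (fun m => xc i t m)) = 0) :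
    (gram n T' p WS xc πs *ᵥ vv T' p β γ) k = 0 := by
  rw [gram_mulVec]
  have h1 := normal_eq n T' p WS xc πs β α γ h b a g
  have h2 : ∑ i, ∑ t, ∑ w ∈ WS, πs i w * ((a i + g t + b ⬝ᵥ (fun m => xc i t m)) *
      ((∑ s, res n T' p xc β α γ i s w) / (T' + 1))) = 0 := by
    refine Finset.sum_eq_zero fun i _ => ?_
    rw [Finset.sum_comm]
    refine Finset.sum_eq_zero fun w _ => ?_
    rw [← Finset.mul_sum, ← Finset.sum_mul, hs]
    ring
  have h3 : ∑ i, ∑ t, ∑ w ∈ WS,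
      πs i w * (zv n T' p xc i t w k * (zv n T' p xc i t w ⬝ᵥ vv T' p β γ)) = 0 - 0 := by
    refine Eq.trans ?_ (congrArg₂ (· - ·) h1 h2)
    simp only [← Finset.sum_sub_distrib]
    refine Finset.sum_congr rfl fun i _ => Finset.sum_congr rfl fun t _ =>
      Finset.sum_congr rfl fun w _ => ?_
    rw [zv_dot n T' p xc β α γ, hk]
    ring
  rw [h3]
  simp

lemma key (n T' p : ℕ) (WS : Finset (Fin (T' + 1) → ℝ))
    (xc : Fin n → Fin (T' + 1) → Fin p → ℝ)
    (πs : Fin n → (Fin (T' + 1) → ℝ) → ℝ)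
    (β : Fin p → ℝ) (α : Fin n → ℝ) (γ : Fin (T' + 1) → ℝ)
    (h : ∀ (b' : Fin p → ℝ) (α' : Fin n → ℝ) (γ' : Fin (T' + 1) → ℝ),
        wxObj n T' p WS xc πs β α γ ≤ wxObj n T' p WS xc πs b' α' γ') :
    ∃ κ : ℝ, gram n T' p WS xc πs *ᵥ vv T' p β γ = κ • lam T' p := by
  refine ⟨(gram n T' p WS xc πs *ᵥ vv T' p β γ) (Sum.inl ()), ?_⟩
  have hT : (T' + 1 : ℝ) ≠ 0 := by positivity
  funext k
  rcases k with u | s | m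
  · simp [lam]
  · rw [key0 n T' p WS xc πs β α γ h 0 (fun _ => - (T' + 1 : ℝ)⁻¹)
      (fun t => if t = Fin.succ s then (1 : ℝ) else 0)]
    · simp [lam]
    · intro i t w
      simp [zv]
      ring
    · intro i
      simp [Finset.sum_add_distrib]
      field_simp
      ring
  · rw [key0 n T' p WS xc πs β α γ h (Pi.single m 1) (fun i => - ((∑ s, xc i s m) / (T' + 1)))
      0]
    · simp [lam]
    · intro i t w
      simp [zv]
      ring
    · intro i
      simp [Finset.sum_add_distrib]
      field_simp
      ring

lemma rho_eq (n T' p : ℕ) (WS : Finset (Fin (T' + 1) → ℝ))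
    (xc : Fin n → Fin (T' + 1) → Fin p → ℝ)
    (πs : Fin n → (Fin (T' + 1) → ℝ) → ℝ)
    (hG : IsUnit (gram n T' p WS xc πs).det)
    (β : Fin p → ℝ) (α : Fin n → ℝ) (γ : Fin (T' + 1) → ℝ)
    (h : ∀ (b' : Fin p → ℝ) (α' : Fin n → ℝ) (γ' : Fin (T' + 1) → ℝ),
        wxObj n T' p WS xc πs β α γ ≤ wxObj n T' p WS xc πs b' α' γ') :
    ∃ κ : ℝ, κ ≠ 0 ∧ ∀ i t w, res n T' p xc β α γ i t w -
      (∑ s, res n T' p xc β α γ i s w) / (T' + 1) = κ * rho n T' p WS xc πs i t w := by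
  obtain ⟨κ, hκ⟩ := key n T' p WS xc πs β α γ h
  have hv : vv T' p β γ = κ • ((gram n T' p WS xc πs)⁻¹ *ᵥ lam T' p) := by
    rw [← mulVec_smul, ← hκ, mulVec_mulVec, nonsing_inv_mul _ hG, one_mulVec]
  refine ⟨κ, ?_, ?_⟩
  · rintro rfl
    have := congrFun hv (Sum.inl ())
    simp [vv] at this
  · intro i t w
    rw [← zv_dot, hv, dotProduct_smul, smul_eq_mul, rho, dotProduct_mulVec, dotProduct_comm,
      dotProduct_mulVec, dotProduct_comm, ← mulVec_transpose, transpose_nonsing_inv, gram_symm]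
    rw [dotProduct_comm (_ *ᵥ _), dotProduct_mulVec]

lemma design_iff (n T' p : ℕ) (WS : Finset (Fin (T' + 1) → ℝ))
    (xc : Fin n → Fin (T' + 1) → Fin p → ℝ)
    (πs : Fin n → (Fin (T' + 1) → ℝ) → ℝ)
    (hsum : ∀ i, ∑ w ∈ WS, πs i w = 1)
    (hG : IsUnit (gram n T' p WS xc πs).det)
    (β : Fin p → ℝ)
    (hβ : ∃ (α : Fin n → ℝ) (γ : Fin (T' + 1) → ℝ),
      ∀ (b' : Fin p → ℝ) (α' : Fin n → ℝ) (γ' : Fin (T' + 1) → ℝ),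
        wxObj n T' p WS xc πs β α γ ≤ wxObj n T' p WS xc πs b' α' γ')
    (q : Fin n → (Fin (T' + 1) → ℝ) → ℝ) (hq : ∀ i, ∑ w ∈ WS, q i w = 1) :
    (∀ (i : Fin n) (t : Fin (T' + 1)), ∑ w ∈ WS, q i w * rho n T' p WS xc πs i t w = 0) ↔
    ∀ i, ∃ c : ℝ, ∀ t, ∑ w ∈ WS, q i w * w t
      - ∑ w ∈ WS, ((n : ℝ)⁻¹ * ∑ j, πs j w) * w t
      - (fun m => xc i t m - (n : ℝ)⁻¹ * ∑ j : Fin n, xc j t m) ⬝ᵥ β = c := by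
  obtain ⟨α, γ, h⟩ := hβ
  obtain ⟨κ, hκ, hr⟩ := rho_eq n T' p WS xc πs hG β α γ h
  have hT : (T' + 1 : ℝ) ≠ 0 := by positivity
  -- condition at each t
  have hqr : ∀ i t, ∑ w ∈ WS, q i w * res n T' p xc β α γ i t w =
      ∑ w ∈ WS, q i w * w t - α i - γ t - β ⬝ᵥ (fun m => xc i t m) := by
    intro i t
    simp only [res, mul_sub, Finset.sum_sub_distrib, ← Finset.sum_mul, hq, one_mul]
  have hcond : ∀ i t, κ * ∑ w ∈ WS, q i w * rho n T' p WS xc πs i t w =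
      ∑ w ∈ WS, q i w * res n T' p xc β α γ i t w -
      (∑ s, ∑ w ∈ WS, q i w * res n T' p xc β α γ i s w) / (T' + 1) := by
    intro i t
    rw [Finset.sum_comm, Finset.sum_div, Finset.mul_sum, ← Finset.sum_sub_distrib]
    refine Finset.sum_congr rfl fun w _ => ?_
    rw [← Finset.mul_sum, mul_left_comm, ← hr]
    ring
  have hiff : (∀ (i : Fin n) (t : Fin (T' + 1)),
      ∑ w ∈ WS, q i w * rho n T' p WS xc πs i t w = 0) ↔
      ∀ i, ∃ c : ℝ, ∀ t, ∑ w ∈ WS, q i w * res n T' p xc β α γ i t w = c := by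
    refine forall_congr' fun i => ⟨fun H => ?_, ?_⟩
    · refine ⟨(∑ s, ∑ w ∈ WS, q i w * res n T' p xc β α γ i s w) / (T' + 1), fun t => ?_⟩
      · have := hcond i t
        rw [H t] at this
        linarith
    · rintro ⟨c, hc⟩ t
      have := hcond i t
      simp only [hc, Finset.sum_const, Finset.card_univ, Fintype.card_fin, nsmul_eq_mul] at this
      push_cast at this
      rw [mul_div_cancel_left₀ _ hT, sub_self] at this
      exact (mul_eq_zero.mp this).resolve_left hκ
  rw [hiff]
  -- normal equation in time
  have ht : ∀ t, ∑ i, ∑ w ∈ WS, πs i w * res n T' p xc β α γ i t w = 0 := by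
    intro t
    have h1 := normal_eq n T' p WS xc πs β α γ h 0 0 (Pi.single t 1)
    rw [← h1]
    refine Finset.sum_congr rfl fun i _ => ?_
    rw [Finset.sum_eq_single t]
    · simp
    · intro s _ hs
      simp [hs]
    · simp
  refine forall_congr' fun i => ?_
  have hn : (n : ℝ) ≠ 0 := by
    have := i.pos
    positivity
  have ht' : ∀ t, γ t = ∑ w ∈ WS, ((n : ℝ)⁻¹ * ∑ j, πs j w) * w t - (n : ℝ)⁻¹ * ∑ j, α j
      - (n : ℝ)⁻¹ * ∑ j, β ⬝ᵥ (fun m => xc j t m) := by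
    intro t
    have h1 := ht t
    simp only [res, mul_sub, Finset.sum_sub_distrib, ← Finset.sum_mul, hsum, one_mul] at h1
    simp only [Finset.sum_const, Finset.card_univ, Fintype.card_fin, nsmul_eq_mul] at h1
    rw [Finset.sum_comm] at h1
    have h2 : ∑ w ∈ WS, ((n : ℝ)⁻¹ * ∑ j, πs j w) * w t
        = (n : ℝ)⁻¹ * ∑ w ∈ WS, ∑ j, πs j w * w t := by
      rw [Finset.mul_sum]
      refine Finset.sum_congr rfl fun w _ => ?_
      rw [← Finset.sum_mul]
      ring
    rw [h2]
    field_simp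
    linarith
  have hx : ∀ t, (fun m => xc i t m - (n : ℝ)⁻¹ * ∑ j : Fin n, xc j t m) ⬝ᵥ β
      = β ⬝ᵥ (fun m => xc i t m) - (n : ℝ)⁻¹ * ∑ j, β ⬝ᵥ (fun m => xc j t m) := by
    intro t
    simp only [dotProduct]
    rw [Finset.sum_comm, Finset.mul_sum, ← Finset.sum_sub_distrib]
    refine Finset.sum_congr rfl fun m _ => ?_
    rw [← Finset.mul_sum]
    ring
  constructor
  · rintro ⟨c, hc⟩
    refine ⟨c + α i - (n : ℝ)⁻¹ * ∑ j, α j, fun t => ?_⟩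
    have h1 := hc t
    rw [hqr, ht' t] at h1
    rw [hx]
    linarith
  · rintro ⟨c, hc⟩
    refine ⟨c - α i + (n : ℝ)⁻¹ * ∑ j, α j, fun t => ?_⟩
    have h1 := hc t
    rw [hx] at h1
    rw [hqr, ht' t]
    linarith

/-- fragility of TWFE with time-varying covariates: with `β_{w→x}` the
population projection coefficient of `W_{it}` on `x_{it}` (with two-way fixed effects)
under `π*`, a necessary condition for an implicit design to exist is that
`(x_i - x̄)β_{w→x}` lies in the span of `𝒲 ∪ {1_T}` for every `i`; and when
`β_{w→x} = 0` and `𝒲` contains linearly independent vectors whose span excludes `1_T`,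
the implicit design is uniquely `π_i(w) = (1/n) Σ_j π*_j(w)`. -/
theorem twfe_time_varying_covariates
    (n T' p : ℕ) (WS : Finset (Fin (T' + 1) → ℝ))
    (hbin : ∀ w ∈ WS, ∀ t, w t = 0 ∨ w t = 1)
    (xc : Fin n → Fin (T' + 1) → Fin p → ℝ)
    (πs : Fin n → (Fin (T' + 1) → ℝ) → ℝ)
    (hpos : ∀ i, ∀ w ∈ WS, 0 ≤ πs i w) (hsum : ∀ i, ∑ w ∈ WS, πs i w = 1)
    (hG : IsUnit (gram n T' p WS xc πs).det)
    (β : Fin p → ℝ)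
    (hβ : ∃ (α : Fin n → ℝ) (γ : Fin (T' + 1) → ℝ),
      ∀ (b' : Fin p → ℝ) (α' : Fin n → ℝ) (γ' : Fin (T' + 1) → ℝ),
        wxObj n T' p WS xc πs β α γ ≤ wxObj n T' p WS xc πs b' α' γ') :
    ((∃ q, ImplicitDesign n T' p WS xc πs q) →
      ∀ i : Fin n,
        (fun t => (fun m => xc i t m - (n : ℝ)⁻¹ * ∑ j : Fin n, xc j t m) ⬝ᵥ β)
          ∈ Submodule.span ℝ ((WS : Set (Fin (T' + 1) → ℝ)) ∪ {fun _ => 1}))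
    ∧ (β = 0 →
        LinearIndependent ℝ
          (fun v : ((WS : Set (Fin (T' + 1) → ℝ)) \ {0} : Set (Fin (T' + 1) → ℝ)) =>
            (v : Fin (T' + 1) → ℝ)) →
        (fun _ => (1 : ℝ)) ∉ Submodule.span ℝ ((WS : Set (Fin (T' + 1) → ℝ)) \ {0}) →
        (ImplicitDesign n T' p WS xc πs
            (fun _ w => (n : ℝ)⁻¹ * ∑ j : Fin n, πs j w)
          ∧ ∀ q, ImplicitDesign n T' p WS xc πs q →
              ∀ i, ∀ w ∈ WS, q i w = (n : ℝ)⁻¹ * ∑ j : Fin n, πs j w)) := by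
  have hiff := design_iff n T' p WS xc πs hsum hG β hβ
  refine ⟨?_, ?_⟩
  · rintro ⟨q, hq1, hq2⟩ i
    obtain ⟨c, hc⟩ := (hiff q hq2).1 hq1 i
    have hmem : ∀ f : (Fin (T' + 1) → ℝ) → ℝ, ∑ w ∈ WS, f w • w ∈
        Submodule.span ℝ ((WS : Set (Fin (T' + 1) → ℝ)) ∪ {fun _ => 1}) := fun f =>
      Submodule.sum_mem _ fun w hw => Submodule.smul_mem _ _
        (Submodule.subset_span (Or.inl hw))
    have h1 : (fun _ => (1 : ℝ)) ∈
        Submodule.span ℝ ((WS : Set (Fin (T' + 1) → ℝ)) ∪ {fun _ => 1}) :=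
      Submodule.subset_span (Or.inr rfl)
    have h2 := Submodule.sub_mem _ (Submodule.sub_mem _ (hmem (q i))
      (hmem (fun w => (n : ℝ)⁻¹ * ∑ j, πs j w))) (Submodule.smul_mem _ c h1)
    convert h2 using 1
    funext t
    simp only [Pi.sub_apply, Finset.sum_apply, Pi.smul_apply, smul_eq_mul, mul_one]
    linarith [hc t]
  · intro hb hli hone
    subst hb
    have hbar : ∀ i : Fin n, ∑ w ∈ WS, (n : ℝ)⁻¹ * ∑ j : Fin n, πs j w = 1 := by
      intro i
      have hn : (n : ℝ) ≠ 0 := by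
        have := i.pos
        positivity
      rw [← Finset.mul_sum, Finset.sum_comm]
      simp [hsum, hn]
    refine ⟨⟨(hiff _ hbar).2 fun i => ⟨0, fun t => by simp⟩, hbar⟩, ?_⟩
    rintro q ⟨hq1, hq2⟩ i
    obtain ⟨c, hc⟩ := (hiff q hq2).1 hq1 i
    set d : (Fin (T' + 1) → ℝ) → ℝ := fun w => q i w - (n : ℝ)⁻¹ * ∑ j : Fin n, πs j w with hd
    have hdc : ∑ w ∈ WS, d w • w = c • (fun _ => (1 : ℝ)) := by
      funext t
      have h1 := hc t
      simp only [dotProduct_zero, sub_zero, ← Finset.sum_sub_distrib, ← sub_mul] at h1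
      simpa [Finset.sum_apply] using h1
    have hmem : ∑ w ∈ WS, d w • w ∈
        Submodule.span ℝ ((WS : Set (Fin (T' + 1) → ℝ)) \ {0}) := by
      refine Submodule.sum_mem _ fun w hw => ?_
      by_cases h0 : w = 0
      · simp [h0]
      · exact Submodule.smul_mem _ _ (Submodule.subset_span ⟨hw, h0⟩)
    have hc0 : c = 0 := by
      by_contra hne
      rw [hdc] at hmem
      exact hone ((Submodule.smul_mem_iff _ hne).1 hmem)
    rw [hc0, zero_smul] at hdc
    have hli' : LinearIndepOn ℝ id ((WS : Set (Fin (T' + 1) → ℝ)) \ {0}) := hli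
    have hset : ((WS : Set (Fin (T' + 1) → ℝ)) \ {0}) =
        ((WS.erase 0 : Finset (Fin (T' + 1) → ℝ)) : Set (Fin (T' + 1) → ℝ)) := by
      rw [Finset.coe_erase]
    rw [hset, linearIndepOn_finset_iff] at hli'
    have hdn : ∀ w ∈ WS.erase 0, d w = 0 := by
      apply hli' d
      simp only [id]
      rw [Finset.sum_erase _ (by simp)]
      exact hdc
    have hds : ∑ w ∈ WS, d w = 0 := by
      rw [hd, Finset.sum_sub_distrib, hq2, hbar i, sub_self]
    intro w hw
    have : d w = 0 := by
      by_cases h0 : w = 0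
      · rw [← hds]
        symm
        apply Finset.sum_eq_single_of_mem w hw
        intro v hv hvw
        exact hdn v (Finset.mem_erase.2 ⟨fun h => hvw (h.trans h0.symm), hv⟩)
      · exact hdn w (Finset.mem_erase.2 ⟨h0, hw⟩)
    exact sub_eq_zero.1 this

end Stmt10
end

section
/- Consider the two-way fixed effects specification Y_{it} = α_i + γ_t + τ W_{it} + ε_{it} estimated on an imbalanced panel where unit i is observed on a fixed set 𝒯_i ⊂ {1,…,T}, with τ the coefficient of interest. Suppose 𝒲 satisfies staggered adoption (w_t ≤ w_{t+1} for all w ∈ 𝒲 and t) and excludes always-treated units, and suppose there is a commonly observed period 𝒯 ⊂ ∩_{i=1}^n 𝒯_i on which the treatment paths have rich variation. Let π̄(w) = (1/n) Σ_{i=1}^n π*_i(w) and Q_i(w) = (Σ_{t∈𝒯_i} w_t)/|𝒯_i|. Then an implicit design exists if and only if for every t ∈ {1,…,T}: Σ_{w∈𝒲} π̄(w) Σ_{i: t∈𝒯_i} (w_t − Q_i(w)) = Σ_{w∈𝒲} Σ_{i: t∈𝒯_i} π*_i(w) (w_t − Q_i(w)). When this holds, the implicit design is unique and satisfies π_i(w)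 = π̄(w) for all i and w. -/
open Matrix BigOperators

namespace Stmt11

/-- Fraction of treated periods of path `w` within unit `i`'s observed period. -/
noncomputable def Q (T' : ℕ) (Ti : Finset (Fin (T' + 1))) (w : Fin (T' + 1) → ℝ) : ℝ :=
  (∑ t ∈ Ti, w t) / (Ti.card : ℝ)

/-- Covariate transform for the TWFE specification on an imbalanced panel: the
within-transformed (over `𝒯_i`) treatment and within-transformed time dummies for
periods `1,…,T-1`. -/
noncomputable def zv (n T' : ℕ) (Ti : Fin n → Finset (Fin (T' + 1)))
    (i : Fin n) (t : Fin (T' + 1)) (w : Fin (T' + 1) → ℝ) : (Unit ⊕ Fin T') → ℝ :=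
  Sum.elim (fun _ => w t - Q T' (Ti i) w)
    (fun s => (if t = Fin.succ s then (1 : ℝ) else 0)
      - (if Fin.succ s ∈ Ti i then ((Ti i).card : ℝ)⁻¹ else 0))

/-- The contrast vector picking out the coefficient on `W_{it}`. -/
def lam (T' : ℕ) : (Unit ⊕ Fin T') → ℝ := Sum.elim (fun _ => 1) (fun _ => 0)

/-- Gram matrix of a design `q`, summing only over observed `(i,t)`. -/
noncomputable def gram (n T' : ℕ) (Ti : Fin n → Finset (Fin (T' + 1)))
    (WS : Finset (Fin (T' + 1) → ℝ)) (q : Fin n → (Fin (T' + 1) → ℝ) → ℝ) :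
    Matrix (Unit ⊕ Fin T') (Unit ⊕ Fin T') ℝ :=
  (n : ℝ)⁻¹ • ∑ i : Fin n, ∑ t ∈ Ti i, ∑ w ∈ WS,
    q i w • vecMulVec (zv n T' Ti i t w) (zv n T' Ti i t w)

/-- Potential weights `ρ_{it}(w) = Λ G_n⁻¹ z_{it}(w)`, relative to the true design `πs`. -/
noncomputable def rho (n T' : ℕ) (Ti : Fin n → Finset (Fin (T' + 1)))
    (WS : Finset (Fin (T' + 1) → ℝ)) (πs : Fin n → (Fin (T' + 1) → ℝ) → ℝ)
    (i : Fin n) (t : Fin (T' + 1)) (w : Fin (T' + 1) → ℝ) : ℝ :=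
  lam T' ⬝ᵥ ((gram n T' Ti WS πs)⁻¹ *ᵥ zv n T' Ti i t w)

/-- `q` is an (improper) implicit design: the level-irrelevance equations hold for every
unit `i` and every observed period `t ∈ 𝒯_i`. -/
def ImplicitDesign (n T' : ℕ) (Ti : Fin n → Finset (Fin (T' + 1)))
    (WS : Finset (Fin (T' + 1) → ℝ)) (πs q : Fin n → (Fin (T' + 1) → ℝ) → ℝ) : Prop :=
  (∀ (i : Fin n), ∀ t ∈ Ti i, ∑ w ∈ WS, q i w * rho n T' Ti WS πs i t w = 0)
  ∧ (∀ i, ∑ w ∈ WS, q i w = 1)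

/-- Average assignment probabilities `π̄(w) = (1/n) Σ_i π*_i(w)`. -/
noncomputable def pibar (n T' : ℕ) (πs : Fin n → (Fin (T' + 1) → ℝ) → ℝ)
    (w : Fin (T' + 1) → ℝ) : ℝ :=
  (n : ℝ)⁻¹ * ∑ i : Fin n, πs i w

lemma Q_dev_sum (T' : ℕ) (S : Finset (Fin (T' + 1))) (hS : S.Nonempty)
    (g : Fin (T' + 1) → ℝ) : ∑ t ∈ S, (g t - Q T' S g) = 0 := by
  have hc : (S.card : ℝ) ≠ 0 := by
    have := hS.card_pos
    positivity
  rw [Finset.sum_sub_distrib, Finset.sum_const, nsmul_eq_mul, Q]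
  field_simp
  ring

lemma swap_sum (n T' : ℕ) (Ti : Fin n → Finset (Fin (T' + 1)))
    (F : Fin n → Fin (T' + 1) → ℝ) :
    ∑ t, ∑ i ∈ Finset.univ.filter (fun i : Fin n => t ∈ Ti i), F i t
      = ∑ i, ∑ t ∈ Ti i, F i t := by
  apply Finset.sum_comm'
  intro x y
  simp

lemma core (n T' : ℕ) (Ti : Fin n → Finset (Fin (T' + 1))) (hTi : ∀ i, (Ti i).Nonempty)
    (g : Fin (T' + 1) → ℝ)
    (h : ∀ t, ∑ i ∈ Finset.univ.filter (fun i : Fin n => t ∈ Ti i), (g t - Q T' (Ti i) g) = 0) :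
    ∀ i, ∀ t ∈ Ti i, g t - Q T' (Ti i) g = 0 := by
  have h1 : ∑ i, ∑ t ∈ Ti i, g t * (g t - Q T' (Ti i) g) = 0 := by
    rw [← swap_sum n T' Ti (fun i t => g t * (g t - Q T' (Ti i) g))]
    refine Finset.sum_eq_zero fun t _ => ?_
    rw [← Finset.mul_sum, h t, mul_zero]
  have h2 : ∑ i, ∑ t ∈ Ti i, (g t - Q T' (Ti i) g) ^ 2 = 0 := by
    rw [← h1]
    refine Finset.sum_congr rfl fun i _ => ?_
    have h3 : ∑ t ∈ Ti i, Q T' (Ti i) g * (g t - Q T' (Ti i) g) = 0 := by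
      rw [← Finset.mul_sum, Q_dev_sum T' _ (hTi i), mul_zero]
    rw [← sub_zero (∑ t ∈ Ti i, g t * (g t - Q T' (Ti i) g)), ← h3, ← Finset.sum_sub_distrib]
    refine Finset.sum_congr rfl fun t _ => ?_
    ring
  intro i t ht
  have h4 := (Finset.sum_eq_zero_iff_of_nonneg
    (fun i _ => Finset.sum_nonneg fun t _ => sq_nonneg (g t - Q T' (Ti i) g))).1 h2 i
    (Finset.mem_univ _)
  have h5 := (Finset.sum_eq_zero_iff_of_nonneg
    (fun t _ => sq_nonneg (g t - Q T' (Ti i) g))).1 h4 t ht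
  exact pow_eq_zero_iff (two_ne_zero) |>.1 h5

lemma Q_mean (T' : ℕ) (S : Finset (Fin (T' + 1))) (WS : Finset (Fin (T' + 1) → ℝ))
    (q : (Fin (T' + 1) → ℝ) → ℝ) :
    Q T' S (fun t => ∑ w ∈ WS, q w * w t) = ∑ w ∈ WS, q w * Q T' S w := by
  simp only [Q]
  rw [Finset.sum_comm, Finset.sum_div]
  refine Finset.sum_congr rfl fun w _ => ?_
  rw [← Finset.mul_sum, mul_div_assoc]

lemma Q_lin (T' : ℕ) (S : Finset (Fin (T' + 1))) (a : ℝ) (f b : Fin (T' + 1) → ℝ) :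
    Q T' S (fun t => a * f t + b t) = a * Q T' S f + Q T' S b := by
  simp only [Q]
  rw [Finset.sum_add_distrib, ← Finset.mul_sum]
  ring

lemma mean_rho (T' : ℕ) (S : Finset (Fin (T' + 1))) (WS : Finset (Fin (T' + 1) → ℝ))
    (q : (Fin (T' + 1) → ℝ) → ℝ) (hq : ∑ w ∈ WS, q w = 1) (a : ℝ) (b : Fin (T' + 1) → ℝ)
    (t : Fin (T' + 1)) :
    ∑ w ∈ WS, q w * (a * (w t - Q T' S w) + (b t - Q T' S b))
      = (a * (∑ w ∈ WS, q w * w t) + b t)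
        - Q T' S (fun t => a * (∑ w ∈ WS, q w * w t) + b t) := by
  rw [Q_lin, Q_mean]
  have : ∀ w ∈ WS, q w * (a * (w t - Q T' S w) + (b t - Q T' S b))
      = a * (q w * w t) - a * (q w * Q T' S w) + q w * (b t - Q T' S b) := by
    intro w _
    ring
  rw [Finset.sum_congr rfl this, Finset.sum_add_distrib, Finset.sum_sub_distrib,
    ← Finset.mul_sum, ← Finset.mul_sum, ← Finset.sum_mul, hq]
  ring

lemma rich (T' : ℕ) (WS : Finset (Fin (T' + 1) → ℝ)) (Tc : Finset (Fin (T' + 1)))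
    (hli : LinearIndependent ℝ
      (fun (w : {v : Fin (T' + 1) → ℝ // v ∈ WS ∧ v ≠ 0}) (t : Tc) =>
        (w : Fin (T' + 1) → ℝ) t))
    (hone : (fun _ : Tc => (1 : ℝ)) ∉ Submodule.span ℝ
      (Set.range (fun (w : {v : Fin (T' + 1) → ℝ // v ∈ WS ∧ v ≠ 0}) (t : Tc) =>
        (w : Fin (T' + 1) → ℝ) t)))
    (c : (Fin (T' + 1) → ℝ) → ℝ) (k : ℝ) (hk : ∀ t ∈ Tc, ∑ w ∈ WS, c w * w t = k)
    (hc : ∑ w ∈ WS, c w = 0) : ∀ w ∈ WS, c w = 0 := by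
  classical
  have hfin : Finite {v : Fin (T' + 1) → ℝ // v ∈ WS ∧ v ≠ 0} :=
    Set.Finite.subset WS.finite_toSet (fun v hv => hv.1)
  have := Fintype.ofFinite {v : Fin (T' + 1) → ℝ // v ∈ WS ∧ v ≠ 0}
  have e : ∀ F : (Fin (T' + 1) → ℝ) → ℝ, F 0 = 0 →
      ∑ w ∈ WS, F w = ∑ w : {v : Fin (T' + 1) → ℝ // v ∈ WS ∧ v ≠ 0}, F w := by
    intro F hF
    rw [← Finset.sum_filter_of_ne (p := fun w => w ≠ 0)]
    · apply Finset.sum_subtype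
      intro x
      simp
    · intro x _ hx h0
      exact hx (h0 ▸ hF)
  have hvec : ∑ w : {v : Fin (T' + 1) → ℝ // v ∈ WS ∧ v ≠ 0},
      c w • (fun t : Tc => (w : Fin (T' + 1) → ℝ) t) = k • (fun _ : Tc => (1 : ℝ)) := by
    funext t
    have := hk t t.2
    rw [e _ (by simp)] at this
    simpa [Finset.sum_apply] using this
  have hk0 : k = 0 := by
    by_contra hk0
    apply hone
    rw [← Submodule.smul_mem_iff _ hk0, ← hvec]
    exact Submodule.sum_mem _ fun w _ => Submodule.smul_mem _ _ (Submodule.subset_span ⟨w, rfl⟩)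
  rw [hk0, zero_smul] at hvec
  have hz := Fintype.linearIndependent_iff.1 hli (fun w => c w) hvec
  have hnz : ∀ w ∈ WS, w ≠ 0 → c w = 0 := fun w hw h0 => hz ⟨w, hw, h0⟩
  intro w hw
  by_cases h0 : w = 0
  · rw [← hc]
    symm
    apply Finset.sum_eq_single_of_mem w hw
    intro v hv hne
    exact hnz v hv (fun h => hne (h.trans h0.symm))
  · exact hnz w hw h0

lemma rho_form (n T' : ℕ) (Ti : Fin n → Finset (Fin (T' + 1)))
    (v : (Unit ⊕ Fin T') → ℝ) (i : Fin n) (t : Fin (T' + 1)) (w : Fin (T' + 1) → ℝ) :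
    v ⬝ᵥ zv n T' Ti i t w = v (Sum.inl ()) * (w t - Q T' (Ti i) w)
      + ((Fin.cons 0 (fun s => v (Sum.inr s)) : Fin (T' + 1) → ℝ) t
        - Q T' (Ti i) (Fin.cons 0 (fun s => v (Sum.inr s)))) := by
  simp only [dotProduct, Fintype.sum_sum_type, zv, Sum.elim_inl, Sum.elim_inr,
    Finset.univ_unique, Finset.sum_singleton, mul_sub, Finset.sum_sub_distrib]
  have h1 : ∑ s : Fin T', v (Sum.inr s) * (if t = Fin.succ s then (1 : ℝ) else 0)
      = (Fin.cons 0 (fun s => v (Sum.inr s)) : Fin (T' + 1) → ℝ) t := by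
    refine Fin.cases ?_ (fun s => ?_) t
    · simp [(Fin.succ_ne_zero _).symm]
    · simp
  have h2 : ∑ s : Fin T', v (Sum.inr s) *
        (if Fin.succ s ∈ Ti i then ((Ti i).card : ℝ)⁻¹ else 0)
      = Q T' (Ti i) (Fin.cons 0 (fun s => v (Sum.inr s))) := by
    rw [Q, ← Finset.univ_inter (Ti i), ← Finset.sum_ite_mem, Fin.sum_univ_succ]
    simp [Finset.sum_div, div_eq_mul_inv, Finset.sum_mul]
  rw [h1, h2]

lemma key (n T' : ℕ) (Ti : Fin n → Finset (Fin (T' + 1))) (hTi : ∀ i, (Ti i).Nonempty)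
    (WS : Finset (Fin (T' + 1) → ℝ)) (πs : Fin n → (Fin (T' + 1) → ℝ) → ℝ)
    (hG : IsUnit (gram n T' Ti WS πs).det) :
    (n : ℝ) ≠ 0 ∧ ∃ a b, (∀ i t w, rho n T' Ti WS πs i t w
        = a * (w t - Q T' (Ti i) w) + (b t - Q T' (Ti i) b))
      ∧ (∀ t, ∑ i ∈ Finset.univ.filter (fun i : Fin n => t ∈ Ti i),
          ∑ w ∈ WS, πs i w * rho n T' Ti WS πs i t w = 0)
      ∧ (n : ℝ)⁻¹ * ∑ i, ∑ t ∈ Ti i, ∑ w ∈ WS,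
          πs i w * (rho n T' Ti WS πs i t w * (w t - Q T' (Ti i) w)) = 1 := by
  obtain ⟨v, hv⟩ : ∃ v, v = lam T' ᵥ* (gram n T' Ti WS πs)⁻¹ := ⟨_, rfl⟩
  have hrho : ∀ i t w, rho n T' Ti WS πs i t w = v ⬝ᵥ zv n T' Ti i t w := by
    intro i t w
    rw [rho, dotProduct_mulVec, hv]
  have hvG : v ᵥ* gram n T' Ti WS πs = lam T' := by
    rw [hv, vecMul_vecMul, Matrix.nonsing_inv_mul _ hG, vecMul_one]
  have hcomp : ∀ j, (n : ℝ)⁻¹ * ∑ i, ∑ t ∈ Ti i, ∑ w ∈ WS,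
      πs i w * (rho n T' Ti WS πs i t w * zv n T' Ti i t w j) = lam T' j := by
    intro j
    rw [← hvG]
    have hg : ∀ l, gram n T' Ti WS πs l j = (n : ℝ)⁻¹ * ∑ i, ∑ t ∈ Ti i, ∑ w ∈ WS,
        πs i w * (zv n T' Ti i t w l * zv n T' Ti i t w j) := by
      intro l
      simp [gram, Matrix.sum_apply, vecMulVec_apply]
    simp only [vecMul, dotProduct, hg, hrho, Finset.mul_sum, Finset.sum_mul]
    conv_rhs => rw [Finset.sum_comm]
    refine Finset.sum_congr rfl fun i _ => ?_
    conv_rhs => rw [Finset.sum_comm]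
    refine Finset.sum_congr rfl fun t _ => ?_
    conv_rhs => rw [Finset.sum_comm]
    refine Finset.sum_congr rfl fun w _ => ?_
    refine Finset.sum_congr rfl fun l _ => ?_
    ring
  have hn : (n : ℝ) ≠ 0 := by
    intro h0
    have := hcomp (Sum.inl ())
    simp [h0, lam] at this
  refine ⟨hn, v (Sum.inl ()), Fin.cons 0 (fun s => v (Sum.inr s)), ?_, ?_, ?_⟩
  · intro i t w
    rw [hrho, rho_form]
  · have hzero : ∀ i w, ∑ t ∈ Ti i, rho n T' Ti WS πs i t w = 0 := by
      intro i w
      simp only [hrho, rho_form]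
      rw [Finset.sum_add_distrib, ← Finset.mul_sum, Q_dev_sum _ _ (hTi i), Q_dev_sum _ _ (hTi i)]
      simp
    have hsucc : ∀ s : Fin T', ∑ i ∈ Finset.univ.filter (fun i : Fin n => s.succ ∈ Ti i),
          ∑ w ∈ WS, πs i w * rho n T' Ti WS πs i s.succ w = 0 := by
      intro s
      have h := hcomp (Sum.inr s)
      simp only [lam, Sum.elim_inr, mul_eq_zero, inv_eq_zero, hn, false_or] at h
      rw [← h, Finset.sum_filter]
      refine Finset.sum_congr rfl fun i _ => ?_
      rw [Finset.sum_comm]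
      simp only [zv, Sum.elim_inr, mul_sub, Finset.sum_sub_distrib]
      simp only [← Finset.mul_sum, ← Finset.sum_mul, hzero]
      by_cases hs : s.succ ∈ Ti i <;> simp [hs]
    intro t
    refine Fin.cases ?_ hsucc t
    have hall := swap_sum n T' Ti (fun i t => ∑ w ∈ WS, πs i w * rho n T' Ti WS πs i t w)
    rw [Fin.sum_univ_succ] at hall
    simp only [hsucc, Finset.sum_const_zero, add_zero] at hall
    rw [hall]
    refine Finset.sum_eq_zero fun i _ => ?_
    rw [Finset.sum_comm]
    simp [← Finset.mul_sum, hzero]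
  · simpa [lam, zv] using hcomp (Sum.inl ())

/-- fragility of TWFE on imbalanced panels: under staggered adoption with
no always-treated path and rich variation on a commonly observed period, an implicit
design exists iff the true design is uncorrelated with the missingness pattern in the
sense of the displayed condition; and when it exists, the implicit design is unique and
equals `π̄` for every unit. -/
theorem twfe_unbalanced
    (n T' : ℕ) (Ti : Fin n → Finset (Fin (T' + 1))) (hTi : ∀ i, (Ti i).Nonempty)
    (WS : Finset (Fin (T' + 1) → ℝ))
    (hbin : ∀ w ∈ WS, ∀ t, w t = 0 ∨ w t = 1)
    (hstag : ∀ w ∈ WS, ∀ t t' : Fin (T' + 1), t ≤ t' → w t ≤ w t')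
    (hnoalways : (fun _ => (1 : ℝ)) ∉ WS)
    (Tc : Finset (Fin (T' + 1))) (hTc : ∀ i, Tc ⊆ Ti i)
    (hli : LinearIndependent ℝ
      (fun (w : {v : Fin (T' + 1) → ℝ // v ∈ WS ∧ v ≠ 0}) (t : Tc) =>
        (w : Fin (T' + 1) → ℝ) t))
    (hone : (fun _ : Tc => (1 : ℝ)) ∉ Submodule.span ℝ
      (Set.range (fun (w : {v : Fin (T' + 1) → ℝ // v ∈ WS ∧ v ≠ 0}) (t : Tc) =>
        (w : Fin (T' + 1) → ℝ) t)))
    (πs : Fin n → (Fin (T' + 1) → ℝ) → ℝ)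
    (hpos : ∀ i, ∀ w ∈ WS, 0 ≤ πs i w) (hsum : ∀ i, ∑ w ∈ WS, πs i w = 1)
    (hG : IsUnit (gram n T' Ti WS πs).det) :
    ((∃ q, ImplicitDesign n T' Ti WS πs q) ↔
      ∀ t : Fin (T' + 1),
        ∑ w ∈ WS, pibar n T' πs w *
            (∑ i ∈ Finset.univ.filter (fun i : Fin n => t ∈ Ti i), (w t - Q T' (Ti i) w))
          = ∑ w ∈ WS, ∑ i ∈ Finset.univ.filter (fun i : Fin n => t ∈ Ti i),
              πs i w * (w t - Q T' (Ti i) w))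
    ∧ ((∃ q, ImplicitDesign n T' Ti WS πs q) →
        (ImplicitDesign n T' Ti WS πs (fun _ w => pibar n T' πs w)
          ∧ ∀ q, ImplicitDesign n T' Ti WS πs q →
              ∀ i, ∀ w ∈ WS, q i w = pibar n T' πs w)) := by
  classical
  obtain ⟨hn, a, b, hrho, hstar, hnorm⟩ := key n T' Ti hTi WS πs hG
  have hmean : ∀ q : (Fin (T' + 1) → ℝ) → ℝ, ∑ w ∈ WS, q w = 1 → ∀ i t,
      ∑ w ∈ WS, q w * rho n T' Ti WS πs i t w
        = (a * (∑ w ∈ WS, q w * w t) + b t)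
        - Q T' (Ti i) (fun t => a * (∑ w ∈ WS, q w * w t) + b t) := by
    intro q hq i t
    simp only [hrho]
    exact mean_rho T' (Ti i) WS q hq a b t
  have ha : a ≠ 0 := by
    intro ha
    subst ha
    have hb := core n T' Ti hTi b (by
      intro t
      rw [← hstar t]
      refine Finset.sum_congr rfl fun i _ => ?_
      rw [hmean _ (hsum i)]
      simp)
    have : ∑ i, ∑ t ∈ Ti i, ∑ w ∈ WS,
          πs i w * (rho n T' Ti WS πs i t w * (w t - Q T' (Ti i) w)) = 0 := by
      refine Finset.sum_eq_zero fun i _ => Finset.sum_eq_zero fun t ht =>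
        Finset.sum_eq_zero fun w _ => ?_
      rw [hrho, hb i t ht]
      simp
    rw [this] at hnorm
    simp at hnorm
  have hpb : ∑ w ∈ WS, pibar n T' πs w = 1 := by
    simp only [pibar]
    rw [← Finset.mul_sum, Finset.sum_comm]
    simp [hsum, hn]
  -- difference identity for a common design
  have hdiff : ∀ q : (Fin (T' + 1) → ℝ) → ℝ, ∑ w ∈ WS, q w = 1 → ∀ t,
      ∑ i ∈ Finset.univ.filter (fun i : Fin n => t ∈ Ti i),
          ∑ w ∈ WS, q w * rho n T' Ti WS πs i t w
      = a * ∑ i ∈ Finset.univ.filter (fun i : Fin n => t ∈ Ti i),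
          ∑ w ∈ WS, (q w - πs i w) * (w t - Q T' (Ti i) w) := by
    intro q hq t
    rw [← sub_zero (∑ i ∈ Finset.univ.filter (fun i : Fin n => t ∈ Ti i),
          ∑ w ∈ WS, q w * rho n T' Ti WS πs i t w), ← hstar t, ← Finset.sum_sub_distrib,
      Finset.mul_sum]
    refine Finset.sum_congr rfl fun i _ => ?_
    have h0 : ∑ w ∈ WS, (q w - πs i w) * (b t - Q T' (Ti i) b) = 0 := by
      rw [← Finset.sum_mul, Finset.sum_sub_distrib, hq, hsum]
      simp
    rw [← add_zero (a * _), ← h0, Finset.mul_sum, ← Finset.sum_sub_distrib,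
      ← Finset.sum_add_distrib]
    refine Finset.sum_congr rfl fun w _ => ?_
    rw [hrho]
    ring
  have hcond : ∀ (q : (Fin (T' + 1) → ℝ) → ℝ) t,
      ∑ i ∈ Finset.univ.filter (fun i : Fin n => t ∈ Ti i),
          ∑ w ∈ WS, (q w - πs i w) * (w t - Q T' (Ti i) w)
      = ∑ w ∈ WS, q w *
            (∑ i ∈ Finset.univ.filter (fun i : Fin n => t ∈ Ti i), (w t - Q T' (Ti i) w))
          - ∑ w ∈ WS, ∑ i ∈ Finset.univ.filter (fun i : Fin n => t ∈ Ti i),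
              πs i w * (w t - Q T' (Ti i) w) := by
    intro q t
    rw [Finset.sum_comm, ← Finset.sum_sub_distrib]
    refine Finset.sum_congr rfl fun w _ => ?_
    rw [Finset.mul_sum, ← Finset.sum_sub_distrib]
    refine Finset.sum_congr rfl fun i _ => ?_
    ring
  have huniq : ∀ q, ImplicitDesign n T' Ti WS πs q →
      ∀ i, ∀ w ∈ WS, q i w = pibar n T' πs w := by
    rintro q ⟨hq0, hq1⟩ i
    have hcomm : ∀ j, ∀ w ∈ WS, q j w = q i w := by
      intro j w hw
      have := rich T' WS Tc hli hone (fun w => q j w - q i w)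
        ((Q T' (Ti j) (fun t => a * (∑ w ∈ WS, q j w * w t) + b t)
          - Q T' (Ti i) (fun t => a * (∑ w ∈ WS, q i w * w t) + b t)) / a)
        (by
          intro t ht
          have e1 := hq0 j t (hTc j ht)
          have e2 := hq0 i t (hTc i ht)
          rw [hmean _ (hq1 _)] at e1 e2
          simp only [sub_mul, Finset.sum_sub_distrib]
          rw [eq_div_iff ha]
          linarith)
        (by rw [Finset.sum_sub_distrib, hq1, hq1, sub_self]) w hw
      exact sub_eq_zero.1 this
    have hD : ∀ t, ∑ j ∈ Finset.univ.filter (fun i : Fin n => t ∈ Ti i),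
          ∑ w ∈ WS, (q i w - πs j w) * (w t - Q T' (Ti j) w) = 0 := by
      intro t
      have h1 := hdiff (q i) (hq1 i) t
      have h2 : ∑ j ∈ Finset.univ.filter (fun i : Fin n => t ∈ Ti i),
          ∑ w ∈ WS, q i w * rho n T' Ti WS πs j t w = 0 := by
        refine Finset.sum_eq_zero fun j hj => ?_
        rw [← hq0 j t (by simpa using hj)]
        refine Finset.sum_congr rfl fun w hw => ?_
        rw [hcomm j w hw]
      rw [h2] at h1
      exact (mul_eq_zero.1 h1.symm).resolve_left ha
    intro w hw
    have := rich T' WS Tc hli hone (fun w => ∑ j, (q i w - πs j w))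
      (∑ j, ∑ w ∈ WS, (q i w - πs j w) * Q T' (Ti j) w)
      (by
        intro t ht
        have h := hD t
        rw [Finset.filter_true_of_mem (fun j _ => hTc j ht)] at h
        have h' : ∑ j, ∑ w ∈ WS, (q i w - πs j w) * w t
            - ∑ j, ∑ w ∈ WS, (q i w - πs j w) * Q T' (Ti j) w = 0 := by
          rw [← h, ← Finset.sum_sub_distrib]
          refine Finset.sum_congr rfl fun j _ => ?_
          rw [← Finset.sum_sub_distrib]
          refine Finset.sum_congr rfl fun w _ => ?_
          ring
        rw [sub_eq_zero] at h'
        rw [← h']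
        simp only [Finset.sum_mul]
        rw [Finset.sum_comm])
      (by
        rw [Finset.sum_comm]
        refine Finset.sum_eq_zero fun j _ => ?_
        rw [Finset.sum_sub_distrib, hq1, hsum, sub_self]) w hw
    simp only [Finset.sum_sub_distrib, Finset.sum_const, Finset.card_univ, Fintype.card_fin,
      nsmul_eq_mul] at this
    rw [pibar, ← sub_eq_zero.1 this]
    field_simp
  have hpibar : (∃ q, ImplicitDesign n T' Ti WS πs q) →
      ImplicitDesign n T' Ti WS πs (fun _ w => pibar n T' πs w) := by
    rintro ⟨q, hq⟩
    refine ⟨?_, fun _ => hpb⟩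
    intro i t ht
    rw [← hq.1 i t ht]
    refine Finset.sum_congr rfl fun w hw => ?_
    rw [huniq q hq i w hw]
  refine ⟨⟨?_, ?_⟩, fun h => ⟨hpibar h, huniq⟩⟩
  · intro h t
    have hI := hpibar h
    have h1 := hdiff _ hpb t
    rw [Finset.sum_eq_zero (fun i hi => hI.1 i t (by simpa using hi)), hcond] at h1
    exact sub_eq_zero.1 ((mul_eq_zero.1 h1.symm).resolve_left ha)
  · intro h
    refine ⟨fun _ w => pibar n T' πs w, ?_, fun _ => hpb⟩
    have hc := core n T' Ti hTi (fun t => a * (∑ w ∈ WS, pibar n T' πs w * w t) + b t) (by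
      intro t
      have h1 := hdiff _ hpb t
      rw [hcond, h t, sub_self, mul_zero] at h1
      rw [← h1]
      refine Finset.sum_congr rfl fun i _ => ?_
      rw [hmean _ hpb])
    intro i t ht
    rw [hmean _ hpb]
    exact hc i t ht

end Stmt11
end

section
/- Consider the event-study-type regression Y_{it} = α_i + γ_t + β'f_t(W_i) + ε_{it} with target estimand τ = Λβ under a design π*, where f_t maps treatment paths to ℝ^m. Then: (i) regardless of whether τ satisfies level irrelevance under π*, the constant design π_i(w) = π̄(w) := (1/n) Σ_{j=1}^n π*_j(w) is a proper and Gram-consistent implicit design; (ii) if Λ is the identity and some column k of f is such that the multiset of vectors {(f_{1k}(w),…,f_{Tk}(w)) : w ∈ 𝒲} contains the zero vector at most once, has its nonzero vectors linearly independent, and has linear span not containing any nonzero constant vector c·1_T, then π̄ is the unique implicit design. -/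
open Matrix BigOperators

namespace Stmt13

/-- Covariate transform for `Y_{it} = α_i + γ_t + β'f_t(W_i) + ε_{it}`: the
within-transformed `f_t(w)` and within-transformed time dummies for periods `1,…,T-1`. -/
noncomputable def zv (T' m : ℕ) (Wt : Type) (f : Wt → Fin (T' + 1) → Fin m → ℝ)
    (t : Fin (T' + 1)) (w : Wt) : (Fin m ⊕ Fin T') → ℝ :=
  Sum.elim (fun j => f w t j - (∑ s, f w s j) / (T' + 1))
    (fun s => (if t = Fin.succ s then (1 : ℝ) else 0) - (T' + 1 : ℝ)⁻¹)

/-- Full contrast matrix `[Λ, 0]` loading only on the `f`-coefficients `β`. -/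
def lamFull (T' m k : ℕ) (Λ : Matrix (Fin k) (Fin m) ℝ) :
    Matrix (Fin k) (Fin m ⊕ Fin T') ℝ :=
  Matrix.of fun a => Sum.elim (fun j => Λ a j) (fun _ => 0)

/-- Gram matrix of a design `q` on treatment paths `Wt`. -/
noncomputable def gram (n T' m : ℕ) (Wt : Type) [Fintype Wt]
    (f : Wt → Fin (T' + 1) → Fin m → ℝ) (q : Fin n → Wt → ℝ) :
    Matrix (Fin m ⊕ Fin T') (Fin m ⊕ Fin T') ℝ :=
  (n : ℝ)⁻¹ • ∑ i : Fin n, ∑ t : Fin (T' + 1), ∑ w : Wt,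
    q i w • vecMulVec (zv T' m Wt f t w) (zv T' m Wt f t w)

/-- Potential weights `ρ_{it}(w) = [Λ,0] G_n⁻¹ z_t(w)` (they do not depend on `i`). -/
noncomputable def rho (n T' m k : ℕ) (Wt : Type) [Fintype Wt]
    (f : Wt → Fin (T' + 1) → Fin m → ℝ) (Λ : Matrix (Fin k) (Fin m) ℝ)
    (πs : Fin n → Wt → ℝ) (t : Fin (T' + 1)) (w : Wt) : Fin k → ℝ :=
  (lamFull T' m k Λ * (gram n T' m Wt f πs)⁻¹) *ᵥ zv T' m Wt f t w

/-- `q` is an (improper) implicit design. -/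
def ImplicitDesign (n T' m k : ℕ) (Wt : Type) [Fintype Wt]
    (f : Wt → Fin (T' + 1) → Fin m → ℝ) (Λ : Matrix (Fin k) (Fin m) ℝ)
    (πs q : Fin n → Wt → ℝ) : Prop :=
  (∀ (i : Fin n) (t : Fin (T' + 1)), ∑ w : Wt, q i w • rho n T' m k Wt f Λ πs t w = 0)
  ∧ (∀ i, ∑ w : Wt, q i w = 1)

/-- Average assignment probabilities `π̄(w) = (1/n) Σ_j π*_j(w)`. -/
noncomputable def pibar (n : ℕ) (Wt : Type) (πs : Fin n → Wt → ℝ) (w : Wt) : ℝ :=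
  (n : ℝ)⁻¹ * ∑ j : Fin n, πs j w

lemma gram_eq (n T' m : ℕ) (Wt : Type) [Fintype Wt]
    (f : Wt → Fin (T' + 1) → Fin m → ℝ) (q : Fin n → Wt → ℝ) :
    gram n T' m Wt f q = ∑ t : Fin (T' + 1), ∑ w : Wt,
      pibar n Wt q w • vecMulVec (zv T' m Wt f t w) (zv T' m Wt f t w) := by
  unfold gram pibar
  rw [Finset.sum_comm, Finset.smul_sum]
  refine Finset.sum_congr rfl fun t _ => ?_
  rw [Finset.sum_comm, Finset.smul_sum]
  refine Finset.sum_congr rfl fun w _ => ?_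
  rw [← Finset.sum_smul, smul_smul]

lemma pibar_const (n : ℕ) (Wt : Type) (πs : Fin n → Wt → ℝ) (w : Wt) :
    pibar n Wt (fun _ w => pibar n Wt πs w) w = pibar n Wt πs w := by
  rcases Nat.eq_zero_or_pos n with h | h
  · subst h; simp [pibar]
  · have : (n : ℝ) ≠ 0 := by positivity
    unfold pibar
    simp only [Finset.sum_const, Finset.card_univ, Fintype.card_fin, nsmul_eq_mul]
    field_simp

/-- demeaned dummies times v -/
noncomputable def cc (T' : ℕ) (v : Fin T' → ℝ) (t : Fin (T' + 1)) : ℝ :=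
  ∑ s, ((if t = Fin.succ s then (1 : ℝ) else 0) - (T' + 1 : ℝ)⁻¹) * v s

noncomputable def zbar (n T' m : ℕ) (Wt : Type) [Fintype Wt]
    (f : Wt → Fin (T' + 1) → Fin m → ℝ) (q : Fin n → Wt → ℝ) (t : Fin (T' + 1)) :
    (Fin m ⊕ Fin T') → ℝ := ∑ w, pibar n Wt q w • zv T' m Wt f t w

lemma zv_dot (T' m : ℕ) (Wt : Type) (f : Wt → Fin (T' + 1) → Fin m → ℝ)
    (t : Fin (T' + 1)) (w : Wt) (v : Fin T' → ℝ) :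
    zv T' m Wt f t w ⬝ᵥ Sum.elim 0 v = cc T' v t := by
  simp [zv, cc, dotProduct]

lemma gram_mulVec (n T' m : ℕ) (Wt : Type) [Fintype Wt]
    (f : Wt → Fin (T' + 1) → Fin m → ℝ) (q : Fin n → Wt → ℝ) (v : Fin T' → ℝ) :
    gram n T' m Wt f q *ᵥ Sum.elim 0 v = ∑ t, cc T' v t • zbar n T' m Wt f q t := by
  rw [gram_eq, Matrix.sum_mulVec]
  refine Finset.sum_congr rfl fun t _ => ?_
  rw [Matrix.sum_mulVec, zbar, Finset.smul_sum]
  refine Finset.sum_congr rfl fun w _ => ?_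
  rw [Matrix.smul_mulVec, Matrix.vecMulVec_mulVec, zv_dot]
  ext x
  simp
  ring

lemma cc_diff (T' : ℕ) (u : Fin (T' + 1) → ℝ) (t : Fin (T' + 1)) :
    cc T' (fun s => u s.succ - u 0) t = u t - (T' + 1 : ℝ)⁻¹ * ∑ s, u s := by
  unfold cc
  simp only [sub_mul, Finset.sum_sub_distrib, ← Finset.mul_sum]
  rw [Fin.sum_univ_succ u]
  have h1 : ∑ s : Fin T', (if t = Fin.succ s then (1 : ℝ) else 0) * (u s.succ - u 0)
      = u t - u 0 := by
    refine Fin.cases ?_ (fun t' => ?_) t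
    · simp [(Fin.succ_ne_zero _).symm]
    · simp [Fin.succ_inj]
  rw [h1]
  have : (T' + 1 : ℝ) ≠ 0 := by positivity
  simp only [Finset.sum_const, Finset.card_univ, Fintype.card_fin, nsmul_eq_mul]
  field_simp
  ring

lemma zv_sum (T' m : ℕ) (Wt : Type) (f : Wt → Fin (T' + 1) → Fin m → ℝ) (w : Wt) :
    ∑ t, zv T' m Wt f t w = 0 := by
  have : (T' + 1 : ℝ) ≠ 0 := by positivity
  ext x
  rw [Finset.sum_apply]
  rcases x with x | x
  · simp [zv]
    field_simp
    ring
  · simp [zv, this]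

lemma zbar_sum (n T' m : ℕ) (Wt : Type) [Fintype Wt]
    (f : Wt → Fin (T' + 1) → Fin m → ℝ) (q : Fin n → Wt → ℝ) :
    ∑ t, zbar n T' m Wt f q t = 0 := by
  unfold zbar
  rw [Finset.sum_comm]
  simp [← Finset.smul_sum, zv_sum]

lemma zbar_mem (n T' m : ℕ) (Wt : Type) [Fintype Wt]
    (f : Wt → Fin (T' + 1) → Fin m → ℝ) (q : Fin n → Wt → ℝ) (t : Fin (T' + 1)) :
    ∃ v : Fin T' → ℝ, gram n T' m Wt f q *ᵥ Sum.elim 0 v = zbar n T' m Wt f q t := by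
  refine ⟨fun s => (Pi.single t 1 : Fin (T' + 1) → ℝ) s.succ -
    (Pi.single t 1 : Fin (T' + 1) → ℝ) 0, ?_⟩
  rw [gram_mulVec]
  simp only [cc_diff, sub_smul, Finset.sum_sub_distrib, ← Finset.smul_sum, zbar_sum]
  rw [smul_zero, sub_zero, Finset.sum_eq_single t]
  · simp
  · intro b _ hb; simp [hb]
  · simp

lemma lam_elim (T' m k : ℕ) (Λ : Matrix (Fin k) (Fin m) ℝ) (v : Fin T' → ℝ) :
    lamFull T' m k Λ *ᵥ Sum.elim 0 v = 0 := by
  ext a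
  simp [lamFull, mulVec, dotProduct]

lemma rho_sum (n T' m k : ℕ) (Wt : Type) [Fintype Wt]
    (f : Wt → Fin (T' + 1) → Fin m → ℝ) (Λ : Matrix (Fin k) (Fin m) ℝ)
    (πs : Fin n → Wt → ℝ) (r : Wt → ℝ) (t : Fin (T' + 1)) :
    ∑ w, r w • rho n T' m k Wt f Λ πs t w =
      lamFull T' m k Λ *ᵥ ((gram n T' m Wt f πs)⁻¹ *ᵥ ∑ w, r w • zv T' m Wt f t w) := by
  unfold rho
  simp [Matrix.mulVec_sum, Matrix.mulVec_smul]

lemma pibar_sum (n : ℕ) (Wt : Type) [Fintype Wt] (πs : Fin n → Wt → ℝ) (i : Fin n)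
    (hsum : ∀ i, ∑ w : Wt, πs i w = 1) : ∑ w, pibar n Wt πs w = 1 := by
  have : (n : ℝ) ≠ 0 := by
    have := i.pos
    positivity
  unfold pibar
  rw [← Finset.mul_sum, Finset.sum_comm]
  simp [hsum, this]

lemma implicit_pibar (n T' m k : ℕ) (Wt : Type) [Fintype Wt]
    (f : Wt → Fin (T' + 1) → Fin m → ℝ) (Λ : Matrix (Fin k) (Fin m) ℝ)
    (πs : Fin n → Wt → ℝ) (hsum : ∀ i, ∑ w : Wt, πs i w = 1)
    (hG : IsUnit (gram n T' m Wt f πs).det) :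
    ImplicitDesign n T' m k Wt f Λ πs (fun _ w => pibar n Wt πs w) := by
  refine ⟨fun i t => ?_, fun i => pibar_sum n Wt πs i hsum⟩
  rw [rho_sum]
  obtain ⟨v, hv⟩ := zbar_mem n T' m Wt f πs t
  unfold zbar at hv
  rw [← hv, Matrix.mulVec_mulVec (Sum.elim 0 v) (gram n T' m Wt f πs)⁻¹,
    Matrix.nonsing_inv_mul _ hG, Matrix.one_mulVec, lam_elim]

lemma gram_zero (n T' m : ℕ) (Wt : Type) [Fintype Wt]
    (f : Wt → Fin (T' + 1) → Fin m → ℝ) (πs : Fin n → Wt → ℝ)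
    (hp : ∑ w, pibar n Wt πs w = 1) (v : Fin T' → ℝ)
    (h : ∀ s, (gram n T' m Wt f πs *ᵥ Sum.elim 0 v) (Sum.inr s) = 0) :
    gram n T' m Wt f πs *ᵥ Sum.elim 0 v = 0 := by
  have h1 : (gram n T' m Wt f πs *ᵥ Sum.elim 0 v) ⬝ᵥ Sum.elim 0 v = 0 := by
    simp [dotProduct, h]
  rw [gram_mulVec] at h1 ⊢
  have h2 : ∀ t, zbar n T' m Wt f πs t ⬝ᵥ Sum.elim 0 v = cc T' v t := by
    intro t
    unfold zbar
    simp only [sum_dotProduct, smul_dotProduct, zv_dot, smul_eq_mul]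
    rw [← Finset.sum_mul, hp, one_mul]
  simp only [sum_dotProduct, smul_dotProduct, h2, smul_eq_mul] at h1
  rw [Finset.sum_eq_zero_iff_of_nonneg (fun t _ => mul_self_nonneg _)] at h1
  refine Finset.sum_eq_zero fun t ht => ?_
  rw [mul_self_eq_zero.mp (h1 t ht), zero_smul]

lemma unique_part (n T' m : ℕ) (Wt : Type) [Fintype Wt]
    (f : Wt → Fin (T' + 1) → Fin m → ℝ) (Λ : Matrix (Fin m) (Fin m) ℝ) (πs : Fin n → Wt → ℝ)
    (hΛ : Λ = 1)
    (hp : ∑ w, pibar n Wt πs w = 1)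
    (hG : IsUnit (gram n T' m Wt f πs).det) (r : Wt → ℝ) (hr : ∑ w, r w = 0)
    (hrho : ∀ t, ∑ w, r w • rho n T' m m Wt f Λ πs t w = 0) (t : Fin (T' + 1)) :
    ∑ w, r w • zv T' m Wt f t w = 0 := by
  subst hΛ
  have h := hrho t
  rw [rho_sum] at h
  set Z := ∑ w, r w • zv T' m Wt f t w with hZ
  set x := (gram n T' m Wt f πs)⁻¹ *ᵥ Z with hx
  have hGx : gram n T' m Wt f πs *ᵥ x = Z := by
    rw [hx, Matrix.mulVec_mulVec, Matrix.mul_nonsing_inv _ hG, Matrix.one_mulVec]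
  have hx0 : x = Sum.elim (0 : Fin m → ℝ) (fun s => x (Sum.inr s)) := by
    ext y
    rcases y with y | y
    · have := congrFun h y
      simpa [lamFull, mulVec, dotProduct, Matrix.one_apply] using this
    · rfl
  rw [hx0] at hGx
  rw [← hGx]
  apply gram_zero _ _ _ _ _ _ hp
  intro s
  rw [hGx, hZ, Finset.sum_apply]
  simp [zv, ← Finset.sum_mul, hr]

/-- event-study / general TWFE: (i) the constant design `π̄` is a proper
and Gram-consistent implicit design regardless of level irrelevance of `τ = Λβ`; (ii) if
`Λ` is the identity and some column `j` of `f` gives a multiset of vectors containing the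
zero vector at most once, with linearly independent nonzero vectors, and whose span
contains no nonzero constant vector, then `π̄` is the unique implicit design. -/
theorem event_study
    (n T' m k : ℕ) (Wt : Type) [Fintype Wt]
    (f : Wt → Fin (T' + 1) → Fin m → ℝ) (Λ : Matrix (Fin k) (Fin m) ℝ)
    (πs : Fin n → Wt → ℝ)
    (hpos : ∀ i w, 0 ≤ πs i w) (hsum : ∀ i, ∑ w : Wt, πs i w = 1)
    (hG : IsUnit (gram n T' m Wt f πs).det) :
    (ImplicitDesign n T' m k Wt f Λ πs (fun _ w => pibar n Wt πs w)
      ∧ (∀ (i : Fin n) (w : Wt), (0 : ℝ) ≤ pibar n Wt πs w)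
      ∧ gram n T' m Wt f (fun _ w => pibar n Wt πs w) = gram n T' m Wt f πs)
    ∧ (∀ (hkm : k = m),
        (∀ a b, Λ a b = if b = Fin.cast hkm a then 1 else 0) →
        ∀ j : Fin m,
          (∀ w w' : Wt, (∀ t, f w t j = 0) → (∀ t, f w' t j = 0) → w = w') →
          LinearIndependent ℝ
            (fun (w : {w : Wt // ¬ ∀ t, f w t j = 0}) (t : Fin (T' + 1)) =>
              f w.1 t j) →
          (∀ c : ℝ, c ≠ 0 →
            (fun _ : Fin (T' + 1) => c) ∉
              Submodule.span ℝ (Set.range (fun (w : Wt) (t : Fin (T' + 1)) => f w t j))) →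
          ∀ q, ImplicitDesign n T' m k Wt f Λ πs q →
            ∀ (i : Fin n) (w : Wt), q i w = pibar n Wt πs w) := by
  refine ⟨⟨implicit_pibar n T' m k Wt f Λ πs hsum hG, ?_, ?_⟩, ?_⟩
  · intro i w
    exact mul_nonneg (by positivity) (Finset.sum_nonneg fun j _ => hpos j w)
  · rw [gram_eq, gram_eq]
    simp only [pibar_const]
  · intro hkm hΛ j hz hli hsp q hq i w
    subst hkm
    have hL : Λ = 1 := by
      ext a b
      rw [hΛ, Matrix.one_apply]
      simp [eq_comm]
    have hp := pibar_sum n Wt πs i hsum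
    have hpi := implicit_pibar n T' k k Wt f Λ πs hsum hG
    set r : Wt → ℝ := fun w => q i w - pibar n Wt πs w with hrdef
    have hr : ∑ w, r w = 0 := by
      simp only [hrdef, Finset.sum_sub_distrib, hp, hq.2 i, sub_self]
    have hrho : ∀ t, ∑ w, r w • rho n T' k k Wt f Λ πs t w = 0 := by
      intro t
      have h1 := hpi.1 i t
      have h2 := hq.1 i t
      simp only [hrdef, sub_smul, Finset.sum_sub_distrib]
      rw [h2]
      simpa using h1
    have hZ := unique_part n T' k Wt f Λ πs hL hp hG r hr hrho
    have hconst : ∃ c : ℝ, ∑ w, r w • (fun t => f w t j) = fun _ : Fin (T' + 1) => c := by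
      refine ⟨∑ w, r w * ((∑ s, f w s j) / (T' + 1)), ?_⟩
      ext t
      have := congrFun (hZ t) (Sum.inl j)
      simp only [Finset.sum_apply, Pi.smul_apply, zv, Sum.elim_inl, smul_eq_mul, mul_sub,
        Finset.sum_sub_distrib, Pi.zero_apply] at this
      simp only [Finset.sum_apply, Pi.smul_apply, smul_eq_mul]
      linarith
    obtain ⟨c, hc⟩ := hconst
    have hc0 : c = 0 := by
      by_contra hne
      apply hsp c hne
      rw [← hc]
      exact Submodule.sum_mem _ fun w _ => Submodule.smul_mem _ _
        (Submodule.subset_span ⟨w, rfl⟩)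
    subst hc0
    classical
    have hnz : ∀ w, (¬ ∀ t, f w t j = 0) → r w = 0 := by
      intro w hw
      rw [Fintype.linearIndependent_iff] at hli
      refine hli (fun w => r w.1) ?_ ⟨w, hw⟩
      have hs := Fintype.sum_subtype_add_sum_subtype (fun w => ¬ ∀ t, f w t j = 0)
        (fun w => r w • (fun t => f w t j))
      rw [hc] at hs
      have h0 : ∑ w : {w : Wt // ¬ ¬ ∀ t, f w t j = 0}, r w.1 • (fun t => f w.1 t j) = 0 := by
        refine Finset.sum_eq_zero fun w _ => ?_
        ext t
        simp [not_not.mp w.2 t]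
      rw [h0, add_zero] at hs
      exact hs
    have : r w = 0 := by
      by_cases hw : ∀ t, f w t j = 0
      · rw [← hr, Finset.sum_eq_single w]
        · intro b _ hb
          exact hnz b fun hb' => hb (hz b w hb' hw)
        · simp
      · exact hnz w hw
    simpa [hrdef, sub_eq_zero] using this

end Stmt13
end

section
/- Forbidden comparisons in TWFE: consider the two-way fixed effects specification Y_{it} = α_i + γ_t + τ W_{it} under staggered adoption (w_t ≤ w_{t+1} for all w ∈ 𝒲 and t), with treatment timing randomly assigned so that π*_i(w) = π*(w) for all i. If 𝒲 = {0_T, w} consists of one never-treated path and one treated path, then the potential weight ρ_{it}(w) is nonnegative for every post-treatment period t (those with w_t = 1) and every unit i. In every other configuration with |𝒲| ≥ 2, there exists a choice of the constant design π*(·) such that ρ_{it}(w') < 0 for some treatment path w' with π*(w') > 0 and some post-treatment period t (with w'_t = 1). -/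
open Matrix BigOperators

namespace Stmt14

/-- Potential weight of the TWFE specification under a constant design `p`:
`ρ_{it}(w) = V⁻¹ [w_t - (1_T'w)/T - Σ_{w'} p(w') w'_t + Σ_{w'} p(w') (1_T'w')/T]`
for the scalar `V > 0` coming from the Gram matrix. -/
noncomputable def rho (T : ℕ) (WS : Finset (Fin T → ℝ))
    (p : (Fin T → ℝ) → ℝ) (V : ℝ) (w : Fin T → ℝ) (t : Fin T) : ℝ :=
  V⁻¹ * (w t - (∑ s, w s) / (T : ℝ) - (∑ w' ∈ WS, p w' * w' t)
    + ∑ w' ∈ WS, p w' * ((∑ s, w' s) / (T : ℝ)))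

theorem aux_neg (T : ℕ) (hT : 0 < T) (WS : Finset (Fin T → ℝ))
    (hbin : ∀ w ∈ WS, ∀ t, w t = 0 ∨ w t = 1)
    (hstag : ∀ w ∈ WS, ∀ t t' : Fin T, t ≤ t' → w t ≤ w t')
    (a b : Fin T → ℝ) (ha : a ∈ WS) (hb : b ∈ WS) (hb0 : b ≠ fun _ => 0)
    (t₀ : Fin T) (hat : a t₀ = 1) (hbt : b t₀ = 0) :
    ∃ p : (Fin T → ℝ) → ℝ, (∀ w ∈ WS, 0 ≤ p w) ∧ (∑ w ∈ WS, p w = 1) ∧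
          ∃ w' ∈ WS, 0 < p w' ∧ ∃ t : Fin T, w' t = 1 ∧
            ∀ V : ℝ, 0 < V → rho T WS p V w' t < 0 := by
  have hlt : ∑ s, b s < ∑ s, a s := by
    apply Finset.sum_lt_sum
    · intro s _
      rcases le_total s t₀ with h | h
      · have h1 := hstag b hb s t₀ h
        rcases hbin a ha s with h2 | h2 <;> linarith
      · have h1 := hstag a ha t₀ s h
        rcases hbin b hb s with h2 | h2 <;> linarith
    · exact ⟨t₀, Finset.mem_univ _, by rw [hat, hbt]; norm_num⟩
  let l : Fin T := ⟨T - 1, by omega⟩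
  have hl : ∀ s : Fin T, s ≤ l := fun s => by
    show s.val ≤ T - 1
    have := s.isLt
    omega
  have hal : a l = 1 := by
    have h1 := hstag a ha t₀ l (hl _)
    rcases hbin a ha l with h2 | h2 <;> linarith
  have hbl : b l = 1 := by
    obtain ⟨s, hs⟩ := Function.ne_iff.mp hb0
    have h1 := hstag b hb s l (hl _)
    have h3 := (hbin b hb s).resolve_left hs
    rcases hbin b hb l with h2 | h2 <;> linarith
  let p : (Fin T → ℝ) → ℝ := fun w => (if w = a then 1/2 else 0) + (if w = b then 1/2 else 0)
  have hsum : ∀ f : (Fin T → ℝ) → ℝ, ∑ w ∈ WS, p w * f w = 1/2 * f a + 1/2 * f b := by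
    intro f
    simp only [p, add_mul, Finset.sum_add_distrib, ite_mul, zero_mul, Finset.sum_ite_eq', ha, hb,
      if_true]
  have hp : ∀ w, 0 ≤ p w := by
    intro w
    simp only [p]
    positivity
  refine ⟨p, fun w _ => hp w, ?_, a, ha, ?_, l, hal, ?_⟩
  · have := hsum (fun _ => 1)
    simp only [mul_one] at this
    rw [this]; norm_num
  · simp only [p, if_true]
    positivity
  · intro V hV
    unfold rho
    rw [hsum (fun w => w l), hsum (fun w => (∑ s, w s) / (T : ℝ))]
    simp only [hal, hbl]
    have hT' : (0 : ℝ) < T := by exact_mod_cast hT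
    have := div_lt_div_of_pos_right hlt hT'
    exact mul_neg_of_pos_of_neg (inv_pos.mpr hV) (by linarith)

/-- forbidden comparisons in TWFE under staggered adoption with randomly
assigned treatment timing: if `𝒲 = {0, w₀}` with a never-treated path, then all
post-treatment potential weights on the treated path are nonnegative; in every other
configuration with `|𝒲| ≥ 2` there is a constant design making some post-treatment
potential weight negative on a path of positive probability. -/
theorem forbidden_comparisons
    (T : ℕ) (hT : 0 < T) (WS : Finset (Fin T → ℝ))
    (hbin : ∀ w ∈ WS, ∀ t, w t = 0 ∨ w t = 1)
    (hstag : ∀ w ∈ WS, ∀ t t' : Fin T, t ≤ t' → w t ≤ w t') :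
    (∀ w₀ : Fin T → ℝ, w₀ ≠ (fun _ => 0) → WS = {(fun _ => 0), w₀} →
      ∀ p : (Fin T → ℝ) → ℝ, (∀ w ∈ WS, 0 ≤ p w) → (∑ w ∈ WS, p w = 1) →
        ∀ V : ℝ, 0 < V → ∀ t : Fin T, w₀ t = 1 → 0 ≤ rho T WS p V w₀ t)
    ∧ (2 ≤ WS.card → (∀ w₀ : Fin T → ℝ, WS ≠ {(fun _ => 0), w₀}) →
        ∃ p : (Fin T → ℝ) → ℝ, (∀ w ∈ WS, 0 ≤ p w) ∧ (∑ w ∈ WS, p w = 1) ∧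
          ∃ w' ∈ WS, 0 < p w' ∧ ∃ t : Fin T, w' t = 1 ∧
            ∀ V : ℝ, 0 < V → rho T WS p V w' t < 0) := by
  have hT' : (0 : ℝ) < T := by exact_mod_cast hT
  constructor
  · intro w₀ hw₀ hWS p hp hp1 V hV t ht
    have hmem : w₀ ∈ WS := by rw [hWS]; simp
    have hp0 : 0 ≤ p (fun _ => 0) := hp _ (by rw [hWS]; simp)
    have hne : (fun _ => 0) ≠ w₀ := hw₀.symm
    have hm : (∑ s, w₀ s) / (T : ℝ) ≤ 1 := by
      rw [div_le_one hT']
      calc ∑ s, w₀ s ≤ ∑ s : Fin T, (1 : ℝ) := Finset.sum_le_sum (fun s _ => by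
            rcases hbin w₀ hmem s with h | h <;> rw [h]; norm_num)
        _ = T := by simp
    rw [hWS, Finset.sum_pair hne] at hp1
    unfold rho
    rw [hWS, Finset.sum_pair hne, Finset.sum_pair hne]
    apply mul_nonneg (inv_pos.mpr hV).le
    simp only [ht, Finset.sum_const_zero, zero_div, mul_zero, zero_add]
    generalize (∑ s, w₀ s) / (T : ℝ) = m at *
    have : p w₀ = 1 - p (fun _ => 0) := by linarith
    rw [this]
    nlinarith [mul_nonneg hp0 (sub_nonneg.mpr hm)]
  · intro hc hW
    have hc2 : 1 < (WS.erase (fun _ => 0)).card := by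
      by_contra hcon
      push Not at hcon
      have h0 : (fun _ => 0) ∈ WS := by
        by_contra h
        rw [Finset.erase_eq_of_notMem h] at hcon
        omega
      have h1 := Finset.card_erase_of_mem h0
      obtain ⟨x, hx⟩ := Finset.card_eq_one.mp (show (WS.erase (fun _ => 0)).card = 1 by omega)
      apply hW x
      rw [← hx, Finset.insert_erase h0]
    obtain ⟨a, ha, b, hb, hab⟩ := Finset.one_lt_card.mp hc2
    obtain ⟨ha0, ha⟩ := Finset.mem_erase.mp ha
    obtain ⟨hb0, hb⟩ := Finset.mem_erase.mp hb
    obtain ⟨t, ht⟩ := Function.ne_iff.mp hab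
    rcases hbin a ha t with h1 | h1 <;> rcases hbin b hb t with h2 | h2
    · exact absurd (h1.trans h2.symm) ht
    · exact aux_neg T hT WS hbin hstag b a hb ha ha0 t h2 h1
    · exact aux_neg T hT WS hbin hstag a b ha hb hb0 t h1 h2
    · exact absurd (h1.trans h2.symm) ht

end Stmt14
end
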